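/- arXiv:1508.04387 — 5 statements merged into one kernel-verified Lean document; each statement's English description precedes it below -/
import Mathlib

section
/- (Khutoretskii) There is a uniformly c.e. sequence (ν_i)_{i∈ℕ} of pairwise incomparable Friedberg numberings of 𝒫⁽¹⁾: each ν_i is an injective computable numbering of all partial computable functions, the map (i,j,x) ↦ ν_i(j)(x) is partial computable, and for i ≠ j, ν_i ≰ ν_j. -/
/-- The set of all partial computable functions ℕ ⇀ ℕ. -/
def PCF : Set (ℕ →. ℕ) := {f | Nat.Partrec f}

/-- ν is a numbering of A: every value lies in A and ν is onto A. -/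
def IsNumbering (A : Set (ℕ →. ℕ)) (ν : ℕ → ℕ →. ℕ) : Prop :=
  (∀ i, ν i ∈ A) ∧ ∀ f ∈ A, ∃ i, ν i = f

/-- A computable numbering: (i,x) ↦ ν i x is partial computable. -/
def IsCompNumbering (A : Set (ℕ →. ℕ)) (ν : ℕ → ℕ →. ℕ) : Prop :=
  IsNumbering A ν ∧ Partrec₂ ν

/-- A Friedberg numbering: computable and injective. -/
def IsFriedberg (A : Set (ℕ →. ℕ)) (ν : ℕ → ℕ →. ℕ) : Prop :=
  IsCompNumbering A ν ∧ Function.Injective ν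

/-- ν is reducible to μ via a total computable function. -/
def Reducible (ν μ : ℕ → ℕ →. ℕ) : Prop :=
  ∃ f : ℕ → ℕ, Computable f ∧ ∀ n, ν n = μ (f n)

/-- g is a subfunction of f (graph inclusion). -/
def Subfn (g f : ℕ →. ℕ) : Prop := ∀ x y, y ∈ g x → y ∈ f x

/-- g is a finite subfunction of f. -/
def FinSubfn (g f : ℕ →. ℕ) : Prop := g.Dom.Finite ∧ Subfn g f

/-- A sequence of numberings is uniformly c.e. -/
def UniformlyCE (ν : ℕ → ℕ → ℕ →. ℕ) : Prop :=
  Partrec₂ (fun p : ℕ × ℕ => ν p.1 p.2)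

/-! ### Computability preliminaries -/

section Preliminaries

variable {α : Type*} [Primcodable α]

theorem primrecPred_ball_lt {R : α → ℕ → Prop} {b : α → ℕ}
    (hR : PrimrecPred fun p : α × ℕ => R p.1 p.2) (hb : Primrec b) :
    PrimrecPred fun a => ∀ x < b a, R a x := by
  have hR' : PrimrecRel fun (x : ℕ) (a : α) => R a x :=
    PrimrecPred.comp hR (Primrec.snd.pair Primrec.fst)
  exact (hR'.forall_mem_list.comp (Primrec.list_range.comp hb) Primrec.id).of_eq (by simp)

theorem primrecPred_bex_lt {R : α → ℕ → Prop} {b : α → ℕ}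
    (hR : PrimrecPred fun p : α × ℕ => R p.1 p.2) (hb : Primrec b) :
    PrimrecPred fun a => ∃ x < b a, R a x := by
  have hR' : PrimrecRel fun (x : ℕ) (a : α) => R a x :=
    PrimrecPred.comp hR (Primrec.snd.pair Primrec.fst)
  exact (hR'.exists_mem_list.comp (Primrec.list_range.comp hb) Primrec.id).of_eq (by simp)

/-- A single-valued projection of a primitive recursive relation is the graph of a partial
computable function. -/
theorem exists_partrec_of_graph {G : α → ℕ → ℕ → Prop}
    (hG : PrimrecPred fun p : α × ℕ × ℕ => G p.1 p.2.1 p.2.2)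
    (huniq : ∀ a y y' s s', G a y s → G a y' s' → y = y') :
    ∃ f : α →. ℕ, Partrec f ∧ ∀ a y, y ∈ f a ↔ ∃ s, G a y s := by
  classical
  let T : α → ℕ → Option ℕ := fun a k =>
    if G a k.unpair.1 k.unpair.2 then some k.unpair.1 else none
  have hT : Computable₂ T := by
    have h1 : Primrec fun p : α × ℕ => (p.1, p.2.unpair.1, p.2.unpair.2) :=
      Primrec.fst.pair (Primrec.unpair.comp Primrec.snd)
    have h2 : Primrec fun p : α × ℕ => some p.2.unpair.1 :=
      Primrec.option_some.comp (Primrec.fst.comp (Primrec.unpair.comp Primrec.snd))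
    exact (Primrec.ite (hG.comp h1) h2 (Primrec.const none)).to_comp
  refine ⟨fun a => Nat.rfindOpt (T a), Partrec.rfindOpt hT, fun a y => ⟨fun h => ?_, ?_⟩⟩
  · obtain ⟨k, hk⟩ := Nat.rfindOpt_spec h
    simp only [T, Option.mem_def, Option.ite_none_right_eq_some, Option.some.injEq] at hk
    exact ⟨_, hk.2 ▸ hk.1⟩
  · rintro ⟨s, hs⟩
    have hd : (Nat.rfindOpt (T a)).Dom :=
      Nat.rfindOpt_dom.2 ⟨Nat.pair y s, y, by simp [T, hs]⟩
    obtain ⟨z, hz⟩ := Part.dom_iff_mem.1 hd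
    obtain ⟨k, hk⟩ := Nat.rfindOpt_spec hz
    simp only [T, Option.mem_def, Option.ite_none_right_eq_some, Option.some.injEq] at hk
    rw [huniq _ _ _ _ _ hs hk.1, hk.2]
    exact hz

theorem exists_computable_enumeration {α : Type*} [Denumerable α] {V : α → Prop}
    (hV : PrimrecPred V) (hinf : {a | V a}.Infinite) :
    ∃ b : ℕ → α, Computable b ∧ Function.Injective b ∧ Set.range b = {a | V a} := by
  classical
  let p : ℕ → Prop := fun n => V (Denumerable.ofNat α n)
  have hp : PrimrecPred p := hV.comp (Primrec.ofNat α)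
  have hpinf : (Set.ofPred p).Infinite := by
    have : Set.InjOn (Encodable.encode : α → ℕ) {a | V a} := Encodable.encode_injective.injOn
    refine (hinf.image this).mono ?_
    rintro _ ⟨a, ha, rfl⟩
    simpa [p] using ha
  have hcount : Primrec (Nat.count p) := by
    have h : Primrec fun n : ℕ => Nat.rec (motive := fun _ => ℕ) 0
        (fun m c => if p m then c + 1 else c) n := by
      refine Primrec.nat_rec₁ 0 (Primrec.ite (hp.comp Primrec.fst) ?_ Primrec.snd)
      exact Primrec.succ.comp Primrec.snd
    refine h.of_eq fun n => ?_
    induction n with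
    | zero => simp
    | succ n ih => simp only [ih, Nat.count_succ]; split_ifs <;> rfl
  have hex : ∀ n, ∃ m, p m ∧ Nat.count p m = n := fun n =>
    ⟨Nat.nth p n, Nat.nth_mem_of_infinite hpinf n, Nat.count_nth_of_infinite hpinf n⟩
  have hcomp : Computable fun n => Nat.find (hex n) :=
    Computable.find (P := fun n m => p m ∧ Nat.count p m = n)
      (((hp.comp Primrec.snd).and (Primrec.eq.comp (hcount.comp Primrec.snd)
        Primrec.fst)).computablePred) hex
  refine ⟨fun n => Denumerable.ofNat α (Nat.find (hex n)), (Computable.ofNat α).comp hcomp,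
    fun n m h => ?_, Set.ext fun a => ⟨?_, fun ha => ?_⟩⟩
  · have h' := congrArg Encodable.encode h
    simp only [Denumerable.encode_ofNat] at h'
    rw [← (Nat.find_spec (hex n)).2, h', (Nat.find_spec (hex m)).2]
  · rintro ⟨n, rfl⟩
    exact (Nat.find_spec (hex n)).1
  · have hpa : p (Encodable.encode a) := by simpa [p] using ha
    refine ⟨Nat.count p (Encodable.encode a), ?_⟩
    have h := Nat.find_spec (hex (Nat.count p (Encodable.encode a)))
    simp only [Nat.count_injective h.1 hpa h.2, Denumerable.ofNat_encode]

theorem computable_of_apply_eq {α β : Type*} [Primcodable α] [Primcodable β] {b : ℕ → β}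
    (hb : Computable b) {g : α → β} (hg : Computable g) (h : ∀ a, ∃ n, b n = g a) :
    ∃ c : α → ℕ, Computable c ∧ ∀ a, b (c a) = g a := by
  classical
  have hP : ComputablePred fun q : α × ℕ => b q.2 = g q.1 :=
    Computable.computablePred <| Primrec.eq.decide.to_comp.comp
      (hb.comp Computable.snd) (hg.comp Computable.fst)
  exact ⟨fun a => Nat.find (h a), Computable.find (P := fun a n => b n = g a) hP h,
    fun a => Nat.find_spec (h a)⟩

end Preliminaries

/-! ### A co-c.e. transversal for a computable numbering

A code `a` gives the numbering `i ↦ (z ↦ eval a (Nat.pair i z))`. -/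

section Transversal

open Nat.Partrec (Code)
open Nat.Partrec.Code

theorem primrec_evaln_pair (a : Code) :
    Primrec fun p : ℕ × ℕ × ℕ => evaln p.1 a (Nat.pair p.2.1 p.2.2) :=
  primrec_evaln.comp ((Primrec.fst.pair (Primrec.const a)).pair
    (Primrec₂.natPair.comp (Primrec.fst.comp Primrec.snd) (Primrec.snd.comp Primrec.snd)))

/-- After `u ≥ m` steps of computation, the `i`-th function cannot be distinguished below `m` from
some function with a smaller index. -/
def LooksRedundant (a : Code) (i m u : ℕ) : Prop :=
  m ≤ u ∧ ∃ j < i, ∀ z < m, evaln u a (Nat.pair i z) = evaln u a (Nat.pair j z)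

theorem LooksRedundant.anti {a : Code} {i m m' u : ℕ} (h : LooksRedundant a i m' u)
    (hm : m ≤ m') : LooksRedundant a i m u := by
  obtain ⟨hu, j, hj, hz⟩ := h
  exact ⟨hm.trans hu, j, hj, fun z hzm => hz z (hzm.trans_le hm)⟩

theorem primrecPred_looksRedundant (a : Code) :
    PrimrecPred fun p : ℕ × ℕ × ℕ => LooksRedundant a p.1 p.2.1 p.2.2 := by
  refine (Primrec.nat_le.comp (Primrec.fst.comp Primrec.snd)
    (Primrec.snd.comp Primrec.snd)).and ?_
  refine primrecPred_bex_lt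
    (R := fun (p : ℕ × ℕ × ℕ) j => ∀ z < p.2.1,
      evaln p.2.2 a (Nat.pair p.1 z) = evaln p.2.2 a (Nat.pair j z)) ?_ Primrec.fst
  refine primrecPred_ball_lt
    (R := fun (p : (ℕ × ℕ × ℕ) × ℕ) z =>
      evaln p.1.2.2 a (Nat.pair p.1.1 z) = evaln p.1.2.2 a (Nat.pair p.2 z)) ?_
    (Primrec.fst.comp (Primrec.snd.comp Primrec.fst))
  have hp : Primrec fun q : ((ℕ × ℕ × ℕ) × ℕ) × ℕ => q.1.1 := Primrec.fst.comp Primrec.fst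
  have hu : Primrec fun q : ((ℕ × ℕ × ℕ) × ℕ) × ℕ => q.1.1.2.2 :=
    Primrec.snd.comp (Primrec.snd.comp hp)
  exact Primrec.eq.comp
    ((primrec_evaln_pair a).comp (hu.pair ((Primrec.fst.comp hp).pair Primrec.snd)))
    ((primrec_evaln_pair a).comp (hu.pair ((Primrec.snd.comp Primrec.fst).pair Primrec.snd)))

theorem exists_forall_mem_evaln (a : Code) (i n : ℕ) :
    ∃ u₀, ∀ u ≥ u₀, ∀ z < n, ∀ y,
      y ∈ evaln u a (Nat.pair i z) ↔ y ∈ eval a (Nat.pair i z) := by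
  induction n with
  | zero => exact ⟨0, by simp⟩
  | succ n ih =>
    obtain ⟨u₀, h⟩ := ih
    have hn : ∃ u₁, ∀ u ≥ u₁, ∀ y,
        y ∈ evaln u a (Nat.pair i n) ↔ y ∈ eval a (Nat.pair i n) := by
      by_cases hd : (eval a (Nat.pair i n)).Dom
      · obtain ⟨y, hy⟩ := Part.dom_iff_mem.1 hd
        obtain ⟨k, hk⟩ := evaln_complete.1 hy
        refine ⟨k, fun u hu y' => ⟨evaln_sound, fun hy' => ?_⟩⟩
        rw [Part.mem_unique hy' hy]
        exact evaln_mono hu hk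
      · exact ⟨0, fun u _ y =>
          ⟨evaln_sound, fun hy => (hd (Part.dom_iff_mem.2 ⟨y, hy⟩)).elim⟩⟩
    obtain ⟨u₁, h₁⟩ := hn
    refine ⟨max u₀ u₁, fun u hu z hz => ?_⟩
    rcases Nat.lt_succ_iff_lt_or_eq.1 hz with hz | rfl
    · exact h u (le_of_max_le_left hu) z hz
    · exact h₁ u (le_of_max_le_right hu)

theorem exists_looksRedundant_of_eq {a : Code} {i j : ℕ} (hj : j < i)
    (h : ∀ z, eval a (Nat.pair i z) = eval a (Nat.pair j z)) (m : ℕ) :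
    ∃ u, LooksRedundant a i m u := by
  obtain ⟨u₁, h₁⟩ := exists_forall_mem_evaln a i m
  obtain ⟨u₂, h₂⟩ := exists_forall_mem_evaln a j m
  let u := max m (max u₁ u₂)
  have hu₁ : u₁ ≤ u := (le_max_left _ _).trans (le_max_right _ _)
  have hu₂ : u₂ ≤ u := (le_max_right _ _).trans (le_max_right _ _)
  refine ⟨u, le_max_left _ _, j, hj, fun z hz => Option.ext fun y => ?_⟩
  exact (h₁ u hu₁ z hz y).trans ((h z) ▸ (h₂ u hu₂ z hz y).symm)

theorem exists_forall_not_looksRedundant {a : Code} {i : ℕ}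
    (h : ∀ j < i, ∃ z, eval a (Nat.pair i z) ≠ eval a (Nat.pair j z)) :
    ∃ m, ∀ u, ¬LooksRedundant a i m u := by
  have key : ∀ j < i, ∃ m, ∀ u ≥ m,
      ∃ z < m, evaln u a (Nat.pair i z) ≠ evaln u a (Nat.pair j z) := by
    intro j hj
    obtain ⟨z, hz⟩ := h j hj
    obtain ⟨u₁, h₁⟩ := exists_forall_mem_evaln a i (z + 1)
    obtain ⟨u₂, h₂⟩ := exists_forall_mem_evaln a j (z + 1)
    refine ⟨max (z + 1) (max u₁ u₂), fun u hu => ⟨z, by omega, fun he => hz ?_⟩⟩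
    ext y
    rw [← h₁ u (by omega) z (by omega) y, ← h₂ u (by omega) z (by omega) y, he]
  choose! m hm using key
  refine ⟨(Finset.range i).sup m, fun u hu => ?_⟩
  obtain ⟨hmu, j, hj, hz⟩ := hu
  have hle : m j ≤ (Finset.range i).sup m := Finset.le_sup (Finset.mem_range.2 hj)
  obtain ⟨z, hzm, hne⟩ := hm j hj u (hle.trans hmu)
  exact hne (hz z (hzm.trans_le hle))

/-- `v` is the canonical certificate that `m` is the least candidate bound not refuted so far. -/
def IsStart (a : Code) (i m v : ℕ) : Prop :=
  (m = 0 ∧ v = 0) ∨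
    (0 < m ∧ LooksRedundant a i (m - 1) v ∧ ∀ u < v, ¬LooksRedundant a i (m - 1) u)

theorem primrecPred_isStart (a : Code) :
    PrimrecPred fun p : ℕ × ℕ × ℕ => IsStart a p.1 p.2.1 p.2.2 := by
  have hm : Primrec fun p : ℕ × ℕ × ℕ => p.2.1 := Primrec.fst.comp Primrec.snd
  have hv : Primrec fun p : ℕ × ℕ × ℕ => p.2.2 := Primrec.snd.comp Primrec.snd
  have hpred : Primrec fun p : ℕ × ℕ × ℕ => p.2.1 - 1 := Primrec.pred.comp hm
  refine ((Primrec.eq.comp hm (Primrec.const 0)).and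
    (Primrec.eq.comp hv (Primrec.const 0))).or
    ((Primrec.nat_lt.comp (Primrec.const 0) hm).and
      (((primrecPred_looksRedundant a).comp (Primrec.fst.pair (hpred.pair hv))).and ?_))
  exact primrecPred_ball_lt
    (R := fun (p : ℕ × ℕ × ℕ) u => ¬LooksRedundant a p.1 (p.2.1 - 1) u)
    ((primrecPred_looksRedundant a).comp ((Primrec.fst.comp Primrec.fst).pair
      ((hpred.comp Primrec.fst).pair Primrec.snd))).not hv

theorem exists_isStart {a : Code} {i : ℕ} (h : ∃ m, ∀ u, ¬LooksRedundant a i m u) :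
    ∃ m v, IsStart a i m v ∧ ∀ u, ¬LooksRedundant a i m u := by
  classical
  rcases Nat.eq_zero_or_pos (Nat.find h) with h0 | hpos
  · exact ⟨_, 0, Or.inl ⟨h0, rfl⟩, Nat.find_spec h⟩
  · have hv : ∃ v, LooksRedundant a i (Nat.find h - 1) v := by
      simpa using Nat.find_min h (Nat.sub_lt hpos one_pos)
    exact ⟨_, Nat.find hv, Or.inr ⟨hpos, Nat.find_spec hv, fun u hu => Nat.find_min hv hu⟩,
      Nat.find_spec h⟩

theorem IsStart.unique {a : Code} {i m v m' v' : ℕ} (h : IsStart a i m v)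
    (h' : IsStart a i m' v') (hs : ∀ u, ¬LooksRedundant a i m u)
    (hs' : ∀ u, ¬LooksRedundant a i m' u) : m = m' ∧ v = v' := by
  have aux : ∀ {m v m' v' : ℕ}, IsStart a i m v → IsStart a i m' v' →
      (∀ u, ¬LooksRedundant a i m u) → m' ≤ m := by
    intro m v m' v' _ h' hs
    rcases h' with ⟨h0, _⟩ | ⟨hpos, hr, _⟩
    · omega
    · by_contra hlt
      exact hs v' (hr.anti (by omega))
  obtain rfl : m = m' := le_antisymm (aux h' h hs') (aux h h' hs)
  refine ⟨rfl, ?_⟩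
  rcases h with ⟨h0, hv⟩ | ⟨hpos, hr, hl⟩ <;> rcases h' with ⟨h0', hv'⟩ | ⟨hpos', hr', hl'⟩
  · omega
  · omega
  · omega
  · rcases lt_trichotomy v v' with hlt | heq | hlt
    · exact (hl' v hlt hr).elim
    · exact heq
    · exact (hl v' hlt hr').elim

/-- `g` codes a triple `⟨i, m, v⟩`: the guess that `i` is the least index of its function, with
`m` and `v` certifying it; `Refuted a g s` says that this guess is seen to be wrong at stage `s`. -/
def Refuted (a : Code) (g s : ℕ) : Prop :=
  ¬IsStart a g.unpair.1 g.unpair.2.unpair.1 g.unpair.2.unpair.2 ∨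
    LooksRedundant a g.unpair.1 g.unpair.2.unpair.1 s

theorem primrecPred_refuted (a : Code) :
    PrimrecPred fun p : ℕ × ℕ => Refuted a p.1 p.2 := by
  have h1 : Primrec fun p : ℕ × ℕ => p.1.unpair := Primrec.unpair.comp Primrec.fst
  have hi : Primrec fun p : ℕ × ℕ => p.1.unpair.1 := Primrec.fst.comp h1
  have h2 : Primrec fun p : ℕ × ℕ => p.1.unpair.2.unpair :=
    Primrec.unpair.comp (Primrec.snd.comp h1)
  exact ((primrecPred_isStart a).comp (hi.pair h2)).not.or
    ((primrecPred_looksRedundant a).comp (hi.pair ((Primrec.fst.comp h2).pair Primrec.snd)))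

theorem exists_forall_not_refuted (a : Code) (i : ℕ) :
    ∃ g, (∀ s, ¬Refuted a g s) ∧
      ∀ z, eval a (Nat.pair g.unpair.1 z) = eval a (Nat.pair i z) := by
  classical
  have hex : ∃ j, ∀ z, eval a (Nat.pair j z) = eval a (Nat.pair i z) := ⟨i, fun _ => rfl⟩
  obtain ⟨m, v, hst, hs⟩ := exists_isStart (a := a) (i := Nat.find hex) <|
    exists_forall_not_looksRedundant fun j hj => by
      obtain ⟨z, hz⟩ := not_forall.1 (Nat.find_min hex hj)
      exact ⟨z, fun h => hz (h.symm.trans (Nat.find_spec hex z))⟩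
  refine ⟨Nat.pair (Nat.find hex) (Nat.pair m v), fun s => ?_, ?_⟩
  · simpa [Refuted, hst] using hs s
  · simpa using Nat.find_spec hex

theorem eq_of_forall_not_refuted {a : Code} {g g' : ℕ} (hg : ∀ s, ¬Refuted a g s)
    (hg' : ∀ s, ¬Refuted a g' s)
    (h : ∀ z, eval a (Nat.pair g.unpair.1 z) = eval a (Nat.pair g'.unpair.1 z)) : g = g' := by
  simp only [Refuted, not_or, not_not] at hg hg'
  have hi : g.unpair.1 = g'.unpair.1 := by
    rcases lt_trichotomy g.unpair.1 g'.unpair.1 with hlt | heq | hlt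
    · obtain ⟨u, hu⟩ := exists_looksRedundant_of_eq hlt (fun z => (h z).symm) g'.unpair.2.unpair.1
      exact ((hg' u).2 hu).elim
    · exact heq
    · obtain ⟨u, hu⟩ := exists_looksRedundant_of_eq hlt h g.unpair.2.unpair.1
      exact ((hg u).2 hu).elim
  have hmv := (hg 0).1.unique (hi ▸ (hg' 0).1) (fun u => (hg u).2)
    (fun u => hi ▸ (hg' u).2)
  rw [← Nat.pair_unpair g, ← Nat.pair_unpair g', ← Nat.pair_unpair g.unpair.2,
    ← Nat.pair_unpair g'.unpair.2, hi, hmv.1, hmv.2]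

end Transversal

/-! ### Splitting off the finite functions with domain `{0, …, n - 1}`, `n` odd -/

section Complement

open Nat.Partrec (Code)
open Nat.Partrec.Code

/-- The finite function with domain `{0, …, σ.length - 1}` listed by `σ`. -/
def listFn (σ : List ℕ) : ℕ →. ℕ := fun x => (σ[x]? : Part ℕ)

theorem mem_listFn {σ : List ℕ} {x y : ℕ} : y ∈ listFn σ x ↔ σ[x]? = some y := by
  simp [listFn]

theorem listFn_dom {σ : List ℕ} {x : ℕ} : (listFn σ x).Dom ↔ x < σ.length := by
  rw [Part.dom_iff_mem]
  simp only [mem_listFn]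
  rw [← Option.isSome_iff_exists, isSome_getElem?]

theorem listFn_injective : Function.Injective listFn := fun σ τ h =>
  List.ext_getElem?' fun n _ => Option.ext fun y => by
    rw [← mem_listFn, ← mem_listFn, h]

/-- `f` is a finite function whose domain is a proper initial segment of odd length. -/
def IsOddString (f : ℕ →. ℕ) : Prop := ∃ σ : List ℕ, σ.length % 2 = 1 ∧ f = listFn σ

/-- The other element of the pair `{2k, 2k + 1}` containing `z`. -/
def partner (z : ℕ) : ℕ := z + 1 - 2 * (z % 2)

theorem partner_partner (z : ℕ) : partner (partner z) = z := by
  unfold partner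
  omega

theorem primrec_partner : Primrec partner :=
  Primrec.nat_sub.comp Primrec.succ
    (Primrec.nat_mul.comp (Primrec.const 2) (Primrec.nat_mod.comp Primrec.id (Primrec.const 2)))

/-- `i` codes a program `c` and numbers `x`, `y`. If `x < y`, the function of `c` is made undefined
at `x`, and everywhere if it is undefined at `y`; otherwise its domain is cut down to a union of
pairs `{2k, 2k + 1}`. -/
def nonOddString (i z : ℕ) : Part ℕ :=
  bif decide (i.unpair.2.unpair.1 < i.unpair.2.unpair.2 ∧ z = i.unpair.2.unpair.1) then Part.none
  else (eval (Denumerable.ofNat Code i.unpair.1)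
      (if i.unpair.2.unpair.1 < i.unpair.2.unpair.2 then i.unpair.2.unpair.2 else partner z)).bind
    fun _ => eval (Denumerable.ofNat Code i.unpair.1) z

theorem partrec_nonOddString : Partrec₂ nonOddString := by
  have hi : Primrec fun p : ℕ × ℕ => p.1.unpair := Primrec.unpair.comp Primrec.fst
  have hc : Computable fun p : ℕ × ℕ => Denumerable.ofNat Code p.1.unpair.1 :=
    ((Primrec.ofNat Code).comp (Primrec.fst.comp hi)).to_comp
  have hxy : Primrec fun p : ℕ × ℕ => p.1.unpair.2.unpair :=
    Primrec.unpair.comp (Primrec.snd.comp hi)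
  have hlt : PrimrecPred fun p : ℕ × ℕ => p.1.unpair.2.unpair.1 < p.1.unpair.2.unpair.2 :=
    Primrec.nat_lt.comp (Primrec.fst.comp hxy) (Primrec.snd.comp hxy)
  refine Partrec.cond
    (hlt.and (Primrec.eq.comp Primrec.snd (Primrec.fst.comp hxy))).decide.to_comp
    Partrec.none (Partrec.bind (eval_part.comp hc
      (Primrec.ite hlt (Primrec.snd.comp hxy) (primrec_partner.comp Primrec.snd)).to_comp) ?_)
  exact eval_part.comp (hc.comp Computable.fst) (Computable.snd.comp Computable.fst)

theorem mem_nonOddString {i z w : ℕ} :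
    w ∈ nonOddString i z ↔
      ¬(i.unpair.2.unpair.1 < i.unpair.2.unpair.2 ∧ z = i.unpair.2.unpair.1) ∧
      (eval (Denumerable.ofNat Code i.unpair.1) (if i.unpair.2.unpair.1 < i.unpair.2.unpair.2
        then i.unpair.2.unpair.2 else partner z)).Dom ∧
      w ∈ eval (Denumerable.ofNat Code i.unpair.1) z := by
  unfold nonOddString
  by_cases h : i.unpair.2.unpair.1 < i.unpair.2.unpair.2 ∧ z = i.unpair.2.unpair.1
  · simp [h]
  · simp only [h, decide_false, cond_false, Part.mem_bind_iff, not_false_eq_true, true_and,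
      Part.dom_iff_mem, exists_and_right]

theorem not_isOddString_nonOddString (i : ℕ) : ¬IsOddString (nonOddString i) := by
  rintro ⟨σ, hσ, h⟩
  have hdom : ∀ z, z < σ.length ↔ ∃ w, w ∈ nonOddString i z := fun z => by
    rw [h, ← listFn_dom, Part.dom_iff_mem]
  have hlast : σ.length - 1 < σ.length := by omega
  obtain ⟨w, hw⟩ := (hdom _).1 hlast
  rw [mem_nonOddString] at hw
  obtain ⟨-, h₁, h₂⟩ := hw
  by_cases hlt : i.unpair.2.unpair.1 < i.unpair.2.unpair.2
  · rw [if_pos hlt] at h₁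
    obtain ⟨v, hv⟩ := Part.dom_iff_mem.1 h₁
    have hy := (hdom i.unpair.2.unpair.2).2
      ⟨v, mem_nonOddString.2 ⟨fun hx => by omega, by rwa [if_pos hlt], hv⟩⟩
    obtain ⟨u, hu⟩ := (hdom i.unpair.2.unpair.1).1 (hlt.trans hy)
    exact (mem_nonOddString.1 hu).1 ⟨hlt, rfl⟩
  · rw [if_neg hlt] at h₁
    obtain ⟨v, hv⟩ := Part.dom_iff_mem.1 h₁
    have hp := (hdom (partner (σ.length - 1))).2 ⟨v, mem_nonOddString.2
      ⟨fun hx => hlt hx.1, by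
        rw [if_neg hlt, partner_partner]; exact Part.dom_iff_mem.2 ⟨w, h₂⟩, hv⟩⟩
    unfold partner at hp
    omega

theorem isOddString_or_exists_nonOddString {f : ℕ →. ℕ} (hf : Nat.Partrec f) :
    IsOddString f ∨ ∃ i, nonOddString i = f := by
  obtain ⟨c, rfl⟩ := exists_code.1 hf
  by_cases hgap : ∃ x y, x < y ∧ ¬(eval c x).Dom ∧ (eval c y).Dom
  · obtain ⟨x, y, hxy, hx, hy⟩ := hgap
    refine Or.inr ⟨Nat.pair (Encodable.encode c) (Nat.pair x y), PFun.ext fun z w => ?_⟩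
    simp only [mem_nonOddString, Nat.unpair_pair, Denumerable.ofNat_encode, hxy, if_true, hy,
      true_and, and_iff_right_iff_imp]
    rintro hw rfl
    exact hx (Part.dom_iff_mem.2 ⟨w, hw⟩)
  push Not at hgap
  have hA : (∀ z, (eval c z).Dom → (eval c (partner z)).Dom) → ∃ i, nonOddString i = eval c := by
    intro hp
    refine ⟨Nat.pair (Encodable.encode c) (Nat.pair 0 0), PFun.ext fun z w => ?_⟩
    simp only [mem_nonOddString, Nat.unpair_pair, Denumerable.ofNat_encode, lt_irrefl, if_false,
      false_and, not_false_eq_true, true_and, and_iff_right_iff_imp]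
    exact fun hw => hp z (Part.dom_iff_mem.2 ⟨w, hw⟩)
  by_cases htot : ∀ z, (eval c z).Dom
  · exact Or.inr (hA fun z _ => htot _)
  classical
  push Not at htot
  let n := Nat.find htot
  have hn : ∀ z, (eval c z).Dom ↔ z < n := fun z =>
    ⟨fun hz => by
      by_contra hle
      rcases (not_lt.1 hle).eq_or_lt with he | hl
      · exact Nat.find_spec htot (by rwa [← he] at hz)
      · exact hgap _ _ hl (Nat.find_spec htot) hz,
    fun hz => not_not.1 (Nat.find_min htot hz)⟩
  rcases Nat.mod_two_eq_zero_or_one n with h0 | h1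
  · refine Or.inr (hA fun z hz => (hn _).2 ?_)
    have := (hn z).1 hz
    unfold partner
    omega
  · refine Or.inl ⟨List.ofFn fun k : Fin n => (eval c k).get ((hn k).2 k.2), by simpa using h1,
      PFun.ext fun z w => ?_⟩
    rw [mem_listFn, List.getElem?_ofFn]
    by_cases hz : z < n
    · simp only [hz, dif_pos, Option.some.injEq]
      exact Part.get_eq_iff_mem _ |>.symm
    · simp only [hz, dif_neg, not_false_eq_true, reduceCtorEq, iff_false]
      exact fun hw => hz ((hn z).1 (Part.dom_iff_mem.2 ⟨w, hw⟩))

theorem exists_code_nonOddString :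
    ∃ a : Code, ∀ i z, eval a (Nat.pair i z) = nonOddString i z := by
  obtain ⟨a, ha⟩ := exists_code.1 (Partrec₂.unpaired'.2 partrec_nonOddString)
  exact ⟨a, fun i z => by simp [ha, Nat.unpaired]⟩

end Complement

/-! ### Functions that are dumped on a long finite function when their index is refuted -/

section Dump

open Nat.Partrec (Code)
open Nat.Partrec.Code

variable {a : Code}

/-- `s` is the first stage at which `g` is refuted. -/
def FirstRefuted (a : Code) (g s : ℕ) : Prop := Refuted a g s ∧ ∀ u < s, ¬Refuted a g u

theorem primrecPred_forall_lt_not_refuted (a : Code) :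
    PrimrecPred fun p : ℕ × ℕ => ∀ u < p.2, ¬Refuted a p.1 u :=
  primrecPred_ball_lt (R := fun (p : ℕ × ℕ) u => ¬Refuted a p.1 u)
    ((primrecPred_refuted a).comp ((Primrec.fst.comp Primrec.fst).pair Primrec.snd)).not
    Primrec.snd

theorem primrecPred_firstRefuted (a : Code) :
    PrimrecPred fun p : ℕ × ℕ => FirstRefuted a p.1 p.2 :=
  (primrecPred_refuted a).and (primrecPred_forall_lt_not_refuted a)

theorem FirstRefuted.unique {g s s' : ℕ} (h : FirstRefuted a g s) (h' : FirstRefuted a g s') :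
    s = s' :=
  le_antisymm (not_lt.1 fun hl => h.2 _ hl h'.1) (not_lt.1 fun hl => h'.2 _ hl h.1)

theorem exists_firstRefuted {g : ℕ} (h : ∃ s, Refuted a g s) : ∃ s, FirstRefuted a g s := by
  classical
  exact ⟨Nat.find h, Nat.find_spec h, fun u hu => Nat.find_min h hu⟩

/-- The value at `x` of the function guessed by `g`, as computed in `s` steps. -/
def approx (a : Code) (g s x : ℕ) : Option ℕ := evaln s a (Nat.pair g.unpair.1 x)

theorem primrec_approx (a : Code) : Primrec fun p : ℕ × ℕ × ℕ => approx a p.1 p.2.1 p.2.2 :=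
  (primrec_evaln_pair a).comp ((Primrec.fst.comp Primrec.snd).pair
    ((Primrec.fst.comp (Primrec.unpair.comp Primrec.fst)).pair (Primrec.snd.comp Primrec.snd)))

theorem approx_mono {g s s' x y : ℕ} (h : s ≤ s') (hy : approx a g s x = some y) :
    approx a g s' x = some y :=
  evaln_mono h hy

theorem lt_of_approx_eq_some {g s x y : ℕ} (h : approx a g s x = some y) : x < s :=
  (Nat.right_le_pair _ _).trans_lt (evaln_bound h)

theorem exists_approx_eq_some {g x y : ℕ} :
    (∃ s, approx a g s x = some y) ↔ y ∈ eval a (Nat.pair g.unpair.1 x) :=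
  evaln_complete.symm

/-- An extension of the approximation at stage `s` to a list whose odd length determines
`g` and `s`. -/
def dump (a : Code) (g s : ℕ) : List ℕ :=
  (List.range (2 * Nat.pair g s + 5)).map fun x => (approx a g s x).getD 0

theorem length_dump (g s : ℕ) : (dump a g s).length = 2 * Nat.pair g s + 5 := by
  simp [dump]

theorem dump_inj {g s g' s' : ℕ} (h : dump a g s = dump a g' s') : g = g' ∧ s = s' := by
  have := congrArg List.length h
  rw [length_dump, length_dump] at this
  exact Nat.pair_eq_pair.1 (by omega)

theorem getElem?_dump {g s x y : ℕ} : (dump a g s)[x]? = some y ↔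
    x < 2 * Nat.pair g s + 5 ∧ (approx a g s x).getD 0 = y := by
  simp [dump, Option.map_eq_some_iff, List.getElem?_eq_some_iff]

theorem primrec_dump (a : Code) : Primrec fun p : ℕ × ℕ => dump a p.1 p.2 := by
  refine Primrec.list_map (Primrec.list_range.comp (Primrec.nat_add.comp (Primrec.nat_mul.comp
    (Primrec.const 2) (Primrec₂.natPair.comp Primrec.fst Primrec.snd)) (Primrec.const 5))) ?_
  exact Primrec.option_getD.comp ((primrec_approx a).comp ((Primrec.fst.comp Primrec.fst).pair
    ((Primrec.snd.comp Primrec.fst).pair Primrec.snd))) (Primrec.const 0)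

/-- Stage `s` puts `y` as the value at `x` of the function with index `g`. -/
def DumpGraph (a : Code) (g x y s : ℕ) : Prop :=
  ((∀ u < s + 1, ¬Refuted a g u) ∧ approx a g s x = some y) ∨
    (FirstRefuted a g s ∧ x < 2 * Nat.pair g s + 5 ∧ (approx a g s x).getD 0 = y)

theorem primrecPred_dumpGraph (a : Code) :
    PrimrecPred fun p : ℕ × ℕ × ℕ × ℕ => DumpGraph a p.1 p.2.1 p.2.2.1 p.2.2.2 := by
  have hx : Primrec fun p : ℕ × ℕ × ℕ × ℕ => p.2.1 := Primrec.fst.comp Primrec.snd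
  have hy : Primrec fun p : ℕ × ℕ × ℕ × ℕ => p.2.2.1 :=
    Primrec.fst.comp (Primrec.snd.comp Primrec.snd)
  have hs : Primrec fun p : ℕ × ℕ × ℕ × ℕ => p.2.2.2 :=
    Primrec.snd.comp (Primrec.snd.comp Primrec.snd)
  have hap := (primrec_approx a).comp (Primrec.fst.pair (hs.pair hx))
  refine (((primrecPred_forall_lt_not_refuted a).comp
    (Primrec.fst.pair (Primrec.succ.comp hs))).and
      (Primrec.eq.comp hap (Primrec.option_some.comp hy))).or
    (((primrecPred_firstRefuted a).comp (Primrec.fst.pair hs)).and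
      ((Primrec.nat_lt.comp hx ?_).and
        (Primrec.eq.comp (Primrec.option_getD.comp hap (Primrec.const 0)) hy)))
  exact Primrec.nat_add.comp (Primrec.nat_mul.comp (Primrec.const 2)
    (Primrec₂.natPair.comp Primrec.fst hs)) (Primrec.const 5)

theorem exists_dumpGraph_of_not_refuted {g : ℕ} (h : ∀ s, ¬Refuted a g s) {x y : ℕ} :
    (∃ s, DumpGraph a g x y s) ↔ y ∈ eval a (Nat.pair g.unpair.1 x) := by
  simp [DumpGraph, FirstRefuted, h, exists_approx_eq_some]

theorem exists_dumpGraph_of_firstRefuted {g s : ℕ} (h : FirstRefuted a g s) {x y : ℕ} :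
    (∃ u, DumpGraph a g x y u) ↔ (dump a g s)[x]? = some y := by
  rw [getElem?_dump]
  constructor
  · rintro ⟨u, ⟨hu, hy⟩ | ⟨hu, hx, hy⟩⟩
    · have hus : u < s := not_le.1 fun hle => hu s (by omega) h.1
      have hx := lt_of_approx_eq_some hy
      have := Nat.right_le_pair g s
      exact ⟨by omega, by rw [approx_mono hus.le hy]; rfl⟩
    · obtain rfl := h.unique hu
      exact ⟨hx, hy⟩
  · rintro ⟨hx, hy⟩
    exact ⟨s, Or.inr ⟨h, hx, hy⟩⟩

/-- `σ` is dumped on by some index. -/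
def Dumped (a : Code) (σ : List ℕ) : Prop := ∃ g s, FirstRefuted a g s ∧ σ = dump a g s

theorem primrecPred_dumped (a : Code) : PrimrecPred (Dumped a) := by
  have hn : Primrec fun σ : List ℕ => ((σ.length - 5) / 2).unpair :=
    Primrec.unpair.comp (Primrec.nat_div.comp
      (Primrec.nat_sub.comp Primrec.list_length (Primrec.const 5)) (Primrec.const 2))
  refine (((primrecPred_firstRefuted a).comp hn).and
    (Primrec.eq.comp Primrec.id ((primrec_dump a).comp hn))).of_eq fun σ => ?_
  refine ⟨fun h => ⟨_, _, h⟩, ?_⟩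
  rintro ⟨g, s, h, rfl⟩
  have : (2 * Nat.pair g s + 5 - 5) / 2 = Nat.pair g s := by omega
  simpa [length_dump, this] using h

theorem Dumped.five_le_length {σ : List ℕ} (h : Dumped a σ) : 5 ≤ σ.length := by
  obtain ⟨g, s, -, rfl⟩ := h
  simp [length_dump]

theorem Dumped.length_odd {σ : List ℕ} (h : Dumped a σ) : σ.length % 2 = 1 := by
  obtain ⟨g, s, -, rfl⟩ := h
  rw [length_dump]
  omega

end Dump

/-! ### Coding the halting problem into the short finite functions -/

section Swap

open Nat.Partrec (Code)
open Nat.Partrec.Code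

/-- The program `e` halts on input `0` in exactly `s + 1` steps. -/
def HaltsAt (e s : ℕ) : Prop :=
  evaln s (Denumerable.ofNat Code e) 0 = none ∧ evaln (s + 1) (Denumerable.ofNat Code e) 0 ≠ none

theorem primrecPred_haltsAt : PrimrecPred fun p : ℕ × ℕ => HaltsAt p.1 p.2 := by
  have hc : Primrec fun p : ℕ × ℕ => Denumerable.ofNat Code p.1 :=
    (Primrec.ofNat Code).comp Primrec.fst
  exact (Primrec.eq.comp (primrec_evaln.comp ((Primrec.snd.pair hc).pair (Primrec.const 0)))
    (Primrec.const none)).and (Primrec.eq.comp (primrec_evaln.comp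
      (((Primrec.succ.comp Primrec.snd).pair hc).pair (Primrec.const 0))) (Primrec.const none)).not

theorem HaltsAt.unique {e s s' : ℕ} (h : HaltsAt e s) (h' : HaltsAt e s') : s = s' := by
  have aux : ∀ {s s' : ℕ}, HaltsAt e s → HaltsAt e s' → s' ≤ s := fun {s s'} h h' => by
    by_contra hlt
    obtain ⟨y, hy⟩ := Option.ne_none_iff_exists'.1 h.2
    have hy' : evaln s' (Denumerable.ofNat Code e) 0 = some y := evaln_mono (by omega) hy
    simp [h'.1] at hy'
  exact le_antisymm (aux h' h) (aux h h')

theorem exists_haltsAt (e : ℕ) :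
    (∃ s, HaltsAt e s) ↔ (eval (Denumerable.ofNat Code e) 0).Dom := by
  classical
  rw [Part.dom_iff_mem]
  constructor
  · rintro ⟨s, -, hs⟩
    obtain ⟨y, hy⟩ := Option.ne_none_iff_exists'.1 hs
    exact ⟨y, evaln_sound hy⟩
  · rintro ⟨y, hy⟩
    obtain ⟨k, hk⟩ := evaln_complete.1 hy
    have hex : ∃ s, evaln s (Denumerable.ofNat Code e) 0 ≠ none := ⟨k, by
      rw [Option.mem_def.1 hk]; simp⟩
    have hpos : 0 < Nat.find hex := Nat.pos_of_ne_zero fun h0 => by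
      have := Nat.find_spec hex
      rw [h0] at this
      exact this (by simp [evaln])
    refine ⟨Nat.find hex - 1, not_not.1 (Nat.find_min hex (Nat.sub_lt hpos one_pos)), ?_⟩
    rw [show Nat.find hex - 1 + 1 = Nat.find hex from Nat.sub_add_cancel hpos]
    exact Nat.find_spec hex

/-- `τ` is the list `[e, ⟨i, s⟩, 0]`, where the program `e` halts at stage `s`. -/
def Marks (i : ℕ) (τ : List ℕ) : Prop :=
  τ.length = 3 ∧ τ.getD 2 0 = 0 ∧ (τ.getD 1 0).unpair.1 = i ∧
    HaltsAt (τ.getD 0 0) (τ.getD 1 0).unpair.2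

theorem marks_iff {i : ℕ} {τ : List ℕ} :
    Marks i τ ↔ ∃ e s, HaltsAt e s ∧ τ = [e, Nat.pair i s, 0] := by
  constructor
  · rintro ⟨hl, h2, h1, h0⟩
    obtain ⟨e, t, r, rfl⟩ := List.length_eq_three.1 hl
    simp only [List.getD_cons_zero, List.getD_cons_succ] at h2 h1 h0
    exact ⟨e, t.unpair.2, h0, by rw [← h1, Nat.pair_unpair, h2]⟩
  · rintro ⟨e, s, h, rfl⟩
    simpa [Marks] using h

theorem primrecPred_marks : PrimrecPred fun p : ℕ × List ℕ => Marks p.1 p.2 := by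
  have hd : ∀ k, Primrec fun p : ℕ × List ℕ => p.2.getD k 0 := fun k =>
    (Primrec.list_getD 0).comp Primrec.snd (Primrec.const k)
  have h1 : Primrec fun p : ℕ × List ℕ => (p.2.getD 1 0).unpair := Primrec.unpair.comp (hd 1)
  exact (Primrec.eq.comp (Primrec.list_length.comp Primrec.snd) (Primrec.const 3)).and
    ((Primrec.eq.comp (hd 2) (Primrec.const 0)).and
      ((Primrec.eq.comp (Primrec.fst.comp h1) Primrec.fst).and
        (primrecPred_haltsAt.comp ((hd 0).pair (Primrec.snd.comp h1)))))

open Classical in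
/-- The involution exchanging `[e]` and `[e, ⟨i, s⟩, 0]` whenever the program `e` halts at
stage `s`. -/
noncomputable def swap (i : ℕ) (σ : List ℕ) : List ℕ :=
  if Marks i σ then [σ.getD 0 0]
  else if h : σ.length = 1 ∧ ∃ s, HaltsAt (σ.getD 0 0) s then
    [σ.getD 0 0, Nat.pair i h.2.choose, 0] else σ

theorem swap_of_haltsAt {i e s : ℕ} (h : HaltsAt e s) :
    swap i [e] = [e, Nat.pair i s, 0] := by
  have hm : ¬Marks i [e] := fun hm => by simpa using hm.1
  have hex : [e].length = 1 ∧ ∃ s, HaltsAt ([e].getD 0 0) s := ⟨rfl, s, h⟩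
  rw [swap, if_neg hm, dif_pos hex, hex.2.choose_spec.unique h]
  rfl

theorem swap_cons_of_haltsAt {i e s : ℕ} (h : HaltsAt e s) :
    swap i [e, Nat.pair i s, 0] = [e] := by
  rw [swap, if_pos (marks_iff.2 ⟨e, s, h, rfl⟩)]
  rfl

theorem swap_of_forall_ne {i : ℕ} {σ : List ℕ}
    (h : ∀ e s, HaltsAt e s → σ ≠ [e] ∧ σ ≠ [e, Nat.pair i s, 0]) : swap i σ = σ := by
  rw [swap, if_neg, dif_neg]
  · rintro ⟨hl, s, hs⟩
    obtain ⟨e, rfl⟩ := List.length_eq_one_iff.1 hl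
    exact (h e s hs).1 rfl
  · rw [marks_iff]
    rintro ⟨e, s, hs, he⟩
    exact (h e s hs).2 he

theorem swap_cases (i : ℕ) (σ : List ℕ) :
    (∃ e s, HaltsAt e s ∧ σ = [e]) ∨ (∃ e s, HaltsAt e s ∧ σ = [e, Nat.pair i s, 0]) ∨
      ∀ e s, HaltsAt e s → σ ≠ [e] ∧ σ ≠ [e, Nat.pair i s, 0] := by
  by_contra! h
  obtain ⟨h1, h2, e, s, hs, h3⟩ := h
  exact h2 e s hs (h3 (h1 e s hs))

theorem swap_involutive (i : ℕ) : Function.Involutive (swap i) := fun σ => by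
  rcases swap_cases i σ with ⟨e, s, h, rfl⟩ | ⟨e, s, h, rfl⟩ | h
  · rw [swap_of_haltsAt h, swap_cons_of_haltsAt h]
  · rw [swap_cons_of_haltsAt h, swap_of_haltsAt h]
  · rw [swap_of_forall_ne h, swap_of_forall_ne h]

theorem swap_length_odd {i : ℕ} {σ : List ℕ} (h : σ.length % 2 = 1) :
    (swap i σ).length % 2 = 1 := by
  rcases swap_cases i σ with ⟨e, s, hs, rfl⟩ | ⟨e, s, hs, rfl⟩ | hs
  · simp [swap_of_haltsAt hs]
  · simp [swap_cons_of_haltsAt hs]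
  · rwa [swap_of_forall_ne hs]

theorem swap_of_five_le_length {i : ℕ} {σ : List ℕ} (h : 5 ≤ σ.length) : swap i σ = σ :=
  swap_of_forall_ne fun e s _ => ⟨by rintro rfl; simp at h, by rintro rfl; simp at h⟩

/-- Stage `s` puts `y` as the value at `x` of the finite function listed by `swap i σ`. -/
def SwapGraph (i : ℕ) (σ : List ℕ) (x y s : ℕ) : Prop :=
  (σ.length = 1 ∧ HaltsAt (σ.getD 0 0) s ∧ [σ.getD 0 0, Nat.pair i s, 0][x]? = some y) ∨
    (σ[x]? = some y ∧ ¬(1 ≤ x ∧ Marks i σ))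

theorem primrecPred_swapGraph : PrimrecPred fun p : (ℕ × List ℕ) × ℕ × ℕ × ℕ =>
    SwapGraph p.1.1 p.1.2 p.2.1 p.2.2.1 p.2.2.2 := by
  have hi : Primrec fun p : (ℕ × List ℕ) × ℕ × ℕ × ℕ => p.1.1 := Primrec.fst.comp Primrec.fst
  have hσ : Primrec fun p : (ℕ × List ℕ) × ℕ × ℕ × ℕ => p.1.2 := Primrec.snd.comp Primrec.fst
  have hx : Primrec fun p : (ℕ × List ℕ) × ℕ × ℕ × ℕ => p.2.1 := Primrec.fst.comp Primrec.snd
  have hy : Primrec fun p : (ℕ × List ℕ) × ℕ × ℕ × ℕ => some p.2.2.1 :=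
    Primrec.option_some.comp (Primrec.fst.comp (Primrec.snd.comp Primrec.snd))
  have hs : Primrec fun p : (ℕ × List ℕ) × ℕ × ℕ × ℕ => p.2.2.2 :=
    Primrec.snd.comp (Primrec.snd.comp Primrec.snd)
  have hd : Primrec fun p : (ℕ × List ℕ) × ℕ × ℕ × ℕ => p.1.2.getD 0 0 :=
    (Primrec.list_getD 0).comp hσ (Primrec.const 0)
  have hl : Primrec fun p : (ℕ × List ℕ) × ℕ × ℕ × ℕ =>
      [p.1.2.getD 0 0, Nat.pair p.1.1 p.2.2.2, 0] :=
    Primrec.list_cons.comp hd (Primrec.list_cons.comp (Primrec₂.natPair.comp hi hs)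
      (Primrec.const [0]))
  exact ((Primrec.eq.comp (Primrec.list_length.comp hσ) (Primrec.const 1)).and
    ((primrecPred_haltsAt.comp (hd.pair hs)).and
      (Primrec.eq.comp (Primrec.list_getElem?.comp hl hx) hy))).or
    ((Primrec.eq.comp (Primrec.list_getElem?.comp hσ hx) hy).and
      ((Primrec.nat_le.comp (Primrec.const 1) hx).and
        (primrecPred_marks.comp (hi.pair hσ))).not)

theorem exists_swapGraph {i : ℕ} {σ : List ℕ} {x y : ℕ} :
    (∃ s, SwapGraph i σ x y s) ↔ (swap i σ)[x]? = some y := by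
  rcases swap_cases i σ with ⟨e, s, h, rfl⟩ | ⟨e, s, h, rfl⟩ | h
  · rw [swap_of_haltsAt h]
    constructor
    · rintro ⟨u, ⟨-, hu, hx⟩ | ⟨hx, -⟩⟩
      · rw [h.unique hu]
        exact hx
      · rcases x with _ | x
        · exact hx
        · simp at hx
    · exact fun hx => ⟨s, Or.inl ⟨rfl, h, hx⟩⟩
  · rw [swap_cons_of_haltsAt h]
    have hm : Marks i [e, Nat.pair i s, 0] := marks_iff.2 ⟨e, s, h, rfl⟩
    rcases x with _ | x
    · simp [SwapGraph]
    · simp [SwapGraph, hm]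
  · rw [swap_of_forall_ne h]
    constructor
    · rintro ⟨u, ⟨hl, hu, -⟩ | ⟨hx, -⟩⟩
      · obtain ⟨e, rfl⟩ := List.length_eq_one_iff.1 hl
        exact ((h e u hu).1 rfl).elim
      · exact hx
    · refine fun hx => ⟨0, Or.inr ⟨hx, fun hm => ?_⟩⟩
      obtain ⟨e, s, hs, he⟩ := marks_iff.1 hm.2
      exact (h e s hs).2 he

end Swap

/-! ### The family of Friedberg numberings -/

section Family

open Nat.Partrec (Code)
open Nat.Partrec.Code

variable {a : Code}

open Classical in
/-- The function with index `(g, σ)` in the `i`-th numbering. -/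
noncomputable def familyFn (a : Code) (i : ℕ) (p : ℕ × List ℕ) : ℕ →. ℕ :=
  if p.2 = [] then
    if h : ∃ s, FirstRefuted a p.1 s then listFn (dump a p.1 h.choose)
    else fun x => eval a (Nat.pair p.1.unpair.1 x)
  else listFn (swap i p.2)

theorem familyFn_of_firstRefuted {i g s : ℕ} (h : FirstRefuted a g s) :
    familyFn a i (g, []) = listFn (dump a g s) := by
  have hex : ∃ s, FirstRefuted a g s := ⟨s, h⟩
  exact (if_pos rfl).trans ((dif_pos hex).trans (by rw [hex.choose_spec.unique h]))

theorem familyFn_of_not_refuted {i g : ℕ} (h : ∀ s, ¬Refuted a g s) :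
    familyFn a i (g, []) = fun x => eval a (Nat.pair g.unpair.1 x) := by
  have hex : ¬∃ s, FirstRefuted a g s := fun ⟨s, hs⟩ => h s hs.1
  exact (if_pos rfl).trans (dif_neg hex)

theorem familyFn_of_ne_nil {i g : ℕ} {σ : List ℕ} (h : σ ≠ []) :
    familyFn a i (g, σ) = listFn (swap i σ) :=
  if_neg h

/-- Stage `s` puts `y` as the value at `x` of the function with index `p` in the `i`-th
numbering. -/
def FamilyGraph (a : Code) (i : ℕ) (p : ℕ × List ℕ) (x y s : ℕ) : Prop :=
  (p.2 = [] ∧ DumpGraph a p.1 x y s) ∨ (¬p.2 = [] ∧ SwapGraph i p.2 x y s)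

theorem mem_familyFn {i x y : ℕ} {p : ℕ × List ℕ} :
    y ∈ familyFn a i p x ↔ ∃ s, FamilyGraph a i p x y s := by
  obtain ⟨g, σ⟩ := p
  by_cases hσ : σ = []
  · subst hσ
    simp only [FamilyGraph, not_true_eq_false, false_and, or_false, true_and]
    by_cases h : ∃ s, Refuted a g s
    · obtain ⟨s, hs⟩ := exists_firstRefuted h
      rw [familyFn_of_firstRefuted hs, mem_listFn, exists_dumpGraph_of_firstRefuted hs]
    · push Not at h
      rw [familyFn_of_not_refuted h, exists_dumpGraph_of_not_refuted h]
  · simp only [FamilyGraph, hσ, false_and, false_or, not_false_eq_true, true_and]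
    rw [familyFn_of_ne_nil hσ, mem_listFn, exists_swapGraph]

theorem partrec_familyFn (a : Code) :
    Partrec fun q : (ℕ × ℕ × List ℕ) × ℕ => familyFn a q.1.1 q.1.2 q.2 := by
  have hq : Primrec fun q : ((ℕ × ℕ × List ℕ) × ℕ) × ℕ × ℕ => q.1.1 :=
    Primrec.fst.comp Primrec.fst
  have hp : Primrec fun q : ((ℕ × ℕ × List ℕ) × ℕ) × ℕ × ℕ => q.1.1.2 := Primrec.snd.comp hq
  have hσ : Primrec fun q : ((ℕ × ℕ × List ℕ) × ℕ) × ℕ × ℕ => q.1.1.2.2 := Primrec.snd.comp hp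
  have hx : Primrec fun q : ((ℕ × ℕ × List ℕ) × ℕ) × ℕ × ℕ => (q.1.2, q.2.1, q.2.2) :=
    (Primrec.snd.comp Primrec.fst).pair Primrec.snd
  have hnil := Primrec.eq.comp hσ (Primrec.const ([] : List ℕ))
  obtain ⟨f, hf, hmem⟩ := exists_partrec_of_graph
    (G := fun (q : (ℕ × ℕ × List ℕ) × ℕ) y s => FamilyGraph a q.1.1 q.1.2 q.2 y s)
    ((hnil.and ((primrecPred_dumpGraph a).comp ((Primrec.fst.comp hp).pair hx))).or
      (hnil.not.and (primrecPred_swapGraph.comp (((Primrec.fst.comp hq).pair hσ).pair hx))))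
    fun q y y' s s' h h' => Part.mem_unique (mem_familyFn.2 ⟨s, h⟩) (mem_familyFn.2 ⟨s', h'⟩)
  exact hf.of_eq fun q => Part.ext fun y => (hmem q y).trans mem_familyFn.symm

/-- The indices of the numberings: `(g, [])` for a guess `g`, and `(0, σ)` for a list `σ` of odd
length that is not dumped on. -/
def IsIndex (a : Code) (p : ℕ × List ℕ) : Prop :=
  p.2 = [] ∨ (p.1 = 0 ∧ p.2.length % 2 = 1 ∧ ¬Dumped a p.2)

theorem primrecPred_isIndex (a : Code) : PrimrecPred (IsIndex a) :=
  (Primrec.eq.comp Primrec.snd (Primrec.const [])).or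
    ((Primrec.eq.comp Primrec.fst (Primrec.const 0)).and
      ((Primrec.eq.comp (Primrec.nat_mod.comp (Primrec.list_length.comp Primrec.snd)
        (Primrec.const 2)) (Primrec.const 1)).and ((primrecPred_dumped a).comp Primrec.snd).not))

theorem infinite_isIndex (a : Code) : {p | IsIndex a p}.Infinite :=
  Set.infinite_of_injective_forall_mem (f := fun g : ℕ => (g, ([] : List ℕ)))
    (fun _ _ h => congrArg Prod.fst h) fun _ => Or.inl rfl

theorem isIndex_singleton (a : Code) (e : ℕ) : IsIndex a (0, [e]) :=
  Or.inr ⟨rfl, rfl, fun h => by simpa using h.five_le_length⟩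

theorem IsIndex.cases {p : ℕ × List ℕ} (hp : IsIndex a p) :
    (∃ g, p = (g, []) ∧ ∀ s, ¬Refuted a g s) ∨ (∃ g s, p = (g, []) ∧ FirstRefuted a g s) ∨
      ∃ σ, p = (0, σ) ∧ σ.length % 2 = 1 ∧ ¬Dumped a σ := by
  obtain ⟨g, σ⟩ := p
  rcases hp with rfl | ⟨rfl, hp⟩
  · by_cases h : ∃ s, Refuted a g s
    · obtain ⟨s, hs⟩ := exists_firstRefuted h
      exact Or.inr (Or.inl ⟨g, s, rfl, hs⟩)
    · exact Or.inl ⟨g, rfl, not_exists.1 h⟩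
  · exact Or.inr (Or.inr ⟨σ, rfl, hp⟩)

theorem ne_nil_of_length_odd {σ : List ℕ} (h : σ.length % 2 = 1) : σ ≠ [] := by
  rintro rfl
  simp at h

theorem not_dumped_swap {i : ℕ} {σ : List ℕ} (h : ¬Dumped a σ) : ¬Dumped a (swap i σ) := fun hd => by
  have := swap_of_five_le_length (i := i) hd.five_le_length
  rw [swap_involutive i σ] at this
  rw [← this] at hd
  exact h hd

theorem familyFn_injOn (ha : ∀ i, ¬IsOddString fun z => eval a (Nat.pair i z)) (i : ℕ) :
    Set.InjOn (familyFn a i) {p | IsIndex a p} := by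
  intro p hp q hq h
  rcases IsIndex.cases hp with ⟨g, rfl, hg⟩ | ⟨g, s, rfl, hg⟩ | ⟨σ, rfl, hσ, hd⟩ <;>
    rcases IsIndex.cases hq with ⟨g', rfl, hg'⟩ | ⟨g', s', rfl, hg'⟩ | ⟨σ', rfl, hσ', hd'⟩
  · rw [familyFn_of_not_refuted hg, familyFn_of_not_refuted hg'] at h
    rw [eq_of_forall_not_refuted hg hg' (congrFun h)]
  · rw [familyFn_of_not_refuted hg, familyFn_of_firstRefuted hg'] at h
    exact (ha _ ⟨_, (show Dumped a (dump a g' s') from ⟨g', s', hg', rfl⟩).length_odd, h⟩).elim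
  · rw [familyFn_of_not_refuted hg, familyFn_of_ne_nil (ne_nil_of_length_odd hσ')] at h
    exact (ha _ ⟨_, swap_length_odd hσ', h⟩).elim
  · rw [familyFn_of_firstRefuted hg, familyFn_of_not_refuted hg'] at h
    exact (ha _ ⟨_, (show Dumped a (dump a g s) from ⟨g, s, hg, rfl⟩).length_odd, h.symm⟩).elim
  · rw [familyFn_of_firstRefuted hg, familyFn_of_firstRefuted hg'] at h
    rw [(dump_inj (listFn_injective h)).1]
  · rw [familyFn_of_firstRefuted hg, familyFn_of_ne_nil (ne_nil_of_length_odd hσ')] at h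
    exact (not_dumped_swap hd' ⟨g, s, hg, (listFn_injective h).symm⟩).elim
  · rw [familyFn_of_ne_nil (ne_nil_of_length_odd hσ), familyFn_of_not_refuted hg'] at h
    exact (ha _ ⟨_, swap_length_odd hσ, h.symm⟩).elim
  · rw [familyFn_of_ne_nil (ne_nil_of_length_odd hσ), familyFn_of_firstRefuted hg'] at h
    exact (not_dumped_swap hd ⟨g', s', hg', listFn_injective h⟩).elim
  · rw [familyFn_of_ne_nil (ne_nil_of_length_odd hσ),
      familyFn_of_ne_nil (ne_nil_of_length_odd hσ')] at h
    rw [(swap_involutive i).injective (listFn_injective h)]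

theorem exists_familyFn_eq {f : ℕ →. ℕ}
    (hf : IsOddString f ∨ ∃ i, (fun z => eval a (Nat.pair i z)) = f) (i : ℕ) :
    ∃ p, IsIndex a p ∧ familyFn a i p = f := by
  rcases hf with ⟨τ, hτ, rfl⟩ | ⟨j, rfl⟩
  · by_cases hd : Dumped a τ
    · obtain ⟨g, s, hg, rfl⟩ := hd
      exact ⟨(g, []), Or.inl rfl, familyFn_of_firstRefuted hg⟩
    · refine ⟨(0, swap i τ), Or.inr ⟨rfl, swap_length_odd hτ, not_dumped_swap hd⟩, ?_⟩
      rw [familyFn_of_ne_nil (ne_nil_of_length_odd (swap_length_odd hτ)), swap_involutive i τ]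
  · obtain ⟨g, hg, h⟩ := exists_forall_not_refuted a j
    exact ⟨(g, []), Or.inl rfl, (familyFn_of_not_refuted hg).trans (funext h)⟩

theorem familyFn_singleton_eq_iff {i j : ℕ} (hij : i ≠ j) (e : ℕ) :
    familyFn a i (0, [e]) = familyFn a j (0, [e]) ↔ ¬(eval (Denumerable.ofNat Code e) 0).Dom := by
  rw [familyFn_of_ne_nil (List.cons_ne_nil _ _), familyFn_of_ne_nil (List.cons_ne_nil _ _),
    listFn_injective.eq_iff, ← exists_haltsAt]
  constructor
  · rintro h ⟨s, hs⟩
    rw [swap_of_haltsAt hs, swap_of_haltsAt hs] at h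
    simp [hij] at h
  · intro h
    have : ∀ k, swap k [e] = [e] := fun k => swap_of_forall_ne fun e' s hs =>
      ⟨by rintro ⟨⟩; exact h ⟨s, hs⟩, by simp⟩
    rw [this, this]

end Family

/-- Khutoretskii: a uniformly c.e. sequence of pairwise incomparable Friedberg
numberings of 𝒫⁽¹⁾. -/
theorem khutoretskii_antichain :
    ∃ ν : ℕ → ℕ → ℕ →. ℕ, UniformlyCE ν ∧
      (∀ i, IsFriedberg PCF (ν i)) ∧
      ∀ i j, i ≠ j → ¬ Reducible (ν i) (ν j) := by
  obtain ⟨a, ha⟩ := exists_code_nonOddString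
  have ha' : ∀ i, (fun z => a.eval (Nat.pair i z)) = nonOddString i := fun i => funext (ha i)
  obtain ⟨b, hb, hbinj, hbrange⟩ :=
    exists_computable_enumeration (primrecPred_isIndex a) (infinite_isIndex a)
  have hbmem : ∀ n, IsIndex a (b n) := fun n => hbrange.subset ⟨n, rfl⟩
  have hinj : ∀ i, Function.Injective fun n => familyFn a i (b n) := fun i n m h =>
    hbinj (familyFn_injOn (fun i => ha' i ▸ not_isOddString_nonOddString i) i
      (hbmem n) (hbmem m) h)
  have hce : UniformlyCE fun i n => familyFn a i (b n) :=
    (partrec_familyFn a).comp (((Computable.fst.comp Computable.fst).pair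
      (hb.comp (Computable.snd.comp Computable.fst))).pair Computable.snd)
  have hcomp : ∀ i, Partrec₂ fun n => familyFn a i (b n) := fun i =>
    hce.comp ((Computable.const i).pair Computable.fst) Computable.snd
  refine ⟨fun i n => familyFn a i (b n), hce, fun i => ⟨⟨⟨fun n => ?_, fun f hf => ?_⟩,
    hcomp i⟩, hinj i⟩, ?_⟩
  · exact Partrec.nat_iff.1 ((hcomp i).comp (Computable.const n) Computable.id)
  · obtain ⟨p, hp, hpf⟩ := exists_familyFn_eq (a := a)
      (by simpa only [ha'] using isOddString_or_exists_nonOddString hf) i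
    obtain ⟨n, rfl⟩ := hbrange.superset hp
    exact ⟨n, hpf⟩
  rintro i j hij ⟨f, hf, hred⟩
  obtain ⟨c, hc, hbc⟩ := computable_of_apply_eq hb
    (g := fun e : Nat.Partrec.Code => ((0, [Encodable.encode e]) : ℕ × List ℕ))
    ((Primrec.const 0).pair (Primrec.list_cons.comp Primrec.encode (Primrec.const []))).to_comp
    fun e => hbrange.superset (isIndex_singleton a _)
  have hdec : ComputablePred fun e => ¬f (c e) = c e :=
    (Computable.computablePred
      (Primrec.eq.decide.to_comp.comp (hf.comp hc) hc)).not
  refine ComputablePred.halting_problem 0 (hdec.of_eq fun e => ?_)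
  have h := familyFn_singleton_eq_iff (a := a) hij (Encodable.encode e)
  have hi : familyFn a j (b (f (c e))) = familyFn a j (b (c e)) ↔ f (c e) = c e :=
    (hinj j).eq_iff
  rw [← hbc, show familyFn a i (b (c e)) = familyFn a j (b (f (c e))) from hred (c e), hi,
    Denumerable.ofNat_encode] at h
  rw [h, not_not]
end

section
/- (Kummer) Let 𝒜 and ℬ be disjoint subsets of 𝒫⁽¹⁾ such that both have Friedberg numberings and every finite subfunction of a member of 𝒜 has infinitely many extensions in ℬ. Then there is a uniformly c.e. sequence of pairwise incomparable Friedberg numberings of 𝒜 ∪ ℬ. -/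
open Nat.Partrec (Code)

theorem Partrec₂.exists_eval_eq {ν : ℕ → ℕ →. ℕ} (hν : Partrec₂ ν) :
    ∃ c : Code, ∀ i x, c.eval (Nat.pair i x) = ν i x := by
  have h : Partrec fun n : ℕ => ν n.unpair.1 n.unpair.2 :=
    hν.comp (Computable.fst.comp Computable.unpair) (Computable.snd.comp Computable.unpair)
  obtain ⟨c, hc⟩ := Code.exists_code.1 (Partrec.nat_iff.1 h)
  exact ⟨c, fun i x => by simp [hc]⟩

theorem UniformlyCE.partrec₂ {ν : ℕ → ℕ → ℕ →. ℕ} (hν : UniformlyCE ν) (i : ℕ) : Partrec₂ (ν i) :=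
  Partrec₂.comp (f := fun p : ℕ × ℕ => ν p.1 p.2) hν ((Computable.const i).pair Computable.fst)
    Computable.snd

/-- The numbering with the values of `ν` at odd indices and those of `μ` at even indices. -/
theorem UniformlyCE.join {ν μ : ℕ → ℕ → ℕ →. ℕ} (hν : UniformlyCE ν) (hμ : UniformlyCE μ) :
    UniformlyCE fun i n x => bif n.bodd then ν i n.div2 x else μ i n.div2 x := by
  have hn : Computable fun w : (ℕ × ℕ) × ℕ => w.1.2 := Computable.snd.comp Computable.fst
  have harg : Computable fun w : (ℕ × ℕ) × ℕ => (w.1.1, w.1.2.div2) :=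
    (Computable.fst.comp Computable.fst).pair (Computable.nat_div2.comp hn)
  exact Partrec.cond (Computable.nat_bodd.comp hn)
    (Partrec₂.comp (f := fun p : ℕ × ℕ => ν p.1 p.2) hν harg Computable.snd)
    (Partrec₂.comp (f := fun p : ℕ × ℕ => μ p.1 p.2) hμ harg Computable.snd)

theorem exists_bound_of_forall_lt {P : ℕ → ℕ → Prop} (hmono : ∀ x k l, k ≤ l → P x k → P x l)
    (n : ℕ) (h : ∀ x < n, ∃ k, P x k) : ∃ k, ∀ x < n, P x k := by
  induction n with
  | zero => exact ⟨0, by simp⟩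
  | succ n ih =>
    obtain ⟨k, hk⟩ := ih fun x hx => h x (by omega)
    obtain ⟨l, hl⟩ := h n (by omega)
    refine ⟨max k l, fun x hx => ?_⟩
    rcases Nat.lt_succ_iff_lt_or_eq.1 hx with hx | rfl
    · exact hmono _ _ _ (le_max_left _ _) (hk x hx)
    · exact hmono _ _ _ (le_max_right _ _) hl

/-- A total search for the least witness of a primitive recursive predicate is computable. -/
theorem exists_computable_least {α : Type*} [Primcodable α] {R : α → ℕ → Prop}
    (hR : PrimrecRel R) (htot : ∀ a, ∃ p, R a p) :
    ∃ f : α → ℕ, Computable f ∧ (∀ a, R a (f a)) ∧ ∀ a p, R a p → f a ≤ p := by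
  classical
  refine ⟨fun a => Nat.find (htot a), ?_, fun a => Nat.find_spec (htot a),
    fun a p h => Nat.find_min' _ h⟩
  have hd : Primrec₂ fun a p => decide (R a p) := hR.decide
  refine (Partrec.rfind hd.to_comp.partrec₂).of_eq fun a => ?_
  refine Part.eq_some_iff.2 (Nat.mem_rfind.2 ⟨?_, fun {m} hm => ?_⟩)
  · simpa using Nat.find_spec (htot a)
  · simpa using Nat.find_min (htot a) hm

/-- Uniformly in `i`, choose for each stage `s` a fresh value satisfying the constraint of `s`,
so that every value gets chosen because infinitely many stages are unconstrained. -/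
theorem exists_computable_bijective_selection {P : ℕ → ℕ → ℕ → ℕ → Prop}
    (hP : PrimrecPred fun q : (ℕ × ℕ) × ℕ × ℕ => P q.1.1 q.1.2 q.2.1 q.2.2)
    (htot : ∀ i s, ∀ L : List ℕ, ∃ b ∉ L, ∃ k, P i s b k)
    (hfree : ∀ i, {s | ∀ b k, P i s b k}.Infinite) :
    ∃ c : ℕ → ℕ → ℕ, Computable₂ c ∧ (∀ i, Function.Bijective (c i)) ∧
      ∀ i s, ∃ k, P i s (c i s) k := by
  have hmem : PrimrecPred fun q : ℕ × List ℕ => q.1 ∉ q.2 :=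
    (((Primrec.eq (α := ℕ)).exists_mem_list.comp Primrec.snd Primrec.fst).not).of_eq
      fun q => by simp
  have hR : PrimrecRel fun (a : (ℕ × ℕ) × List ℕ) (p : ℕ) =>
      p.unpair.1 ∉ a.2 ∧ P a.1.1 a.1.2 p.unpair.1 p.unpair.2 := by
    refine PrimrecPred.and (hmem.comp
      (f := fun q : ((ℕ × ℕ) × List ℕ) × ℕ => (q.2.unpair.1, q.1.2)) ?_) (hP.comp
      (f := fun q : ((ℕ × ℕ) × List ℕ) × ℕ => (q.1.1, q.2.unpair)) ?_)
    · exact (Primrec.fst.comp (Primrec.unpair.comp Primrec.snd)).pair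
        (Primrec.snd.comp Primrec.fst)
    · exact (Primrec.fst.comp Primrec.fst).pair (Primrec.unpair.comp Primrec.snd)
  obtain ⟨f, hf, hfR, hfmin⟩ := exists_computable_least hR fun a => by
    obtain ⟨b, hb, k, hk⟩ := htot a.1.1 a.1.2 a.2
    exact ⟨Nat.pair b k, by simpa using ⟨hb, hk⟩⟩
  let hist : ℕ → ℕ → List ℕ := fun i s =>
    Nat.rec [] (fun t L => (f ((i, t), L)).unpair.1 :: L) s
  let c : ℕ → ℕ → ℕ := fun i s => (f ((i, s), hist i s)).unpair.1
  have hhist : Computable₂ hist := by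
    refine Computable.nat_rec (f := fun q : ℕ × ℕ => q.2) (g := fun _ => ([] : List ℕ))
      (h := fun q r => (f ((q.1, r.1), r.2)).unpair.1 :: r.2)
      Computable.snd (Computable.const _) ?_
    refine Computable.list_cons.comp (Computable.fst.comp (Computable.unpair.comp (hf.comp ?_))) ?_
    · exact (((Computable.fst.comp Computable.fst).pair
        (Computable.fst.comp Computable.snd)).pair (Computable.snd.comp Computable.snd))
    · exact Computable.snd.comp Computable.snd
  have hc : Computable₂ c :=
    Computable.fst.comp (Computable.unpair.comp (hf.comp (Computable.id.pair hhist)))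
  have mem_hist : ∀ i s b, b ∈ hist i s ↔ ∃ t < s, c i t = b := by
    intro i s b
    induction s with
    | zero => simp [hist]
    | succ s ih =>
      have : hist i (s + 1) = c i s :: hist i s := rfl
      rw [this, List.mem_cons, ih]
      constructor
      · rintro (rfl | ⟨t, ht, rfl⟩)
        · exact ⟨s, by omega, rfl⟩
        · exact ⟨t, by omega, rfl⟩
      · rintro ⟨t, ht, rfl⟩
        rcases Nat.lt_succ_iff_lt_or_eq.1 ht with ht | rfl
        · exact Or.inr ⟨t, ht, rfl⟩
        · exact Or.inl rfl
  have hne : ∀ i s t, t < s → c i t ≠ c i s := fun i s t hts h =>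
    (hfR ((i, s), hist i s)).1 ((mem_hist i s _).2 ⟨t, hts, h⟩)
  have hinj : ∀ i, Function.Injective (c i) := by
    intro i s t h
    rcases lt_trichotomy s t with hst | hst | hst
    · exact (hne i t s hst h).elim
    · exact hst
    · exact (hne i s t hst h.symm).elim
  refine ⟨c, hc, fun i => ⟨hinj i, fun b => ?_⟩, fun i s => ⟨_, (hfR ((i, s), hist i s)).2⟩⟩
  by_contra! hb
  refine hfree i (Set.Finite.of_finite_image (f := fun s => f ((i, s), hist i s)) ?_ ?_)
  · refine (Set.finite_Iic (Nat.pair b 0)).subset ?_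
    rintro _ ⟨s, hs, rfl⟩
    refine hfmin ((i, s), hist i s) _ ?_
    simp only [Nat.unpair_pair]
    refine ⟨fun h => ?_, hs b 0⟩
    obtain ⟨t, -, ht⟩ := (mem_hist i s b).1 h
    exact hb t ht
  · intro s _ t _ h
    exact hinj i (congrArg (fun p => (Nat.unpair p).1) h)

/-- Uniformly in `i`, there is a computable permutation `c i` such that `β (c i s)` extends the part
of `α r` computed by stage `s` whenever `ent i s = some r`. -/
theorem exists_selection_extending {A B : Set (ℕ →. ℕ)} {α β : ℕ → ℕ →. ℕ}
    (hαA : ∀ r, α r ∈ A) (hβsurj : ∀ f ∈ B, ∃ b, β b = f)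
    (hext : ∀ f ∈ A, ∀ g : ℕ →. ℕ, FinSubfn g f → {h | h ∈ B ∧ Subfn g h}.Infinite)
    {ca cb : Code} (hca : ∀ r x, ca.eval (Nat.pair r x) = α r x)
    (hcb : ∀ b x, cb.eval (Nat.pair b x) = β b x)
    {ent : ℕ → ℕ → Option ℕ} (hent : Primrec₂ ent)
    (hent_free : ∀ i, {s | ent i s = none}.Infinite) :
    ∃ c : ℕ → ℕ → ℕ, Computable₂ c ∧ (∀ i, Function.Bijective (c i)) ∧
      ∀ i s r, ent i s = some r → ∀ t ≤ s, ∀ x y,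
        y ∈ ca.evaln t (Nat.pair r x) → y ∈ β (c i s) x := by
  classical
  let v : ℕ → ℕ → ℕ → Option ℕ := fun i s x => (ent i s).bind fun r => ca.evaln s (Nat.pair r x)
  let P : ℕ → ℕ → ℕ → ℕ → Prop := fun i s b k =>
    ∀ x < s, v i s x = none ∨ v i s x = cb.evaln k (Nat.pair b x)
  have hv : Primrec fun q : (ℕ × ℕ) × ℕ => v q.1.1 q.1.2 q.2 := by
    refine Primrec.option_bind (hent.comp (Primrec.fst.comp Primrec.fst)
      (Primrec.snd.comp Primrec.fst)) ?_
    refine Code.primrec_evaln.comp (((Primrec.snd.comp (Primrec.fst.comp Primrec.fst)).pair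
      (Primrec.const ca)).pair (Primrec₂.natPair.comp Primrec.snd
        (Primrec.snd.comp Primrec.fst)))
  have hP : PrimrecPred fun q : (ℕ × ℕ) × ℕ × ℕ => P q.1.1 q.1.2 q.2.1 q.2.2 := by
    have hv' : Primrec fun w : ℕ × (ℕ × ℕ) × ℕ × ℕ => v w.2.1.1 w.2.1.2 w.1 :=
      hv.comp ((Primrec.fst.comp Primrec.snd).pair Primrec.fst)
    have hb : Primrec fun w : ℕ × (ℕ × ℕ) × ℕ × ℕ =>
        cb.evaln w.2.2.2 (Nat.pair w.2.2.1 w.1) := by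
      have h22 : Primrec fun w : ℕ × (ℕ × ℕ) × ℕ × ℕ => w.2.2 := Primrec.snd.comp Primrec.snd
      exact Code.primrec_evaln.comp (((Primrec.snd.comp h22).pair (Primrec.const cb)).pair
        (Primrec₂.natPair.comp (Primrec.fst.comp h22) Primrec.fst))
    have hbody : PrimrecRel fun (x : ℕ) (q : (ℕ × ℕ) × ℕ × ℕ) =>
        v q.1.1 q.1.2 x = none ∨ v q.1.1 q.1.2 x = cb.evaln q.2.2 (Nat.pair q.2.1 x) :=
      PrimrecPred.or (Primrec.eq.comp hv' (Primrec.const none)) (Primrec.eq.comp hv' hb)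
    exact (hbody.forall_mem_list.comp (Primrec.list_range.comp (Primrec.snd.comp Primrec.fst))
      Primrec.id).of_eq fun q => by simp [P]
  have htot : ∀ i s, ∀ L : List ℕ, ∃ b ∉ L, ∃ k, P i s b k := by
    intro i s L
    rcases hes : ent i s with _ | r
    · obtain ⟨b, hb⟩ := L.toFinset.exists_notMem
      exact ⟨b, by simpa using hb, 0, fun x _ => Or.inl (by simp [v, hes])⟩
    have hvr : ∀ x, v i s x = ca.evaln s (Nat.pair r x) := fun x => by simp [v, hes]
    have hfin : FinSubfn (fun x => (v i s x : Part ℕ)) (α r) := by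
      constructor
      · refine (Set.finite_Iio s).subset fun x hx => ?_
        obtain ⟨y, hy⟩ := Part.dom_iff_mem.1 hx
        rw [Part.mem_ofOption, hvr] at hy
        exact (Nat.right_le_pair r x).trans_lt (Code.evaln_bound hy)
      · intro x y hy
        rw [Part.mem_ofOption, hvr] at hy
        rw [← hca]
        exact Code.evaln_sound hy
    obtain ⟨h, ⟨hhB, hsub⟩, hnot⟩ := (hext _ (hαA r) _ hfin).exists_notMem_finset
      (L.toFinset.image β)
    obtain ⟨b, rfl⟩ := hβsurj h hhB
    refine ⟨b, fun hb => hnot (Finset.mem_image_of_mem _ (by simpa using hb)), ?_⟩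
    have := exists_bound_of_forall_lt (P := fun x k => ∀ y ∈ v i s x,
        y ∈ cb.evaln k (Nat.pair b x))
      (fun x k l hkl hk y hy => Code.evaln_mono hkl (hk y hy)) s (fun x _ => by
        rcases hvx : v i s x with _ | y
        · exact ⟨0, by simp⟩
        · have hy : y ∈ β b x := hsub x y (by simp [hvx])
          rw [← hcb] at hy
          obtain ⟨k, hk⟩ := Code.evaln_complete.1 hy
          exact ⟨k, by simpa using hk⟩)
    obtain ⟨k, hk⟩ := this
    refine ⟨k, fun x hx => ?_⟩
    rcases hvx : v i s x with _ | y
    · exact Or.inl rfl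
    · exact Or.inr (hk x hx y hvx).symm
  have hfree : ∀ i, {s | ∀ b k, P i s b k}.Infinite := fun i =>
    (hent_free i).mono fun s hs b k x _ => Or.inl (by simp [v, show ent i s = none from hs])
  obtain ⟨c, hc, hcbij, hcP⟩ := exists_computable_bijective_selection hP htot hfree
  refine ⟨c, hc, hcbij, ?_⟩
  intro i s r hes t hts x y hy
  have hy' := Code.evaln_mono hts hy
  have hx : x < s := (Nat.right_le_pair r x).trans_lt (Code.evaln_bound hy')
  have hvx : v i s x = some y := by simpa [v, hes] using hy'
  obtain ⟨k, hk⟩ := hcP i s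
  have := hk x hx
  rw [hvx] at this
  rw [← hcb]
  exact Code.evaln_sound (k := k) (this.resolve_left (by simp)).symm

/-- A numbering that copies `α r` until the first stage `s` with `ent i s = some r`, and from then
on continues as `β (c i s)`. -/
theorem exists_moved_numbering {α β : ℕ → ℕ →. ℕ} (hαc : Partrec₂ α) (hβc : Partrec₂ β)
    {ca : Code} (hca : ∀ r x, ca.eval (Nat.pair r x) = α r x)
    {ent : ℕ → ℕ → Option ℕ} (hent : Primrec₂ ent)
    (hent_inj : ∀ i s t r, ent i s = some r → ent i t = some r → s = t)
    {c : ℕ → ℕ → ℕ} (hc : Computable₂ c)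
    (happrox : ∀ i s r, ent i s = some r → ∀ t ≤ s, ∀ x y,
      y ∈ ca.evaln t (Nat.pair r x) → y ∈ β (c i s) x) :
    ∃ moved : ℕ → ℕ → ℕ →. ℕ, UniformlyCE moved ∧
      (∀ i s r, ent i s = some r → moved i r = β (c i s)) ∧
      ∀ i r, (∀ s, ent i s ≠ some r) → moved i r = α r := by
  classical
  let T : (ℕ × ℕ) × ℕ → ℕ → Prop := fun q t =>
    ent q.1.1 t = some q.1.2 ∨ ca.evaln t (Nat.pair q.1.2 q.2) ≠ none
  have hT : PrimrecRel T := by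
    have h11 : Primrec fun w : ((ℕ × ℕ) × ℕ) × ℕ => w.1.1 := Primrec.fst.comp Primrec.fst
    refine PrimrecPred.or (Primrec.eq.comp (hent.comp (Primrec.fst.comp h11) Primrec.snd)
      (Primrec.option_some.comp (Primrec.snd.comp h11))) (PrimrecPred.not (Primrec.eq.comp
        (Code.primrec_evaln.comp ((Primrec.snd.pair (Primrec.const ca)).pair
          (Primrec₂.natPair.comp (Primrec.snd.comp h11) (Primrec.snd.comp Primrec.fst))))
        (Primrec.const none)))
  let moved : ℕ → ℕ → ℕ →. ℕ := fun i r x =>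
    (Nat.rfind fun t => Part.some (decide (T ((i, r), x) t))).bind fun t =>
      bif decide (ent i t = some r) then β (c i t) x else α r x
  have moved_of_ent : ∀ i s r, ent i s = some r → moved i r = β (c i s) := by
    intro i s r hes
    funext x
    obtain ⟨t, ht, hts⟩ := Nat.rfind_min' (p := fun t => decide (T ((i, r), x) t)) (m := s)
      (by simp [T, hes])
    have htT : T ((i, r), x) t := by simpa using Nat.rfind_spec ht
    have hmoved : moved i r x =
        bif decide (ent i t = some r) then β (c i t) x else α r x := by
      have := Part.eq_some_iff.2 ht
      simp only [moved]
      exact (congrArg (fun o : Part ℕ => o.bind _) this).trans (Part.bind_some _ _)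
    rw [hmoved]
    by_cases het : ent i t = some r
    · obtain rfl := hent_inj i t s r het hes
      simp [hes]
    · obtain ⟨y, hy⟩ := Option.ne_none_iff_exists'.1 (htT.resolve_left het)
      have h1 : y ∈ α r x := by
        rw [← hca]
        exact Code.evaln_sound hy
      have h2 : y ∈ β (c i s) x := happrox i s r hes t hts x y hy
      simp [het, Part.eq_some_iff.2 h1, Part.eq_some_iff.2 h2]
  have moved_of_not_ent : ∀ i r, (∀ s, ent i s ≠ some r) → moved i r = α r := by
    intro i r hne
    funext x
    refine Part.ext fun y => ?_
    simp only [moved, hne, decide_false, cond_false, Part.mem_bind_iff]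
    refine ⟨fun ⟨_, _, h⟩ => h, fun h => ?_⟩
    rw [← hca] at h
    obtain ⟨k, hk⟩ := Code.evaln_complete.1 h
    obtain ⟨t, ht, -⟩ := Nat.rfind_min' (p := fun t => decide (T ((i, r), x) t)) (m := k)
      (by simp [T, Option.mem_def.1 hk])
    exact ⟨t, ht, by rwa [← hca]⟩
  refine ⟨moved, ?_, moved_of_ent, moved_of_not_ent⟩
  have h1 : Computable fun w : ((ℕ × ℕ) × ℕ) × ℕ => w.1.1.1 :=
    Computable.fst.comp (Computable.fst.comp Computable.fst)
  have h2 : Computable fun w : ((ℕ × ℕ) × ℕ) × ℕ => w.1.1.2 :=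
    Computable.snd.comp (Computable.fst.comp Computable.fst)
  have h3 : Computable fun w : ((ℕ × ℕ) × ℕ) × ℕ => w.1.2 :=
    Computable.snd.comp Computable.fst
  have hTd : Primrec₂ fun q t => decide (T q t) := hT.decide
  have hdec : Computable fun w : ((ℕ × ℕ) × ℕ) × ℕ =>
      decide (ent w.1.1.1 w.2 = some w.1.1.2) := by
    have heq : Primrec₂ fun a b : Option ℕ => decide (a = b) := Primrec.eq.decide
    exact heq.to_comp.comp (hent.to_comp.comp h1 Computable.snd)
      (Computable.option_some.comp h2)
  exact (Partrec.rfind hTd.to_comp.partrec₂).bind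
    (Partrec.cond hdec (hβc.comp (hc.comp h1 Computable.snd) h3) (hαc.comp h2 h3))

/-- Injectivity and surjectivity of a numbering in which some even indices are moved from `A` to `B`
while odd indices take over the values of `A` so released. -/
theorem isNumbering_and_injective_of_moves {A B : Set (ℕ →. ℕ)} (hdisj : Disjoint A B)
    {α β : ℕ → ℕ →. ℕ} (hα : IsNumbering A α) (hαinj : Function.Injective α)
    (hβ : IsNumbering B β) (hβinj : Function.Injective β) {ent : ℕ → Option ℕ}
    (hent_inj : ∀ s t r, ent s = some r → ent t = some r → s = t)
    {c : ℕ → ℕ} (hc : Function.Bijective c) {moved taken μ : ℕ → ℕ →. ℕ}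
    (moved_of_ent : ∀ s r, ent s = some r → moved r = β (c s))
    (moved_of_not_ent : ∀ r, (∀ s, ent s ≠ some r) → moved r = α r)
    (taken_of_ent : ∀ s r, ent s = some r → taken s = α r)
    (taken_of_none : ∀ s, ent s = none → taken s = β (c s))
    (μ_even : ∀ r, μ (2 * r) = moved r) (μ_odd : ∀ s, μ (2 * s + 1) = taken s) :
    IsNumbering (A ∪ B) μ ∧ Function.Injective μ := by
  obtain ⟨hαA, hαsurj⟩ := hα
  obtain ⟨hβB, hβsurj⟩ := hβ
  have hAB : ∀ r b, α r ≠ β b := fun r b h =>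
    Set.disjoint_left.1 hdisj (hαA r) (h ▸ hβB b)
  refine ⟨⟨fun n => ?_, ?_⟩, ?_⟩
  · obtain ⟨r, rfl | rfl⟩ := n.even_or_odd'
    · rw [μ_even]
      by_cases h : ∃ s, ent s = some r
      · obtain ⟨s, hs⟩ := h
        exact Or.inr (moved_of_ent s r hs ▸ hβB _)
      · push Not at h
        exact Or.inl (moved_of_not_ent r h ▸ hαA _)
    · rw [μ_odd]
      rcases hs : ent r with _ | a
      · exact Or.inr (taken_of_none r hs ▸ hβB _)
      · exact Or.inl (taken_of_ent r a hs ▸ hαA _)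
  · rintro f (hf | hf)
    · obtain ⟨r, rfl⟩ := hαsurj f hf
      by_cases h : ∃ s, ent s = some r
      · obtain ⟨s, hs⟩ := h
        exact ⟨2 * s + 1, by rw [μ_odd, taken_of_ent s r hs]⟩
      · push Not at h
        exact ⟨2 * r, by rw [μ_even, moved_of_not_ent r h]⟩
    · obtain ⟨b, rfl⟩ := hβsurj f hf
      obtain ⟨s, rfl⟩ := hc.2 b
      rcases hs : ent s with _ | r
      · exact ⟨2 * s + 1, by rw [μ_odd, taken_of_none s hs]⟩
      · exact ⟨2 * r, by rw [μ_even, moved_of_ent s r hs]⟩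
  · have hmm : ∀ r r', moved r = moved r' → r = r' := by
      intro r r' h
      by_cases hr : ∃ s, ent s = some r <;> by_cases hr' : ∃ s, ent s = some r'
      · obtain ⟨s, hs⟩ := hr
        obtain ⟨s', hs'⟩ := hr'
        rw [moved_of_ent s r hs, moved_of_ent s' r' hs'] at h
        obtain rfl := hc.1 (hβinj h)
        exact Option.some.inj (hs.symm.trans hs')
      · obtain ⟨s, hs⟩ := hr
        push Not at hr'
        rw [moved_of_ent s r hs, moved_of_not_ent r' hr'] at h
        exact (hAB _ _ h.symm).elim
      · obtain ⟨s', hs'⟩ := hr'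
        push Not at hr
        rw [moved_of_not_ent r hr, moved_of_ent s' r' hs'] at h
        exact (hAB _ _ h).elim
      · push Not at hr hr'
        rw [moved_of_not_ent r hr, moved_of_not_ent r' hr'] at h
        exact hαinj h
    have htt : ∀ s s', taken s = taken s' → s = s' := by
      intro s s' h
      rcases hs : ent s with _ | r <;> rcases hs' : ent s' with _ | r'
      · rw [taken_of_none s hs, taken_of_none s' hs'] at h
        exact hc.1 (hβinj h)
      · rw [taken_of_none s hs, taken_of_ent s' r' hs'] at h
        exact (hAB _ _ h.symm).elim
      · rw [taken_of_ent s r hs, taken_of_none s' hs'] at h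
        exact (hAB _ _ h).elim
      · rw [taken_of_ent s r hs, taken_of_ent s' r' hs'] at h
        obtain rfl := hαinj h
        exact hent_inj s s' r hs hs'
    have hmt : ∀ r s, moved r ≠ taken s := by
      intro r s h
      by_cases hr : ∃ t, ent t = some r
      · obtain ⟨t, ht⟩ := hr
        rcases hs : ent s with _ | r'
        · rw [moved_of_ent t r ht, taken_of_none s hs] at h
          obtain rfl := hc.1 (hβinj h)
          simp [hs] at ht
        · rw [moved_of_ent t r ht, taken_of_ent s r' hs] at h
          exact hAB _ _ h.symm
      · push Not at hr
        rcases hs : ent s with _ | r'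
        · rw [moved_of_not_ent r hr, taken_of_none s hs] at h
          exact hAB _ _ h
        · rw [moved_of_not_ent r hr, taken_of_ent s r' hs] at h
          exact hr s (hαinj h ▸ hs)
    intro m n h
    obtain ⟨a, rfl | rfl⟩ := m.even_or_odd' <;> obtain ⟨b, rfl | rfl⟩ := n.even_or_odd' <;>
      simp only [μ_even, μ_odd] at h
    · rw [hmm a b h]
    · exact (hmt a b h).elim
    · exact (hmt b a h.symm).elim
    · rw [htt a b h]

/-- At stage `s`, `ent i s = some r` asks to move the index `2 * r` of the `i`-th numbering from
`α r` into `B`; the index `2 * s + 1` then takes over `α r`. -/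
theorem exists_friedberg_with_moves {A B : Set (ℕ →. ℕ)} (hdisj : Disjoint A B)
    {α β : ℕ → ℕ →. ℕ} (hα : IsFriedberg A α) (hβ : IsFriedberg B β)
    (hext : ∀ f ∈ A, ∀ g : ℕ →. ℕ, FinSubfn g f → {h | h ∈ B ∧ Subfn g h}.Infinite)
    {ent : ℕ → ℕ → Option ℕ} (hent : Primrec₂ ent)
    (hent_inj : ∀ i s t r, ent i s = some r → ent i t = some r → s = t)
    (hent_free : ∀ i, {s | ent i s = none}.Infinite) :
    ∃ μ : ℕ → ℕ → ℕ →. ℕ, UniformlyCE μ ∧ (∀ i, IsFriedberg (A ∪ B) (μ i)) ∧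
      (∀ i s r, ent i s = some r → μ i (2 * r) ∈ B) ∧
      ∀ i r, (∀ s, ent i s ≠ some r) → μ i (2 * r) = α r := by
  obtain ⟨⟨hα, hαc⟩, hαinj⟩ := hα
  obtain ⟨⟨hβ, hβc⟩, hβinj⟩ := hβ
  obtain ⟨ca, hca⟩ := hαc.exists_eval_eq
  obtain ⟨cb, hcb⟩ := hβc.exists_eval_eq
  obtain ⟨c, hc, hcbij, happrox⟩ :=
    exists_selection_extending hα.1 hβ.2 hext hca hcb hent hent_free
  obtain ⟨moved, hmovedc, moved_of_ent, moved_of_not_ent⟩ :=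
    exists_moved_numbering hαc hβc hca hent hent_inj hc happrox
  let taken : ℕ → ℕ → ℕ →. ℕ := fun i s x =>
    bif (ent i s).isSome then α ((ent i s).getD 0) x else β (c i s) x
  have taken_of_ent : ∀ i s r, ent i s = some r → taken i s = α r := by
    intro i s r hes
    funext x
    simp [taken, hes]
  have taken_of_none : ∀ i s, ent i s = none → taken i s = β (c i s) := by
    intro i s hes
    funext x
    simp [taken, hes]
  have htakenc : Partrec fun q : (ℕ × ℕ) × ℕ => taken q.1.1 q.1.2 q.2 := by
    have he : Computable fun q : (ℕ × ℕ) × ℕ => ent q.1.1 q.1.2 := hent.to_comp.comp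
      (Computable.fst.comp Computable.fst) (Computable.snd.comp Computable.fst)
    exact Partrec.cond (Primrec.option_isSome.to_comp.comp he)
      (hαc.comp (Computable.option_getD he (Computable.const 0)) Computable.snd)
      (hβc.comp (hc.comp (Computable.fst.comp Computable.fst)
        (Computable.snd.comp Computable.fst)) Computable.snd)
  let μ : ℕ → ℕ → ℕ →. ℕ := fun i n x =>
    bif n.bodd then taken i n.div2 x else moved i n.div2 x
  have μ_even : ∀ i r, μ i (2 * r) = moved i r := by
    intro i r
    funext x
    simp [μ, Nat.div2_val]
  have μ_odd : ∀ i s, μ i (2 * s + 1) = taken i s := by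
    intro i s
    funext x
    have : (2 * s + 1) / 2 = s := by omega
    simp [μ, Nat.div2_val, this]
  have hμc : UniformlyCE μ := UniformlyCE.join htakenc hmovedc
  have hμi : ∀ i, IsNumbering (A ∪ B) (μ i) ∧ Function.Injective (μ i) := fun i =>
    isNumbering_and_injective_of_moves hdisj hα hαinj hβ hβinj (hent_inj i) (hcbij i)
      (moved_of_ent i) (moved_of_not_ent i) (taken_of_ent i) (taken_of_none i) (μ_even i)
      (μ_odd i)
  refine ⟨μ, hμc, fun i => ⟨⟨(hμi i).1, ?_⟩, (hμi i).2⟩, fun i s r hs => ?_, fun i r h => ?_⟩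
  · exact hμc.partrec₂ i
  · rw [μ_even, moved_of_ent i s r hs]
    exact hβ.1 _
  · rw [μ_even, moved_of_not_ent i r h]

/-- `2 * Nat.pair e i` is confirmed as a fixed point of the `e`-th partial computable function at
exactly the `k`-th evaluation step, where `s = Nat.pair e k`. -/
def FixesAt (i s : ℕ) : Prop :=
  2 * Nat.pair s.unpair.1 i ∈ (Code.ofNatCode s.unpair.1).evaln s.unpair.2
      (2 * Nat.pair s.unpair.1 i) ∧
    2 * Nat.pair s.unpair.1 i ∉ (Code.ofNatCode s.unpair.1).evaln (s.unpair.2 - 1)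
      (2 * Nat.pair s.unpair.1 i)

theorem primrecRel_fixesAt : PrimrecRel FixesAt := by
  have he : Primrec fun q : ℕ × ℕ => q.2.unpair.1 :=
    Primrec.fst.comp (Primrec.unpair.comp Primrec.snd)
  have hk : Primrec fun q : ℕ × ℕ => q.2.unpair.2 :=
    Primrec.snd.comp (Primrec.unpair.comp Primrec.snd)
  have hr : Primrec fun q : ℕ × ℕ => 2 * Nat.pair q.2.unpair.1 q.1 :=
    Primrec.nat_mul.comp (Primrec.const 2) (Primrec₂.natPair.comp he Primrec.fst)
  have hcode : Primrec fun q : ℕ × ℕ => Code.ofNatCode q.2.unpair.1 :=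
    (Primrec.ofNat Code).comp he
  have hev : ∀ {g : ℕ × ℕ → ℕ}, Primrec g → PrimrecPred fun q : ℕ × ℕ =>
      2 * Nat.pair q.2.unpair.1 q.1 ∈ (Code.ofNatCode q.2.unpair.1).evaln (g q)
        (2 * Nat.pair q.2.unpair.1 q.1) := fun hg =>
    Primrec.eq.comp (Code.primrec_evaln.comp ((hg.pair hcode).pair hr))
      (Primrec.option_some.comp hr)
  exact (hev hk).and (hev (Primrec.nat_sub.comp hk (Primrec.const 1))).not

theorem FixesAt.unique {i s t : ℕ} (hs : FixesAt i s) (ht : FixesAt i t)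
    (hst : s.unpair.1 = t.unpair.1) : s = t := by
  obtain ⟨hs1, hs2⟩ := hs
  obtain ⟨ht1, ht2⟩ := ht
  rw [← hst] at ht1 ht2
  have hk : s.unpair.2 = t.unpair.2 := by
    rcases lt_trichotomy s.unpair.2 t.unpair.2 with h | h | h
    · exact (ht2 (Code.evaln_mono (by omega) hs1)).elim
    · exact h
    · exact (hs2 (Code.evaln_mono (by omega) ht1)).elim
  rw [← Nat.pair_unpair s, ← Nat.pair_unpair t, hst, hk]

theorem not_fixesAt_pair_zero (i e : ℕ) : ¬ FixesAt i (Nat.pair e 0) := fun h => by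
  have := Code.evaln_bound h.1
  simp at this

theorem exists_fixesAt_iff (i e : ℕ) :
    (∃ s, s.unpair.1 = e ∧ FixesAt i s) ↔
      2 * Nat.pair e i ∈ (Code.ofNatCode e).eval (2 * Nat.pair e i) := by
  constructor
  · rintro ⟨s, rfl, hs, -⟩
    exact Code.evaln_sound hs
  · intro h
    classical
    have hex := Code.evaln_complete.1 h
    refine ⟨Nat.pair e (Nat.find hex), by simp, ?_⟩
    have hspec := Nat.find_spec hex
    have hpos : Nat.find hex ≠ 0 := fun h0 => by
      have := Code.evaln_bound hspec
      omega
    refine ⟨by simpa using hspec, ?_⟩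
    simpa using Nat.find_min hex (m := Nat.find hex - 1) (by omega)

/-- Kummer: antichain criterion with two Friedberg pieces. -/
theorem kummer_antichain_two_pieces (A B : Set (ℕ →. ℕ))
    (hA : A ⊆ PCF) (hB : B ⊆ PCF) (hdisj : Disjoint A B)
    (hAnum : ∃ ν : ℕ → ℕ →. ℕ, IsFriedberg A ν)
    (hBnum : ∃ ν : ℕ → ℕ →. ℕ, IsFriedberg B ν)
    (hext : ∀ f ∈ A, ∀ g : ℕ →. ℕ, FinSubfn g f → {h | h ∈ B ∧ Subfn g h}.Infinite) :
    ∃ ν : ℕ → ℕ → ℕ →. ℕ, UniformlyCE ν ∧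
      (∀ i, IsFriedberg (A ∪ B) (ν i)) ∧
      ∀ i j, i ≠ j → ¬ Reducible (ν i) (ν j) := by
  classical
  obtain ⟨α, hα⟩ := hAnum
  obtain ⟨β, hβ⟩ := hBnum
  let ent : ℕ → ℕ → Option ℕ := fun i s =>
    if FixesAt i s then some (Nat.pair s.unpair.1 i) else none
  have ent_eq : ∀ i s r, ent i s = some r ↔ FixesAt i s ∧ Nat.pair s.unpair.1 i = r := by
    intro i s r
    simp [ent]
  have hent : Primrec₂ ent := Primrec.ite primrecRel_fixesAt
    (Primrec.option_some.comp (Primrec₂.natPair.comp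
      (Primrec.fst.comp (Primrec.unpair.comp Primrec.snd)) Primrec.fst)) (Primrec.const none)
  have hent_inj : ∀ i s t r, ent i s = some r → ent i t = some r → s = t := by
    intro i s t r hs ht
    obtain ⟨hs, hsr⟩ := (ent_eq i s r).1 hs
    obtain ⟨ht, htr⟩ := (ent_eq i t r).1 ht
    exact hs.unique ht (Nat.pair_eq_pair.1 (hsr.trans htr.symm)).1
  have hent_free : ∀ i, {s | ent i s = none}.Infinite := by
    intro i
    refine Set.infinite_of_injective_forall_mem (f := fun e => Nat.pair e 0)
      (fun e e' h => (Nat.pair_eq_pair.1 h).1) fun e => ?_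
    simp [ent, not_fixesAt_pair_zero]
  obtain ⟨μ, hμ, hF, hmove, hkeep⟩ :=
    exists_friedberg_with_moves hdisj hα hβ hext hent hent_inj hent_free
  refine ⟨μ, hμ, hF, ?_⟩
  rintro i j hij ⟨f, hf, hred⟩
  obtain ⟨c, hc⟩ := Code.exists_code.1 (Partrec.nat_iff.1 hf)
  let r := Nat.pair (Code.encodeCode c) i
  have hcode : Code.ofNatCode (Code.encodeCode c) = c := Denumerable.ofNat_encode c
  have hfix := exists_fixesAt_iff i (Code.encodeCode c)
  rw [hcode, hc] at hfix
  have hj : μ j (2 * r) = α r := hkeep j r fun s hs =>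
    hij (Nat.pair_eq_pair.1 ((ent_eq j s r).1 hs).2).2.symm
  have hfix' : (∃ s, ent i s = some r) ↔ f (2 * r) = 2 * r := by
    simp only [ent_eq]
    refine Iff.trans ?_ (hfix.trans ?_)
    · simp [r, Nat.pair_eq_pair, and_comm]
    · simp [r, eq_comm]
  by_cases h : f (2 * r) = 2 * r
  · obtain ⟨s, hs⟩ := hfix'.2 h
    have hB' := hmove i s r hs
    rw [hred, h, hj] at hB'
    exact Set.disjoint_left.1 hdisj (hα.1.1.1 r) hB'
  · have hi : μ i (2 * r) = α r := hkeep i r fun s hs => h (hfix'.1 ⟨s, hs⟩)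
    exact h ((hF j).2 (by rw [← hred, hi, hj]))
end

section
/- (Kummer) Let 𝒜 ⊆ 𝒫⁽¹⁾ have a Friedberg numbering and suppose every finite subfunction of a member of 𝒜 has infinitely many extensions in 𝒜. Then there is a uniformly c.e. sequence of pairwise incomparable Friedberg numberings of 𝒜. -/
open Nat.Partrec (Code)
open Nat.Partrec.Code Denumerable

/-- Unbounded search for a decidable relation that always succeeds is a computable function. -/
theorem exists_computable_choice {α : Type*} [Primcodable α] {P : α → ℕ → Bool}
    (hP : Computable₂ P) (h : ∀ a, ∃ n, P a n = true) :
    ∃ f : α → ℕ, Computable f ∧ ∀ a, P a (f a) = true := by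
  refine ⟨fun a => Nat.find (h a), ?_, fun a => Nat.find_spec (h a)⟩
  refine (Partrec.rfind (p := fun a n => Part.some (P a n)) hP.partrec₂).of_eq fun a => ?_
  refine Part.eq_some_iff.2 (Nat.mem_rfind.2 ⟨?_, fun {m} hm => ?_⟩)
  · simpa using (Nat.find_spec (h a)).symm
  · simpa using (Nat.find_min (h a) hm)

/-- Recursion whose step may consult one earlier value besides the last one. -/
theorem exists_computable_history_rec {G : ℕ × ℕ × ℕ → ℕ} (hG : Computable G) {k : ℕ → ℕ}
    (hk : Computable k) (hks : ∀ s, k s ≤ s) :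
    ∃ w : ℕ → ℕ, Computable w ∧ ∀ s, w (s + 1) = G (w (k s), s, w s) := by
  let L : ℕ → List ℕ := fun n => Nat.rec [0]
    (fun s l => l ++ [G (l.getD (k s) 0, s, l.getD s 0)]) n
  have hgetD : Computable₂ fun (l : List ℕ) (n : ℕ) => l.getD n 0 := (Primrec.list_getD 0).to_comp
  have hL : Computable L := by
    refine Computable.nat_rec (f := fun n => n) (g := fun _ => [0])
      (h := fun _ p => p.2 ++ [G (p.2.getD (k p.1) 0, p.1, p.2.getD p.1 0)])
      Computable.id (Computable.const _) ?_
    have hs : Computable fun q : ℕ × ℕ × List ℕ => q.2.1 := Computable.fst.comp Computable.snd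
    have hl : Computable fun q : ℕ × ℕ × List ℕ => q.2.2 := Computable.snd.comp Computable.snd
    exact Computable.list_concat.comp hl (hG.comp
      ((hgetD.comp hl (hk.comp hs)).pair (hs.pair (hgetD.comp hl hs))))
  have hsucc : ∀ s, L (s + 1) = L s ++ [G ((L s).getD (k s) 0, s, (L s).getD s 0)] := fun _ => rfl
  have hlen : ∀ s, (L s).length = s + 1 := by
    intro s
    induction s with
    | zero => rfl
    | succ s ih => rw [hsucc, List.length_append, ih]; rfl
  have hstable : ∀ s j, j ≤ s → (L s).getD j 0 = (L j).getD j 0 := by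
    intro s j hj
    induction s, hj using Nat.le_induction with
    | base => rfl
    | succ s hj ih =>
      rw [hsucc, List.getD_append _ _ _ _ (by rw [hlen]; omega), ih]
  refine ⟨fun s => (L s).getD s 0, hgetD.comp hL Computable.id, fun s => ?_⟩
  change (L (s + 1)).getD (s + 1) 0 = _
  rw [hsucc, List.getD_append_right _ _ _ _ (by rw [hlen]), hlen, hstable s (k s) (hks s)]
  simp

/-- If finite subfunctions have infinitely many extensions, then an index, as large as desired,
of an extension of any given finite part can be found effectively. -/
theorem exists_computable_extension {A : Set (ℕ →. ℕ)} {ν : ℕ → ℕ →. ℕ} (hν : IsNumbering A ν)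
    (hext : ∀ f ∈ A, ∀ g : ℕ →. ℕ, FinSubfn g f → {h | h ∈ A ∧ Subfn g h}.Infinite)
    {c : Code} (hc : ∀ a x, eval c (Nat.pair a x) = ν a x) :
    ∃ g : ℕ × ℕ × ℕ → ℕ, Computable g ∧ ∀ a t m, m < g (a, t, m) ∧
      ∀ x y, y ∈ evaln t c (Nat.pair a x) → y ∈ ν (g (a, t, m)) x := by
  let ev : ℕ → ℕ → ℕ → Option ℕ := fun t a x => evaln t c (Nat.pair a x)
  have hev : Primrec fun q : ℕ × ℕ × ℕ => ev q.1 q.2.1 q.2.2 :=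
    primrec_evaln.comp ((Primrec.fst.pair (Primrec.const c)).pair
      (Primrec₂.natPair.comp (Primrec.fst.comp Primrec.snd) (Primrec.snd.comp Primrec.snd)))
  let M : ℕ → (ℕ × ℕ) × (ℕ × ℕ) → Prop := fun x q =>
    ev q.1.1 q.1.2 x = none ∨ ev q.1.1 q.1.2 x = ev q.2.1 q.2.2 x
  have hM : PrimrecRel M := by
    have hx : Primrec fun p : ℕ × (ℕ × ℕ) × (ℕ × ℕ) => p.1 := Primrec.fst
    have h1 : Primrec fun p : ℕ × (ℕ × ℕ) × (ℕ × ℕ) => p.2.1 := Primrec.fst.comp Primrec.snd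
    have h2 : Primrec fun p : ℕ × (ℕ × ℕ) × (ℕ × ℕ) => p.2.2 := Primrec.snd.comp Primrec.snd
    have e1 := hev.comp ((Primrec.fst.comp h1).pair ((Primrec.snd.comp h1).pair hx))
    have e2 := hev.comp ((Primrec.fst.comp h2).pair ((Primrec.snd.comp h2).pair hx))
    exact (Primrec.eq.comp e1 (Primrec.const none)).or (Primrec.eq.comp e1 e2)
  let Q : ℕ × ℕ × ℕ → ℕ → Prop := fun p n =>
    p.2.2 < n.unpair.1 ∧ ∀ x < p.2.1, M x ((p.2.1, p.1), (n.unpair.2, n.unpair.1))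
  have hQ : PrimrecRel Q := by
    have ha : Primrec fun p : (ℕ × ℕ × ℕ) × ℕ => p.1.1 := Primrec.fst.comp Primrec.fst
    have ht : Primrec fun p : (ℕ × ℕ × ℕ) × ℕ => p.1.2.1 :=
      Primrec.fst.comp (Primrec.snd.comp Primrec.fst)
    have hm : Primrec fun p : (ℕ × ℕ × ℕ) × ℕ => p.1.2.2 :=
      Primrec.snd.comp (Primrec.snd.comp Primrec.fst)
    have hn : Primrec fun p : (ℕ × ℕ × ℕ) × ℕ => p.2.unpair := Primrec.unpair.comp Primrec.snd
    have h1 := Primrec.fst.comp hn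
    have h2 := Primrec.snd.comp hn
    have hall : PrimrecRel fun t q => ∀ x < t, M x q :=
      (hM.forall_mem_list.comp (Primrec.list_range.comp Primrec.fst) Primrec.snd).of_eq
        fun _ => by simp
    exact (Primrec.nat_lt.comp hm h1).and
      (hall.comp ht ((ht.pair ha).pair (h2.pair h1)))
  classical
  have hex : ∀ p, ∃ n, decide (Q p n) = true := by
    rintro ⟨a, t, m⟩
    let f : ℕ →. ℕ := fun x => (ev t a x : Part ℕ)
    have hmem : ∀ x y, y ∈ f x ↔ y ∈ ev t a x := fun x y => Part.mem_ofOption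
    have hfin : FinSubfn f (ν a) := by
      refine ⟨(Set.finite_lt_nat t).subset fun x hx => ?_, fun x y hy => ?_⟩
      · obtain ⟨y, hy⟩ := Part.dom_iff_mem.1 hx
        exact (Nat.right_le_pair a x).trans_lt (evaln_bound ((hmem x y).1 hy))
      · rw [← hc]
        exact evaln_sound ((hmem x y).1 hy)
    obtain ⟨h, ⟨hhA, hsub⟩, hh⟩ := (hext _ (hν.1 a) f hfin).exists_notMem_finite
      ((Set.finite_le_nat m).image ν)
    obtain ⟨b, rfl⟩ := hν.2 h hhA
    have hmb : m < b := by
      by_contra hle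
      exact hh ⟨b, not_lt.1 hle, rfl⟩
    have hstage : ∀ x, ∃ u, ∀ u' ≥ u, M x ((t, a), (u', b)) := by
      intro x
      rcases hx : ev t a x with _ | y
      · exact ⟨0, fun _ _ => Or.inl hx⟩
      · have hy := hsub x y ((hmem x y).2 hx)
        rw [← hc] at hy
        obtain ⟨u, hu⟩ := evaln_complete.1 hy
        exact ⟨u, fun u' hu' => Or.inr (hx.trans (evaln_mono hu' hu).symm)⟩
    choose u hu using hstage
    refine ⟨Nat.pair b ((Finset.range t).sup u), decide_eq_true ?_⟩
    simp only [Q, Nat.unpair_pair]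
    exact ⟨hmb, fun x hx => hu x _ (Finset.le_sup (Finset.mem_range.2 hx))⟩
  obtain ⟨g, hg, hgQ⟩ := exists_computable_choice hQ.decide.to_comp hex
  refine ⟨fun p => (g p).unpair.1, Computable.fst.comp (Computable.unpair.comp hg),
    fun a t m => ?_⟩
  obtain ⟨hlt, hM'⟩ := of_decide_eq_true (hgQ (a, t, m))
  refine ⟨hlt, fun x y hy => ?_⟩
  have hy' : ev t a x = some y := hy
  rcases hM' x ((Nat.right_le_pair a x).trans_lt (evaln_bound hy)) with h | h
  · rw [h] at hy'
    cases hy'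
  · rw [← hc]
    exact evaln_sound (h.symm.trans hy')

/-- A uniformly computable enumeration without repetition of disjoint noncomputable sets: stage
`s` enumerates `s.unpair.1` into the set with index `i` iff `R i s`. -/
theorem exists_enumeration_halting : ∃ R : ℕ → ℕ → Bool, Computable₂ R ∧
    (∀ i s s', R i s = true → R i s' = true → s.unpair.1 = s'.unpair.1 → s = s') ∧
    (∀ i s, R i s = true → s.unpair.1.unpair.1 = i) ∧
    ∀ i (d : Code), (∃ s, R i s = true ∧ s.unpair.1 = Nat.pair i (Encodable.encode d)) ↔
      (eval d 0).Dom := by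
  let D : ℕ → ℕ → Option ℕ := fun t e => evaln t (ofNat Code e.unpair.2) 0
  let P : ℕ → ℕ → Prop := fun i s =>
    s.unpair.1.unpair.1 = i ∧ D s.unpair.2 s.unpair.1 = none ∧
      ¬ D (s.unpair.2 + 1) s.unpair.1 = none
  have hP : PrimrecRel P := by
    have hs : Primrec fun p : ℕ × ℕ => p.2.unpair := Primrec.unpair.comp Primrec.snd
    have he := Primrec.fst.comp hs
    have ht := Primrec.snd.comp hs
    have hD : Primrec fun p : ℕ × ℕ => D p.1 p.2 :=
      primrec_evaln.comp ((Primrec.fst.pair ((Primrec.ofNat Code).comp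
        (Primrec.snd.comp (Primrec.unpair.comp Primrec.snd)))).pair (Primrec.const 0))
    exact (Primrec.eq.comp (Primrec.fst.comp (Primrec.unpair.comp he)) Primrec.fst).and
      ((Primrec.eq.comp (hD.comp (ht.pair he)) (Primrec.const none)).and
        (Primrec.eq.comp (hD.comp ((Primrec.succ.comp ht).pair he)) (Primrec.const none)).not)
  have hmono : ∀ t t' e, t ≤ t' → D t e ≠ none → D t' e ≠ none := by
    intro t t' e h hne
    obtain ⟨y, hy⟩ := Option.ne_none_iff_exists'.1 hne
    exact Option.ne_none_iff_exists'.2 ⟨y, evaln_mono h hy⟩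
  classical
  refine ⟨fun i s => decide (P i s), hP.decide.to_comp, ?_, ?_, ?_⟩
  · intro i s s' hs hs' he
    obtain ⟨-, h1, h2⟩ := of_decide_eq_true hs
    obtain ⟨-, h1', h2'⟩ := of_decide_eq_true hs'
    rw [← he] at h1' h2'
    have ht : s.unpair.2 = s'.unpair.2 := by
      rcases lt_trichotomy s.unpair.2 s'.unpair.2 with h | h | h
      · exact absurd h1' (hmono _ _ _ h h2)
      · exact h
      · exact absurd h1 (hmono _ _ _ h h2')
    rw [← Nat.pair_unpair s, ← Nat.pair_unpair s', he, ht]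
  · exact fun i s hs => (of_decide_eq_true hs).1
  · intro i d
    have hDd : ∀ t, D t (Nat.pair i (Encodable.encode d)) = evaln t d 0 := by
      intro t
      simp [D]
    constructor
    · rintro ⟨s, hs, he⟩
      obtain ⟨-, -, h⟩ := of_decide_eq_true hs
      rw [he, hDd] at h
      obtain ⟨y, hy⟩ := Option.ne_none_iff_exists'.1 h
      exact Part.dom_iff_mem.2 ⟨y, evaln_sound hy⟩
    · intro hd
      obtain ⟨y, hy⟩ := Part.dom_iff_mem.1 hd
      obtain ⟨u, hu⟩ := evaln_complete.1 hy
      have hex : ∃ u, evaln u d 0 ≠ none := ⟨u, Option.ne_none_iff_exists'.2 ⟨y, hu⟩⟩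
      have hpos : Nat.find hex ≠ 0 := by
        intro h0
        have := Nat.find_spec hex
        rw [h0] at this
        exact this (by simp [evaln])
      obtain ⟨t, ht⟩ := Nat.exists_eq_succ_of_ne_zero hpos
      refine ⟨Nat.pair (Nat.pair i (Encodable.encode d)) t, decide_eq_true ?_, by simp⟩
      simp only [P, Nat.unpair_pair, hDd]
      refine ⟨trivial, ?_, ?_⟩
      · exact not_not.1 (Nat.find_min hex (by omega : t < Nat.find hex))
      · have := Nat.find_spec hex
        rwa [ht] at this

/-- The position where `p` is moved at stage `u`: if `E u`, then `v u` and `b u` are exchanged. -/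
def swapAt (E : ℕ → Bool) (v b : ℕ → ℕ) (p u : ℕ) : ℕ :=
  bif E u then bif p == v u then b u else bif p == b u then v u else p else p

theorem swapAt_ne {E : ℕ → Bool} {v b : ℕ → ℕ} {p u : ℕ} (h : swapAt E v b p u ≠ p) :
    E u = true ∧ (p = v u ∧ swapAt E v b p u = b u ∨ p = b u ∧ swapAt E v b p u = v u) := by
  simp only [swapAt, Bool.cond_eq_ite, beq_iff_eq] at h ⊢
  grind

theorem swapAt_left {E : ℕ → Bool} {v b : ℕ → ℕ} {u : ℕ} (h : E u = true) :
    swapAt E v b (v u) u = b u := by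
  simp [swapAt, h]

theorem swapAt_right {E : ℕ → Bool} {v b : ℕ → ℕ} {u : ℕ} (h : E u = true) :
    swapAt E v b (b u) u = v u := by
  by_cases h' : b u = v u <;> simp [swapAt, Bool.cond_eq_ite, h, h']

open Classical in
/-- The product of all the exchanges performed by `swapAt`. -/
noncomputable def swapAll (E : ℕ → Bool) (v b : ℕ → ℕ) (p : ℕ) : ℕ :=
  if h : ∃ u, swapAt E v b p u ≠ p then swapAt E v b p h.choose else p

/-- The exchanges performed by `swapAt` are pairwise disjoint. -/
structure DisjointSwaps (E : ℕ → Bool) (v b : ℕ → ℕ) : Prop where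
  left_inj : ∀ s s', E s = true → E s' = true → v s = v s' → s = s'
  right_inj : ∀ s s', b s = b s' → s = s'
  ne : ∀ s s', v s ≠ b s'

namespace DisjointSwaps

variable {E : ℕ → Bool} {v b : ℕ → ℕ}

theorem stage_unique (H : DisjointSwaps E v b) {p u u' : ℕ}
    (h : swapAt E v b p u ≠ p) (h' : swapAt E v b p u' ≠ p) :
    u = u' := by
  obtain ⟨hE, ⟨h1, -⟩ | ⟨h1, -⟩⟩ := swapAt_ne h <;>
    obtain ⟨hE', ⟨h2, -⟩ | ⟨h2, -⟩⟩ := swapAt_ne h'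
  · exact H.left_inj _ _ hE hE' (h1.symm.trans h2)
  · exact absurd (h1.symm.trans h2) (H.ne _ _)
  · exact absurd (h2.symm.trans h1) (H.ne _ _)
  · exact H.right_inj _ _ (h1.symm.trans h2)

theorem swapAll_eq (H : DisjointSwaps E v b) {p u : ℕ} (h : swapAt E v b p u ≠ p) :
    swapAll E v b p = swapAt E v b p u := by
  have hex : ∃ u, swapAt E v b p u ≠ p := ⟨u, h⟩
  rw [swapAll, dif_pos hex, H.stage_unique hex.choose_spec h]

theorem swapAll_eq_self {p : ℕ} (h : ∀ u, swapAt E v b p u = p) : swapAll E v b p = p := by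
  rw [swapAll, dif_neg]
  simpa using h

theorem swapAll_left (H : DisjointSwaps E v b) {u : ℕ} (h : E u = true) :
    swapAll E v b (v u) = b u := by
  rw [H.swapAll_eq (u := u) (by rw [swapAt_left h]; exact (H.ne u u).symm), swapAt_left h]

theorem swapAll_right (H : DisjointSwaps E v b) {u : ℕ} (h : E u = true) :
    swapAll E v b (b u) = v u := by
  rw [H.swapAll_eq (u := u) (by rw [swapAt_right h]; exact H.ne u u), swapAt_right h]

theorem swapAll_involutive (H : DisjointSwaps E v b) :
    Function.Involutive (swapAll E v b) := by
  intro p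
  by_cases h : ∃ u, swapAt E v b p u ≠ p
  · obtain ⟨u, hu⟩ := h
    obtain ⟨hE, ⟨rfl, -⟩ | ⟨rfl, -⟩⟩ := swapAt_ne hu
    · rw [H.swapAll_left hE, H.swapAll_right hE]
    · rw [H.swapAll_right hE, H.swapAll_left hE]
  · push Not at h
    rw [swapAll_eq_self h, swapAll_eq_self h]

/-- Evaluating `ν` at the permuted index by a search: wait until either `p` is moved or the
computation of `ν p x` converges. -/
theorem rfind_bind_eq (H : DisjointSwaps E v b) {ν : ℕ → ℕ →. ℕ} {c : Code}
    (hc : ∀ a x, eval c (Nat.pair a x) = ν a x)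
    (hlt : ∀ s, s < b s)
    (hb : ∀ s x y, y ∈ evaln s c (Nat.pair (v s) x) → y ∈ ν (b s) x) (p x : ℕ) :
    ((Nat.rfind fun u => Part.some
      (!(swapAt E v b p u == p) || (evaln u c (Nat.pair p x)).isSome)).bind
        fun u => ν (swapAt E v b p u) x) = ν (swapAll E v b p) x := by
  set T : ℕ → Bool := fun u =>
    !(swapAt E v b p u == p) || (evaln u c (Nat.pair p x)).isSome with hT
  have hTiff : ∀ u, T u = true ↔
      swapAt E v b p u ≠ p ∨ ∃ y, y ∈ evaln u c (Nat.pair p x) := by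
    intro u
    simp [hT, Option.isSome_iff_exists]
  by_cases h : ∃ s, swapAt E v b p s ≠ p
  · obtain ⟨s, hs⟩ := h
    obtain ⟨u, hu, hus⟩ := Nat.rfind_min' (p := T) ((hTiff s).2 (Or.inl hs))
    change (Nat.rfind fun u => Part.some (T u)).bind _ = _
    have hu' : Nat.rfind (fun u => Part.some (T u)) = Part.some u := Part.eq_some_iff.2 hu
    rw [hu', Part.bind_some, H.swapAll_eq hs]
    rcases hus.eq_or_lt with rfl | hlt'
    · rfl
    · have hfix : swapAt E v b p u = p := by
        by_contra hne
        exact hlt'.ne (H.stage_unique hne hs)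
      have hTu : T u = true := (Part.mem_some_iff.1 (Nat.rfind_spec hu)).symm
      obtain ⟨y, hy⟩ := ((hTiff u).1 hTu).resolve_left (not_not.2 hfix)
      have hy1 : y ∈ ν p x := hc p x ▸ evaln_sound hy
      obtain ⟨-, ⟨hp, hq⟩ | ⟨hp, -⟩⟩ := swapAt_ne hs
      · have hy2 : y ∈ ν (b s) x := hb s x y (hp ▸ evaln_mono hlt'.le hy)
        rw [hfix, hq, Part.eq_some_iff.2 hy1, Part.eq_some_iff.2 hy2]
      · have h1 := (Nat.left_le_pair p x).trans_lt (evaln_bound hy)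
        have h2 := hlt s
        omega
  · push Not at h
    rw [swapAll_eq_self h]
    refine Part.ext fun y => ?_
    simp only [Part.mem_bind_iff, h]
    refine ⟨fun ⟨_, _, hy⟩ => hy, fun hy => ?_⟩
    obtain ⟨u, hu⟩ := evaln_complete.1 ((hc p x).symm ▸ hy)
    obtain ⟨u', hu', -⟩ := Nat.rfind_min' (p := T) ((hTiff u).2 (Or.inr ⟨y, hu⟩))
    simp only [hT, h] at hu'
    exact ⟨u', hu', hy⟩

end DisjointSwaps

theorem computable_swapAt {R : ℕ → ℕ → Bool} (hR : Computable₂ R) {v b : ℕ → ℕ}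
    (hv : Computable v) (hb : Computable b) :
    Computable fun q : ℕ × ℕ × ℕ => swapAt (R q.1) v b q.2.1 q.2.2 := by
  have hp : Computable fun q : ℕ × ℕ × ℕ => q.2.1 := Computable.fst.comp Computable.snd
  have hu : Computable fun q : ℕ × ℕ × ℕ => q.2.2 := Computable.snd.comp Computable.snd
  have heq : Computable₂ fun a b : ℕ => a == b := Primrec.beq.to_comp
  exact Computable.cond (hR.comp Computable.fst hu)
    (Computable.cond (heq.comp hp (hv.comp hu)) (hb.comp hu)
      (Computable.cond (heq.comp hp (hb.comp hu)) (hv.comp hu) hp)) hp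

theorem partrec_comp_swapAll {ν : ℕ → ℕ →. ℕ} {c : Code}
    (hc : ∀ a x, eval c (Nat.pair a x) = ν a x) (hν : Partrec₂ ν)
    {R : ℕ → ℕ → Bool} (hR : Computable₂ R) {v b : ℕ → ℕ}
    (hv : Computable v) (hb : Computable b) (H : ∀ i, DisjointSwaps (R i) v b)
    (hlt : ∀ s, s < b s)
    (hvb : ∀ s x y, y ∈ evaln s c (Nat.pair (v s) x) → y ∈ ν (b s) x) :
    UniformlyCE fun i p => ν (swapAll (R i) v b p) := by
  have hsw := computable_swapAt hR hv hb
  have hi : Computable fun q : ((ℕ × ℕ) × ℕ) × ℕ => q.1.1.1 :=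
    Computable.fst.comp (Computable.fst.comp Computable.fst)
  have hp : Computable fun q : ((ℕ × ℕ) × ℕ) × ℕ => q.1.1.2 :=
    Computable.snd.comp (Computable.fst.comp Computable.fst)
  have hx : Computable fun q : ((ℕ × ℕ) × ℕ) × ℕ => q.1.2 := Computable.snd.comp Computable.fst
  have hu : Computable fun q : ((ℕ × ℕ) × ℕ) × ℕ => q.2 := Computable.snd
  have hmove := hsw.comp (hi.pair (hp.pair hu))
  have heq : Computable₂ fun a b : ℕ => a == b := Primrec.beq.to_comp
  have heval : Computable fun q : ((ℕ × ℕ) × ℕ) × ℕ =>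
      (evaln q.2 c (Nat.pair q.1.1.2 q.1.2)).isSome :=
    Primrec.option_isSome.to_comp.comp (primrec_evaln.to_comp.comp
      ((hu.pair (Computable.const c)).pair (Primrec₂.natPair.to_comp.comp hp hx)))
  have htest : Computable₂ fun (q : (ℕ × ℕ) × ℕ) (u : ℕ) =>
      (!(swapAt (R q.1.1) v b q.1.2 u == q.1.2) || (evaln u c (Nat.pair q.1.2 q.2)).isSome) :=
    Primrec.or.to_comp.comp (Primrec.not.to_comp.comp (heq.comp hmove hp)) heval
  have hval : Partrec₂ fun (q : (ℕ × ℕ) × ℕ) (u : ℕ) => ν (swapAt (R q.1.1) v b q.1.2 u) q.2 :=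
    hν.comp hmove hx
  exact ((Partrec.rfind htest.partrec₂).bind hval).of_eq
    fun q => (H q.1.1).rfind_bind_eq hc hlt hvb q.1.2 q.2

/-- Kummer: antichain criterion for a single class. -/
theorem kummer_antichain (A : Set (ℕ →. ℕ)) (hA : A ⊆ PCF)
    (hAnum : ∃ ν : ℕ → ℕ →. ℕ, IsFriedberg A ν)
    (hext : ∀ f ∈ A, ∀ g : ℕ →. ℕ, FinSubfn g f → {h | h ∈ A ∧ Subfn g h}.Infinite) :
    ∃ ν : ℕ → ℕ → ℕ →. ℕ, UniformlyCE ν ∧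
      (∀ i, IsFriedberg A (ν i)) ∧
      ∀ i j, i ≠ j → ¬ Reducible (ν i) (ν j) := by
  obtain ⟨ν, ⟨hnum, hν⟩, hinj⟩ := hAnum
  obtain ⟨c, hc⟩ := exists_code.1 (Partrec₂.unpaired'.2 hν)
  replace hc : ∀ a x, eval c (Nat.pair a x) = ν a x := fun a x => by simp [hc]
  obtain ⟨g, hg, hgspec⟩ := exists_computable_extension hnum hext hc
  obtain ⟨R, hR, hRinj, hRfst, hRhalt⟩ := exists_enumeration_halting
  have hk : Computable fun s : ℕ => s.unpair.1 := Computable.fst.comp Computable.unpair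
  obtain ⟨w, hw, hwsucc⟩ := exists_computable_history_rec (Computable.succ.comp hg) hk
    Nat.unpair_left_le
  set v : ℕ → ℕ := fun s => w s.unpair.1 with hv
  set b : ℕ → ℕ := fun s => g (v s, s, w s) with hb
  have hvc : Computable v := hw.comp hk
  have hbc : Computable b := hg.comp (hvc.pair (Computable.id.pair hw))
  have hwb : ∀ s, w s < b s := fun s => (hgspec _ _ _).1
  have hbw : ∀ s, w (s + 1) = b s + 1 := hwsucc
  have hwmono : StrictMono w := strictMono_nat_of_lt_succ fun s => by
    have := hwb s
    have := hbw s
    omega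
  have hbne : ∀ e s, w e ≠ b s := by
    intro e s h
    have h1 := hwb s
    have h2 := hbw s
    rcases le_or_gt e s with h3 | h3
    · have := hwmono.monotone h3
      omega
    · have := hwmono.monotone (Nat.succ_le_of_lt h3)
      simp only [Nat.succ_eq_add_one] at this
      omega
  have H : ∀ i, DisjointSwaps (R i) v b := fun i =>
    { left_inj := fun s s' hs hs' h => hRinj i s s' hs hs' (hwmono.injective h)
      right_inj := fun s s' h => by
        have := hwmono.injective ((hbw s).trans ((congrArg (· + 1) h).trans (hbw s').symm))
        omega
      ne := fun s s' => hbne _ s' }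
  have hfix : ∀ i e, (∀ s, R i s = true → s.unpair.1 ≠ e) → swapAll (R i) v b (w e) = w e := by
    intro i e he
    refine DisjointSwaps.swapAll_eq_self fun u => ?_
    by_contra hne
    obtain ⟨hE, ⟨h, -⟩ | ⟨h, -⟩⟩ := swapAt_ne hne
    · exact he u hE (hwmono.injective h).symm
    · exact hbne _ _ h
  have hCE := partrec_comp_swapAll hc hν hR hvc hbc H
    (fun s => (hwmono.le_apply).trans_lt (hwb s)) (fun s => (hgspec (v s) s (w s)).2)
  refine ⟨fun i p => ν (swapAll (R i) v b p), hCE, fun i => ⟨⟨⟨fun p => hnum.1 _, fun f hf => ?_⟩,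
    ?_⟩, hinj.comp (H i).swapAll_involutive.injective⟩, ?_⟩
  · obtain ⟨a, rfl⟩ := hnum.2 f hf
    exact ⟨swapAll (R i) v b a, congrArg ν ((H i).swapAll_involutive a)⟩
  · exact hCE.comp ((Computable.const i).pair Computable.fst) Computable.snd
  · rintro i j hij ⟨φ, hφ, hred⟩
    have hred' : ∀ n, swapAll (R i) v b n = swapAll (R j) v b (φ n) := fun n => hinj (hred n)
    let n : Code → ℕ := fun d => w (Nat.pair i (Encodable.encode d))
    have hn : Computable n := hw.comp
      (Primrec₂.natPair.to_comp.comp (Computable.const i) Computable.encode)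
    have hj : ∀ d, swapAll (R j) v b (n d) = n d := fun d => hfix j _ fun s hs he => hij <| by
      simpa [he] using hRfst j s hs
    have hdec : ∀ d, φ (n d) ≠ n d ↔ (eval d 0).Dom := by
      intro d
      rw [← hRhalt i d]
      constructor
      · intro hne
        by_contra hno
        push Not at hno
        refine hne ((H j).swapAll_involutive.injective ?_)
        rw [← hred', hj]
        exact hfix i _ hno
      · rintro ⟨s, hs, he⟩ heq
        have h1 := hred' (n d)
        rw [heq, hj] at h1
        have h2 : v s = n d := congrArg w he
        rw [← h2, (H i).swapAll_left hs] at h1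
        exact (H i).ne s s h1.symm
    refine ComputablePred.halting_problem 0 (ComputablePred.computable_iff.2
      ⟨fun d => !(φ (n d) == n d), Primrec.not.to_comp.comp
        ((Primrec.beq (α := ℕ)).to_comp.comp (hφ.comp hn) hn), funext fun d => propext ?_⟩)
    rw [← hdec d]
    simp
end

section
/- There is a uniformly c.e. independent sequence (ν_i)_{i∈ℕ} of Friedberg numberings of 𝒫⁽¹⁾: for every i, ν_i is not reducible to the direct sum ⊕_{j≠i} ν_j. -/
/-- Skip i: the increasing enumeration of ℕ \ {i}. -/
def skipIdx (i j : ℕ) : ℕ := if j < i then j else j + 1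

/-- The direct sum ⊕_{j ≠ i} ν j, with components reindexed via skipIdx. -/
def dsumExcept (ν : ℕ → ℕ → ℕ →. ℕ) (i : ℕ) : ℕ → ℕ →. ℕ :=
  fun n => ν (skipIdx i n.unpair.1) n.unpair.2

namespace FriedbergSequence

open Nat.Partrec (Code)
open Denumerable (ofNat)

section Limits

/-- Any two values output by the sequence agree. -/
def Consistent (g : ℕ → Option ℕ) : Prop :=
  ∀ u v y z, g u = some y → g v = some z → y = z

open Classical in
/-- The value eventually output by a consistent sequence, if any. -/
noncomputable def lim (g : ℕ → Option ℕ) : Option ℕ :=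
  if h : ∃ y u, g u = some y then some h.choose else none

theorem lim_eq_some {g : ℕ → Option ℕ} (hg : Consistent g) {y : ℕ} :
    lim g = some y ↔ ∃ u, g u = some y := by
  unfold lim
  split_ifs with h
  · obtain ⟨u, hu⟩ := h.choose_spec
    constructor
    · intro e
      exact ⟨u, hu.trans e⟩
    · rintro ⟨v, hv⟩
      rw [hg _ _ _ _ hu hv]
  · simp only [false_iff]
    rintro ⟨u, hu⟩
    exact h ⟨y, u, hu⟩

theorem rfindOpt_eq_lim {g : ℕ → Option ℕ} (hg : Consistent g) :
    Nat.rfindOpt g = (lim g : Part ℕ) := by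
  ext y
  rw [Part.mem_coe, Option.mem_def, lim_eq_some hg]
  constructor
  · exact Nat.rfindOpt_spec
  · rintro ⟨u, hu⟩
    have hd : (Nat.rfindOpt g).Dom := Nat.rfindOpt_dom.2 ⟨u, y, hu⟩
    obtain ⟨v, hv⟩ := Nat.rfindOpt_spec (Part.get_mem hd)
    rw [hg _ _ _ _ hu hv]
    exact Part.get_mem hd

theorem consistent_of_mono {g : ℕ → Option ℕ}
    (hg : ∀ u v y, u ≤ v → g u = some y → g v = some y) : Consistent g :=
  fun u v y z hu hv => by
    have h1 := hg u (max u v) y (le_max_left _ _) hu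
    have h2 := hg v (max u v) z (le_max_right _ _) hv
    exact Option.some.inj (h1.symm.trans h2)

theorem exists_eventually_eq_lim {g : ℕ → Option ℕ}
    (hg : ∀ u v y, u ≤ v → g u = some y → g v = some y) :
    ∃ u, ∀ v ≥ u, g v = lim g := by
  have hc := consistent_of_mono hg
  cases h : lim g with
  | some y =>
    obtain ⟨u, hu⟩ := (lim_eq_some hc).1 h
    exact ⟨u, fun v hv => hg u v y hv hu⟩
  | none =>
    refine ⟨0, fun v _ => ?_⟩
    cases hv : g v with
    | none => rfl
    | some y => simp [(lim_eq_some hc).2 ⟨v, hv⟩] at h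

theorem coe_option_injective : Function.Injective (fun (o : ℕ → Option ℕ) x => (o x : Part ℕ)) := by
  intro o o' h
  funext x
  have := congrFun h x
  ext y
  simpa using congrArg (y ∈ ·) this

end Limits

section Stages

open Classical in
/-- A monotone uniform approximation: even indices `2 * v` give the constant function `v`, odd
indices `2 * e + 1` give the partial function with code `e`. -/
noncomputable def ev (c s z : ℕ) : Option ℕ :=
  if c % 2 = 0 then some (c / 2) else Code.evaln s (ofNat Code (c / 2)) z

open Classical in
/-- A slowed down version of `ev` in which at most one point is added at each stage. -/
noncomputable def E (c u z : ℕ) : Option ℕ :=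
  if ∃ s < u, Nat.pair z s < u ∧ (ev c s z).isSome = true then ev c u z else none

theorem ev_mono {c s s' z y : ℕ} (h : s ≤ s') (hy : ev c s z = some y) : ev c s' z = some y := by
  unfold ev at *
  split_ifs at * with hc
  · exact hy
  · exact Code.evaln_mono h hy

theorem ev_eq {c s s' z : ℕ} (h : s ≤ s') (hs : (ev c s z).isSome = true) :
    ev c s' z = ev c s z := by
  obtain ⟨y, hy⟩ := Option.isSome_iff_exists.1 hs
  rw [hy, ev_mono h hy]

theorem E_mono {c u u' z y : ℕ} (h : u ≤ u') (hy : E c u z = some y) : E c u' z = some y := by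
  unfold E at *
  split_ifs at hy with h1
  obtain ⟨s, hs, hp, he⟩ := h1
  rw [if_pos ⟨s, by omega, by omega, he⟩]
  exact ev_mono h hy

theorem E_lt {c u z y : ℕ} (hy : E c u z = some y) : z < u := by
  unfold E at hy
  split_ifs at hy with h1
  obtain ⟨s, hs, hp, he⟩ := h1
  exact (Nat.left_le_pair z s).trans_lt hp

theorem E_eq_none {c u z : ℕ} (h : u ≤ z) : E c u z = none := by
  cases hE : E c u z with
  | none => rfl
  | some y => exact absurd (E_lt hE) (by omega)

theorem E_succ_of_ne {c u z : ℕ} (hz : z ≠ u.unpair.1) : E c (u + 1) z = E c u z := by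
  unfold E
  by_cases h : ∃ s < u, Nat.pair z s < u ∧ (ev c s z).isSome = true
  · rw [if_pos h]
    obtain ⟨s, hs, hp, he⟩ := h
    rw [if_pos ⟨s, by omega, by omega, he⟩, ev_eq (s' := u + 1) (by omega) he, ev_eq (s' := u) (by omega) he]
  · rw [if_neg h, if_neg]
    rintro ⟨s, hs, hp, he⟩
    have hne : Nat.pair z s ≠ u := by
      rintro rfl
      simp at hz
    have := Nat.right_le_pair z s
    exact h ⟨s, by omega, by omega, he⟩

theorem exists_E_iff {c z y : ℕ} : (∃ u, E c u z = some y) ↔ ∃ s, ev c s z = some y := by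
  constructor
  · rintro ⟨u, hu⟩
    unfold E at hu
    split_ifs at hu
    exact ⟨u, hu⟩
  · rintro ⟨s, hs⟩
    have := Nat.right_le_pair z s
    refine ⟨Nat.pair z s + 1, ?_⟩
    unfold E
    rw [if_pos ⟨s, by omega, by omega, by simp [hs]⟩]
    exact ev_mono (by omega) hs

/-- The marker `(i, f, s)` of a follower `f` released at stage `s` in the `i`-th numbering. -/
def marker (i f s : ℕ) : ℕ := Nat.pair i (Nat.pair f s)

/-- The finite function `E c s`, where `N = marker i f s` and `f` is a follower of `c`, padded with
zeros below `2 * N` and extended by the value `q` at `2 * N`. -/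
noncomputable def beta (N q z : ℕ) : Option ℕ :=
  if z < 2 * N then some ((E N.unpair.2.unpair.1.unpair.1 N.unpair.2.unpair.2 z).getD 0)
  else if z = 2 * N then some q else none

theorem beta_isSome {N q z : ℕ} : (beta N q z).isSome = true ↔ z ≤ 2 * N := by
  unfold beta
  split_ifs <;> simp <;> omega

theorem beta_last (N q : ℕ) : beta N q (2 * N) = some q := by
  simp [beta]

theorem beta_inj {N q N' q' : ℕ} (h : beta N q = beta N' q') : N = N' ∧ q = q' := by
  have key : ∀ z, z ≤ 2 * N ↔ z ≤ 2 * N' := fun z => by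
    rw [← @beta_isSome N q, ← @beta_isSome N' q', h]
  have h1 := (key (2 * N)).1 le_rfl
  have h2 := (key (2 * N')).2 le_rfl
  obtain rfl : N = N' := by omega
  refine ⟨rfl, ?_⟩
  have := congrFun h (2 * N)
  simpa [beta_last] using this

/-- The finite function `E c u` is one of the functions `beta N q`. -/
def IsBeta (c u : ℕ) : Prop :=
  ∃ N < u, ∀ z < 3 * u, E c u z = beta N ((E c u (2 * N)).getD 0) z

theorem isBeta_iff {c u : ℕ} : IsBeta c u ↔ ∃ N q, E c u = beta N q := by
  constructor
  · rintro ⟨N, hN, h⟩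
    refine ⟨N, (E c u (2 * N)).getD 0, funext fun z => ?_⟩
    by_cases hz : z < 3 * u
    · exact h z hz
    · rw [E_eq_none (by omega)]
      unfold beta
      rw [if_neg (by omega), if_neg (by omega)]
  · rintro ⟨N, q, h⟩
    have h1 : E c u (2 * N) = some q := by rw [h, beta_last]
    have := E_lt h1
    refine ⟨N, by omega, fun z _ => ?_⟩
    rw [h1, h]
    rfl

theorem IsBeta.succ_eq {c u : ℕ} (h : IsBeta c u) (h' : IsBeta c (u + 1)) :
    E c (u + 1) = E c u := by
  obtain ⟨N, q, h⟩ := isBeta_iff.1 h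
  obtain ⟨N', q', h'⟩ := isBeta_iff.1 h'
  have key : ∀ z, z ≠ u.unpair.1 → (z ≤ 2 * N' ↔ z ≤ 2 * N) := fun z hz => by
    rw [← @beta_isSome N q, ← @beta_isSome N' q', ← h, ← h', E_succ_of_ne hz]
  have hN : N' = N := by
    by_contra hne
    rcases Nat.lt_or_gt_of_ne hne with hlt | hlt
    · have h1 := fun e => key (2 * N) e
      have h2 := fun e => key (2 * N - 1) e
      by_cases e : 2 * N = u.unpair.1
      · have := h2 (by omega)
        omega
      · have := h1 e
        omega
    · have h1 := fun e => key (2 * N') e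
      have h2 := fun e => key (2 * N' - 1) e
      by_cases e : 2 * N' = u.unpair.1
      · have := h2 (by omega)
        omega
      · have := h1 e
        omega
  subst hN
  funext z
  cases hz : E c u z with
  | some y => exact E_mono (by omega) hz
  | none =>
    have h1 : ¬ z ≤ 2 * N' := by
      rw [← @beta_isSome N' q, ← h, hz]
      simp
    rw [← @beta_isSome N' q', ← h'] at h1
    simpa using h1

open Classical in
/-- The approximation `E c` restricted to the points seen at stages that are not of the form
`beta N q`. -/
noncomputable def A (c s z : ℕ) : Option ℕ :=
  if ∃ u < s + 1, ¬ IsBeta c u ∧ (E c u z).isSome = true then E c s z else none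

/-- The limit function of the approximation `A c`; it never is of the form `beta N q`. -/
noncomputable def alpha (c z : ℕ) : Option ℕ := lim fun s => A c s z

theorem A_mono {c s s' z y : ℕ} (h : s ≤ s') (hy : A c s z = some y) : A c s' z = some y := by
  unfold A at *
  split_ifs at hy with h1
  obtain ⟨u, hu, hb, he⟩ := h1
  rw [if_pos ⟨u, by omega, hb, he⟩]
  exact E_mono h hy

theorem A_le_E {c s z y : ℕ} (hy : A c s z = some y) : E c s z = some y := by
  unfold A at hy
  split_ifs at hy
  exact hy

theorem A_consistent (c z : ℕ) : Consistent fun s => A c s z :=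
  consistent_of_mono fun _ _ _ => A_mono

theorem alpha_eq_some {c z y : ℕ} : alpha c z = some y ↔ ∃ s, A c s z = some y :=
  lim_eq_some (A_consistent c z)

theorem exists_A_eq_alpha (c z : ℕ) : ∃ u, ∀ v ≥ u, A c v z = alpha c z :=
  exists_eventually_eq_lim fun _ _ _ => A_mono

theorem not_isBeta_zero (c : ℕ) : ¬ IsBeta c 0 := by
  rintro ⟨N, hN, -⟩
  omega

theorem alpha_ne_beta (c N q : ℕ) : alpha c ≠ beta N q := by
  intro h
  have hdom : ∀ z ≤ 2 * N, ∃ u, ¬ IsBeta c u ∧ (E c u z).isSome = true := fun z hz => by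
    have h1 := (@beta_isSome N q z).2 hz
    rw [← h] at h1
    obtain ⟨y, hy⟩ := Option.isSome_iff_exists.1 h1
    obtain ⟨s, hs⟩ := alpha_eq_some.1 hy
    unfold A at hs
    split_ifs at hs with h2
    obtain ⟨u, -, hu⟩ := h2
    exact ⟨u, hu⟩
  have hchain : ∀ M ≤ 2 * N + 1, ∃ u, ¬ IsBeta c u ∧ ∀ z < M, (E c u z).isSome = true := by
    intro M
    induction M with
    | zero => exact fun _ => ⟨0, not_isBeta_zero c, by simp⟩
    | succ M ih =>
      intro hM
      obtain ⟨u, hu, hz⟩ := ih (by omega)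
      obtain ⟨v, hv, hMv⟩ := hdom M (by omega)
      have mono : ∀ {a b z}, a ≤ b → (E c a z).isSome = true → (E c b z).isSome = true := by
        intro a b z hab ha
        obtain ⟨y, hy⟩ := Option.isSome_iff_exists.1 ha
        simp [E_mono hab hy]
      rcases le_total u v with huv | huv
      · refine ⟨v, hv, fun z hlt => ?_⟩
        rcases Nat.lt_succ_iff_lt_or_eq.1 hlt with h1 | rfl
        · exact mono huv (hz z h1)
        · exact hMv
      · refine ⟨u, hu, fun z hlt => ?_⟩
        rcases Nat.lt_succ_iff_lt_or_eq.1 hlt with h1 | rfl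
        · exact hz z h1
        · exact mono huv hMv
  obtain ⟨u, hu, hz⟩ := hchain _ le_rfl
  refine hu (isBeta_iff.2 ⟨N, q, ?_⟩)
  have hle : ∀ z y, E c u z = some y → beta N q z = some y := fun z y hy => by
    rw [← h]
    refine alpha_eq_some.2 ⟨u, ?_⟩
    unfold A
    rw [if_pos ⟨u, by omega, hu, by simp [hy]⟩, hy]
  funext z
  cases hE : E c u z with
  | some y => exact (hle z y hE).symm
  | none =>
    have : ¬ z ≤ 2 * N := fun hle => by
      have := hz z (by omega)
      simp [hE] at this
    rw [← @beta_isSome N q] at this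
    symm
    simpa using this

theorem alpha_eq_of_ne_beta {c : ℕ} {g : ℕ → Option ℕ}
    (hg : ∀ z y, g z = some y ↔ ∃ u, E c u z = some y) (hb : ∀ N q, g ≠ beta N q) :
    alpha c = g := by
  have hle : ∀ z y, g z = some y → alpha c z = some y := by
    intro z y hy
    obtain ⟨u₀, hu₀⟩ := (hg z y).1 hy
    by_cases h : ∃ u ≥ u₀, ¬ IsBeta c u
    · obtain ⟨u, hu, hnb⟩ := h
      have := E_mono hu hu₀
      refine alpha_eq_some.2 ⟨u, ?_⟩
      unfold A
      rw [if_pos ⟨u, by omega, hnb, by simp [this]⟩, this]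
    · push Not at h
      exfalso
      have hconst : ∀ k, E c (u₀ + k) = E c u₀ := by
        intro k
        induction k with
        | zero => rfl
        | succ k ih =>
          rw [← ih]
          exact (h (u₀ + k) (by omega)).succ_eq (h (u₀ + k + 1) (by omega))
      obtain ⟨N, q, hNq⟩ := isBeta_iff.1 (h u₀ le_rfl)
      refine hb N q (funext fun x => ?_)
      rw [← hNq]
      ext w
      rw [hg]
      constructor
      · rintro ⟨u, hu⟩
        rw [← hconst u]
        exact E_mono (by omega) hu
      · exact fun hw => ⟨u₀, hw⟩
  funext z
  cases hz : alpha c z with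
  | some y =>
    obtain ⟨s, hs⟩ := alpha_eq_some.1 hz
    exact ((hg z y).2 ⟨s, A_le_E hs⟩).symm
  | none =>
    cases hgz : g z with
    | none => rfl
    | some y => simp [hle z y hgz] at hz

theorem alpha_even (v : ℕ) : alpha (2 * v) = fun _ => some v := by
  apply alpha_eq_of_ne_beta
  · intro z y
    rw [exists_E_iff]
    simp [ev]
  · intro N q h
    have := congrFun h (2 * N + 1)
    have h2 : (beta N q (2 * N + 1)).isSome = true := by simp [← this]
    rw [beta_isSome] at h2
    omega

theorem exists_alpha_eq {f : ℕ →. ℕ} (hf : Nat.Partrec f)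
    (hb : ∀ N q, f ≠ fun z => (beta N q z : Part ℕ)) :
    ∃ e, f = fun z => (alpha (2 * e + 1) z : Part ℕ) := by
  classical
  obtain ⟨cd, rfl⟩ := Code.exists_code.1 hf
  refine ⟨Encodable.encode cd, ?_⟩
  have h : alpha (2 * Encodable.encode cd + 1) = fun z => (cd.eval z).toOption := by
    apply alpha_eq_of_ne_beta
    · intro z y
      have h2 : (2 * Encodable.encode cd + 1) / 2 = Encodable.encode cd := by omega
      rw [exists_E_iff, ← Option.mem_def, Part.mem_toOption, Code.evaln_complete]
      simp [ev, h2]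
    · intro N q h
      refine hb N q (funext fun z => ?_)
      rw [← congrFun h z]
      simp
  rw [h]
  funext z
  simp

end Stages

section Followers

/-- Evidence at stage `s` that the index `c` is to be given up at the threshold `t`. For even `c`
this is used only to diagonalise against a possible reduction; for odd `c` it says that `alpha c`
agrees below `t` with a constant function or with some `alpha c'`, `c' < c`. -/
def GiveUp (c t s : ℕ) : Prop :=
  t = 0 ∨
  (c % 2 = 0 ∧ t = 1 ∧ ∃ y < s, Code.evaln s (ofNat Code (c / 2)) (2 * Nat.pair c 0) = some y) ∨
  (c % 2 = 1 ∧ t < s + 1 ∧ ((∃ c' < c, ∀ x < t, A c' s x = A c s x) ∨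
    ∀ x < t, (A c s x).isSome = true ∧ A c s x = A c s 0))

/-- The follower `f = (c, (t, s₀))` is legitimate: `s₀` is the stage at which `t` becomes the
threshold of `c`. -/
def Valid (f : ℕ) : Prop :=
  GiveUp f.unpair.1 f.unpair.2.unpair.1 f.unpair.2.unpair.2 ∧
    ∀ s < f.unpair.2.unpair.2, ¬ GiveUp f.unpair.1 f.unpair.2.unpair.1 s

/-- The follower `f` is to be released at stage `s`. -/
def Rel (f s : ℕ) : Prop := ¬ Valid f ∨ GiveUp f.unpair.1 (f.unpair.2.unpair.1 + 1) s

/-- Stage `s` is the first one at which `f` is released. -/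
def FirstRel (f s : ℕ) : Prop := Rel f s ∧ ∀ s' < s, ¬ Rel f s'

theorem GiveUp.of_succ {c t s : ℕ} (h : GiveUp c (t + 1) s) : GiveUp c t s := by
  rcases h with h | ⟨h1, h2, h3⟩ | ⟨h1, h2, h3⟩
  · omega
  · exact Or.inl (by omega)
  · refine Or.inr (Or.inr ⟨h1, by omega, ?_⟩)
    rcases h3 with ⟨c', hc', h⟩ | h
    · exact Or.inl ⟨c', hc', fun x hx => h x (by omega)⟩
    · exact Or.inr fun x hx => h x (by omega)

theorem GiveUp.anti {c t t' s : ℕ} (h : GiveUp c t s) (ht : t' ≤ t) : GiveUp c t' s := by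
  induction ht with
  | refl => exact h
  | step _ ih => exact ih h.of_succ

/-- The index `c` is eventually kept. -/
def Kept (c : ℕ) : Prop := ∃ t, ∀ s, ¬ GiveUp c t s

theorem exists_first {p : ℕ → Prop} (h : ∃ s, p s) : ∃ s, p s ∧ ∀ s' < s, ¬ p s' := by
  classical
  exact ⟨Nat.find h, Nat.find_spec h, fun _ => Nat.find_min h⟩

theorem first_unique {p : ℕ → Prop} {s s' : ℕ} (h : p s ∧ ∀ r < s, ¬ p r)
    (h' : p s' ∧ ∀ r < s', ¬ p r) : s = s' := by
  rcases lt_trichotomy s s' with hlt | rfl | hlt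
  · exact absurd h.1 (h'.2 s hlt)
  · rfl
  · exact absurd h'.1 (h.2 s' hlt)

theorem kept_of_unreleased {f : ℕ} (h : ∀ s, ¬ Rel f s) : Kept f.unpair.1 :=
  ⟨_, fun s hs => h s (Or.inr hs)⟩

theorem valid_of_unreleased {f : ℕ} (h : ∀ s, ¬ Rel f s) : Valid f := by
  by_contra hv
  exact h 0 (Or.inl hv)

theorem exists_unreleased {c : ℕ} (h : Kept c) : ∃ f, f.unpair.1 = c ∧ ∀ s, ¬ Rel f s := by
  obtain ⟨t, ht, hmin⟩ := exists_first h
  obtain ⟨t, rfl⟩ : ∃ r, t = r + 1 :=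
    Nat.exists_eq_succ_of_ne_zero (by rintro rfl; exact ht 0 (Or.inl rfl))
  have h1 := hmin t (by omega)
  push Not at h1
  obtain ⟨s, hs⟩ := exists_first h1
  refine ⟨Nat.pair c (Nat.pair t s), by simp, fun r hr => ?_⟩
  rcases hr with hr | hr
  · exact hr (by simpa [Valid] using hs)
  · exact ht r (by simpa using hr)

theorem unreleased_unique {f f' : ℕ} (h : ∀ s, ¬ Rel f s) (h' : ∀ s, ¬ Rel f' s)
    (hc : f.unpair.1 = f'.unpair.1) : f = f' := by
  have hv := valid_of_unreleased h
  have hv' := valid_of_unreleased h'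
  have key : ∀ {g g' : ℕ}, (∀ s, ¬ Rel g s) → Valid g' → g.unpair.1 = g'.unpair.1 →
      g'.unpair.2.unpair.1 ≤ g.unpair.2.unpair.1 := by
    intro g g' hg hg' e
    by_contra hlt
    refine hg g'.unpair.2.unpair.2 (Or.inr ?_)
    rw [e]
    exact hg'.1.anti (by omega)
  have ht : f.unpair.2.unpair.1 = f'.unpair.2.unpair.1 :=
    le_antisymm (key h' hv hc.symm) (key h hv' hc)
  unfold Valid at hv hv'
  rw [hc, ht] at hv
  have hs := first_unique hv hv'
  rw [← Nat.pair_unpair f, ← Nat.pair_unpair f', hc, ← Nat.pair_unpair f.unpair.2, ht, hs,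
    Nat.pair_unpair f'.unpair.2]

theorem eventually_below {P : ℕ → ℕ → Prop} (h : ∀ x, ∃ u, ∀ s ≥ u, P x s) (t : ℕ) :
    ∃ u, ∀ s ≥ u, ∀ x < t, P x s := by
  choose u hu using h
  refine ⟨(Finset.range t).sup u, fun s hs x hx => hu x s ?_⟩
  exact (Finset.le_sup (Finset.mem_range.2 hx)).trans hs

theorem not_kept_of_alpha_eq {c c' : ℕ} (hc : c % 2 = 1) (hlt : c' < c) (h : alpha c' = alpha c) :
    ¬ Kept c := by
  rintro ⟨t, ht⟩
  obtain ⟨u, hu⟩ := eventually_below (P := fun x s => A c' s x = A c s x) (fun x => by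
    obtain ⟨u, hu⟩ := exists_A_eq_alpha c x
    obtain ⟨u', hu'⟩ := exists_A_eq_alpha c' x
    refine ⟨max u u', fun s hs => ?_⟩
    rw [hu s (by omega), hu' s (by omega), h]) t
  exact ht (max u t) (Or.inr (Or.inr ⟨hc, by omega, Or.inl ⟨c', hlt, hu _ (by omega)⟩⟩))

theorem not_kept_of_alpha_const {c v : ℕ} (hc : c % 2 = 1) (h : alpha c = fun _ => some v) :
    ¬ Kept c := by
  rintro ⟨t, ht⟩
  obtain ⟨u, hu⟩ := eventually_below (P := fun x s => A c s x = some v) (fun x => by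
    obtain ⟨u, hu⟩ := exists_A_eq_alpha c x
    exact ⟨u, fun s hs => by rw [hu s hs, h]⟩) (t + 1)
  refine ht (max u t) (Or.inr (Or.inr ⟨hc, by omega, Or.inr fun x hx => ?_⟩))
  rw [hu _ (le_max_left _ _) x (by omega), hu _ (le_max_left _ _) 0 (by omega)]
  simp

theorem kept_even {c : ℕ} (hc : c % 2 = 0) : Kept c :=
  ⟨2, fun s hs => by
    rcases hs with h | ⟨-, h, -⟩ | ⟨h, -⟩ <;> omega⟩

theorem kept_odd {c : ℕ} (h1 : ∀ c' < c, alpha c' ≠ alpha c)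
    (h2 : ∀ v, alpha c ≠ fun _ => some v) : Kept c := by
  by_cases hc : c % 2 = 0
  · exact kept_even hc
  have hd : ∀ c', ∃ u, c' < c → ∀ s ≥ u, ∃ x < u, A c' s x ≠ A c s x := by
    intro c'
    by_cases hlt : c' < c
    · obtain ⟨x, hx⟩ := Function.ne_iff.1 (h1 c' hlt)
      obtain ⟨u, hu⟩ := exists_A_eq_alpha c x
      obtain ⟨u', hu'⟩ := exists_A_eq_alpha c' x
      refine ⟨max (x + 1) (max u u'), fun _ s hs => ⟨x, by omega, ?_⟩⟩
      rwa [hu s (by omega), hu' s (by omega)]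
    · exact ⟨0, fun h => absurd h hlt⟩
  choose u hu using hd
  obtain ⟨w, hw⟩ : ∃ w, ∀ s, ∃ x < w, ¬ ((A c s x).isSome = true ∧ A c s x = A c s 0) := by
    by_contra hcon
    push Not at hcon
    obtain ⟨s₁, hs₁⟩ := hcon 1
    obtain ⟨v, hv⟩ := Option.isSome_iff_exists.1 (hs₁ 0 (by omega)).1
    refine h2 v (funext fun x => ?_)
    obtain ⟨s, hs⟩ := hcon (x + 1)
    obtain ⟨v', hv'⟩ := Option.isSome_iff_exists.1 (hs 0 (by omega)).1
    rw [A_consistent c 0 s₁ s v v' hv hv']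
    exact alpha_eq_some.2 ⟨s, by rw [(hs x (by omega)).2, hv']⟩
  refine ⟨max (w + 1) ((Finset.range c).sup u), fun s hs => ?_⟩
  rcases hs with h | ⟨h, -⟩ | ⟨-, hts, ⟨c', hc', h⟩ | h⟩
  · omega
  · omega
  · have hle : u c' ≤ (Finset.range c).sup u := Finset.le_sup (Finset.mem_range.2 hc')
    obtain ⟨x, hx, hne⟩ := hu c' hc' s (by omega)
    exact hne (h x (by omega))
  · obtain ⟨x, hx, hn⟩ := hw s
    exact hn (h x (by omega))

theorem kept_unique {c c' : ℕ} (h : Kept c) (h' : Kept c') (e : alpha c = alpha c') : c = c' := by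
  have aux : ∀ {c : ℕ}, c % 2 = 0 → alpha c = fun _ => some (c / 2) := fun {c} hc => by
    obtain ⟨v, rfl⟩ : ∃ v, c = 2 * v := ⟨c / 2, by omega⟩
    rw [alpha_even]
    simp
  by_cases hc : c % 2 = 0 <;> by_cases hc' : c' % 2 = 0
  · rw [aux hc, aux hc'] at e
    have := congrFun e 0
    simp at this
    omega
  · exact absurd h' (not_kept_of_alpha_const (by omega) (e.symm.trans (aux hc)))
  · exact absurd h (not_kept_of_alpha_const (by omega) (e.trans (aux hc')))
  · rcases lt_trichotomy c c' with hlt | heq | hlt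
    · exact absurd h' (not_kept_of_alpha_eq (by omega) hlt e)
    · exact heq
    · exact absurd h (not_kept_of_alpha_eq (by omega) hlt e.symm)

theorem exists_kept (c : ℕ) : ∃ d, Kept d ∧ alpha d = alpha c := by
  by_cases h : ∃ v, alpha c = fun _ => some v
  · obtain ⟨v, hv⟩ := h
    exact ⟨2 * v, kept_even (by omega), by rw [alpha_even, hv]⟩
  · push Not at h
    obtain ⟨d, hd, hmin⟩ := exists_first (p := fun d => alpha d = alpha c) ⟨c, rfl⟩
    refine ⟨d, kept_odd (fun c' hc' => ?_) (fun v => ?_), hd⟩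
    · rw [hd]
      exact hmin c' hc'
    · rw [hd]
      exact h v

theorem firstRel_or (f : ℕ) : (∃ s, FirstRel f s) ∨ ∀ s, ¬ Rel f s := by
  by_cases h : ∃ s, Rel f s
  · exact Or.inl (exists_first h)
  · push Not at h
    exact Or.inr h

end Followers

section Numbering

open Classical in
/-- The second parameter of the function with index `2 * (N, q) + 1` in the `i`-th numbering. -/
noncomputable def shift (i N q : ℕ) : ℕ :=
  if N.unpair.1 = i ∧ FirstRel N.unpair.2.unpair.1 N.unpair.2.unpair.2 then q + 1 else q

open Classical in
/-- The output at stage `u` of the computation of the function attached to the follower `f` in the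
`i`-th numbering. -/
noncomputable def followerStep (i f x u : ℕ) : Option ℕ :=
  if FirstRel f u then beta (marker i f u) 0 x
  else if ∃ s < u, Rel f s then none
  else A f.unpair.1 u x

/-- The output at stage `u` of the computation of the `n`-th function of the `i`-th numbering. -/
noncomputable def step (i n x u : ℕ) : Option ℕ :=
  if n % 2 = 0 then followerStep i (n / 2) x u
  else beta (n / 2).unpair.1 (shift i (n / 2).unpair.1 (n / 2).unpair.2) x

theorem step_even (i f x u : ℕ) : step i (2 * f) x u = followerStep i f x u := by
  simp [step]

theorem step_odd (i k x u : ℕ) :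
    step i (2 * k + 1) x u = beta k.unpair.1 (shift i k.unpair.1 k.unpair.2) x := by
  have h : (2 * k + 1) / 2 = k := by omega
  simp [step, h]

/-- The `i`-th numbering of the independent sequence. -/
noncomputable def nu (i n : ℕ) : ℕ →. ℕ := fun x => Nat.rfindOpt (step i n x)

theorem beta_of_A {i f s u x y : ℕ} (hu : u ≤ s) (hy : A f.unpair.1 u x = some y) :
    beta (marker i f s) 0 x = some y := by
  have h1 := E_mono hu (A_le_E hy)
  have h2 : s ≤ marker i f s := (Nat.right_le_pair f s).trans (Nat.right_le_pair i _)
  have h3 := E_lt h1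
  unfold beta
  rw [if_pos (by omega)]
  simp [marker, h1]

theorem nu_of_lim {i n : ℕ} {g : ℕ → Option ℕ}
    (h : ∀ x y, (∃ u, step i n x u = some y) ↔ g x = some y) :
    nu i n = fun x => (g x : Part ℕ) := by
  funext x
  have hc : Consistent (step i n x) := fun u v y z hu hv => by
    have h1 := (h x y).1 ⟨u, hu⟩
    have h2 := (h x z).1 ⟨v, hv⟩
    exact Option.some.inj (h1.symm.trans h2)
  unfold nu
  rw [rfindOpt_eq_lim hc]
  congr 1
  ext y
  rw [lim_eq_some hc, h]

theorem nu_released {i f s : ℕ} (h : FirstRel f s) :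
    nu i (2 * f) = fun x => (beta (marker i f s) 0 x : Part ℕ) := by
  refine nu_of_lim fun x y => ?_
  simp only [step_even]
  constructor
  · rintro ⟨u, hu⟩
    unfold followerStep at hu
    split_ifs at hu with h1 h2
    · rwa [first_unique h h1]
    · refine beta_of_A ?_ hu
      by_contra hlt
      exact h2 ⟨s, by omega, h.1⟩
  · intro hy
    refine ⟨s, ?_⟩
    unfold followerStep
    rwa [if_pos h]

theorem nu_unreleased {i f : ℕ} (h : ∀ s, ¬ Rel f s) :
    nu i (2 * f) = fun x => (alpha f.unpair.1 x : Part ℕ) := by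
  refine nu_of_lim fun x y => ?_
  rw [alpha_eq_some]
  refine exists_congr fun u => ?_
  rw [step_even, followerStep, if_neg (fun h' => h u h'.1), if_neg (fun ⟨s, _, hs⟩ => h s hs)]

theorem nu_odd (i k : ℕ) :
    nu i (2 * k + 1) =
      fun x => (beta k.unpair.1 (shift i k.unpair.1 k.unpair.2) x : Part ℕ) :=
  nu_of_lim fun x y => by simp [step_odd]

theorem marker_inj {i f s i' f' s' : ℕ} (h : marker i f s = marker i' f' s') :
    i = i' ∧ f = f' ∧ s = s' := by
  simpa [marker, Nat.pair_eq_pair] using h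

/-- Every index of a numbering is of one of three kinds. -/
theorem nu_cases (i n : ℕ) :
    (∃ f, n = 2 * f ∧ (∀ s, ¬ Rel f s) ∧ nu i n = fun x => (alpha f.unpair.1 x : Part ℕ)) ∨
    (∃ f s, n = 2 * f ∧ FirstRel f s ∧
      nu i n = fun x => (beta (marker i f s) 0 x : Part ℕ)) ∨
    ∃ N q, n = 2 * Nat.pair N q + 1 ∧ nu i n = fun x => (beta N (shift i N q) x : Part ℕ) := by
  by_cases hn : n % 2 = 0
  · obtain ⟨f, rfl⟩ : ∃ f, n = 2 * f := ⟨n / 2, by omega⟩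
    rcases firstRel_or f with ⟨s, hs⟩ | h
    · exact Or.inr (Or.inl ⟨f, s, rfl, hs, nu_released hs⟩)
    · exact Or.inl ⟨f, rfl, h, nu_unreleased h⟩
  · obtain ⟨k, rfl⟩ : ∃ k, n = 2 * k + 1 := ⟨n / 2, by omega⟩
    exact Or.inr (Or.inr ⟨k.unpair.1, k.unpair.2, by simp, nu_odd i k⟩)

theorem shift_marker {i f s : ℕ} (h : FirstRel f s) (q : ℕ) :
    shift i (marker i f s) q = q + 1 := by
  unfold shift
  rw [if_pos (by simpa [marker] using h)]

theorem shift_injective (i N : ℕ) : Function.Injective (shift i N) := by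
  intro q q' h
  unfold shift at h
  split_ifs at h <;> omega

theorem nu_injective (i : ℕ) : Function.Injective (nu i) := by
  have hab : ∀ {c N q}, (fun x => (alpha c x : Part ℕ)) ≠ fun x => (beta N q x : Part ℕ) :=
    fun h => alpha_ne_beta _ _ _ (coe_option_injective h)
  intro n n' h
  rcases nu_cases i n with ⟨f, rfl, hf, e⟩ | ⟨f, s, rfl, hf, e⟩ | ⟨N, q, rfl, e⟩ <;>
  rcases nu_cases i n' with ⟨f', rfl, hf', e'⟩ | ⟨f', s', rfl, hf', e'⟩ | ⟨N', q', rfl, e'⟩ <;>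
  rw [e, e'] at h
  · have hc := kept_unique (kept_of_unreleased hf) (kept_of_unreleased hf')
      (coe_option_injective h)
    rw [unreleased_unique hf hf' hc]
  · exact absurd h hab
  · exact absurd h hab
  · exact absurd h.symm hab
  · obtain ⟨h1, -⟩ := beta_inj (coe_option_injective h)
    rw [(marker_inj h1).2.1]
  · obtain ⟨rfl, h2⟩ := beta_inj (coe_option_injective h)
    rw [shift_marker hf] at h2
    omega
  · exact absurd h.symm hab
  · obtain ⟨rfl, h2⟩ := beta_inj (coe_option_injective h)
    rw [shift_marker hf'] at h2
    omega
  · obtain ⟨rfl, h2⟩ := beta_inj (coe_option_injective h)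
    rw [shift_injective i N h2]

theorem exists_nu_eq_beta (i N q : ℕ) : ∃ n, nu i n = fun x => (beta N q x : Part ℕ) := by
  have hodd : ∀ r, nu i (2 * Nat.pair N r + 1) = fun x => (beta N (shift i N r) x : Part ℕ) :=
    fun r => by simpa using nu_odd i (Nat.pair N r)
  by_cases h : N.unpair.1 = i ∧ FirstRel N.unpair.2.unpair.1 N.unpair.2.unpair.2
  · cases q with
    | zero =>
      refine ⟨2 * N.unpair.2.unpair.1, ?_⟩
      rw [nu_released h.2, marker, ← h.1, Nat.pair_unpair, Nat.pair_unpair]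
    | succ q => exact ⟨_, by rw [hodd q, shift, if_pos h]⟩
  · exact ⟨_, by rw [hodd q, shift, if_neg h]⟩

theorem exists_nu_eq (i : ℕ) {f : ℕ →. ℕ} (hf : Nat.Partrec f) : ∃ n, nu i n = f := by
  by_cases hb : ∃ N q, f = fun z => (beta N q z : Part ℕ)
  · obtain ⟨N, q, rfl⟩ := hb
    exact exists_nu_eq_beta i N q
  · push Not at hb
    obtain ⟨e, rfl⟩ := exists_alpha_eq hf hb
    obtain ⟨d, hd, hde⟩ := exists_kept (2 * e + 1)
    obtain ⟨g, hg, hu⟩ := exists_unreleased hd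
    exact ⟨2 * g, by rw [nu_unreleased hu, hg, hde]⟩

theorem not_reducible (i : ℕ) : ¬ Reducible (nu i) (dsumExcept nu i) := by
  rintro ⟨F, hF, hred⟩
  obtain ⟨cd, hcd⟩ := Code.exists_code.1 (Partrec.nat_iff.1 hF.partrec)
  set c := 2 * Encodable.encode cd with hc
  set f := Nat.pair c 0 with hf
  have hf1 : f.unpair.1 = c := by simp [hf]
  have hf2 : f.unpair.2 = 0 := by simp [hf]
  have hc2 : c / 2 = Encodable.encode cd := by omega
  have hvalid : Valid f := by
    unfold Valid
    rw [hf2]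
    simp [GiveUp]
  have hmem : F (2 * f) ∈ cd.eval (2 * f) := by
    rw [hcd]
    simp
  have hrel : ∃ s, Rel f s := by
    obtain ⟨s, hs⟩ := Code.evaln_complete.1 hmem
    refine ⟨max s (F (2 * f) + 1), Or.inr (Or.inr (Or.inl ⟨?_, ?_, F (2 * f), ?_, ?_⟩))⟩
    · rw [hf1]
      omega
    · simp [hf2]
    · omega
    · rw [hf1, hc2, ← hf]
      simpa using Code.evaln_mono (le_max_left s _) hs
  obtain ⟨s, hs⟩ := exists_first hrel
  have hlt : F (2 * f) < s := by
    rcases hs.1 with h | h | ⟨-, -, y, hy, h⟩ | ⟨h, -⟩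
    · exact absurd hvalid h
    · omega
    · rw [hf1, hc2, ← hf] at h
      have h1 := Code.evaln_sound (show y ∈ Code.evaln s (ofNat Code _) _ from h)
      rw [Denumerable.ofNat_encode] at h1
      rwa [Part.mem_unique hmem h1]
    · rw [hf1] at h
      omega
  have key := hred (2 * f)
  unfold dsumExcept at key
  rw [nu_released hs] at key
  have hne : skipIdx i (F (2 * f)).unpair.1 ≠ i := by
    unfold skipIdx
    split_ifs <;> omega
  have hk := Nat.unpair_right_le (F (2 * f))
  generalize skipIdx i (F (2 * f)).unpair.1 = j at key hne
  generalize (F (2 * f)).unpair.2 = k at key hk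
  rcases nu_cases j k with ⟨f', rfl, -, e⟩ | ⟨f', s', rfl, -, e⟩ | ⟨N, q, rfl, e⟩ <;>
    rw [e] at key
  · exact alpha_ne_beta _ _ _ (coe_option_injective key).symm
  · exact hne (marker_inj (beta_inj (coe_option_injective key)).1).1.symm
  · have h1 := (beta_inj (coe_option_injective key)).1
    have h2 : s ≤ marker i f s := (Nat.right_le_pair f s).trans (Nat.right_le_pair i _)
    have h3 := Nat.left_le_pair N q
    omega

end Numbering

section Computability

variable {α : Type*} [Primcodable α]

theorem primrecPred_exists_lt {f : α → ℕ} {R : ℕ → α → Prop} (hf : Primrec f)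
    (hR : PrimrecPred fun p : ℕ × α => R p.1 p.2) : PrimrecPred fun a => ∃ x < f a, R x a :=
  ((PrimrecRel.exists_mem_list (R := R) hR).comp (Primrec.list_range.comp hf) Primrec.id).of_eq
    fun a => by simp

theorem primrecPred_forall_lt {f : α → ℕ} {R : ℕ → α → Prop} (hf : Primrec f)
    (hR : PrimrecPred fun p : ℕ × α => R p.1 p.2) : PrimrecPred fun a => ∀ x < f a, R x a :=
  ((PrimrecRel.forall_mem_list (R := R) hR).comp (Primrec.list_range.comp hf) Primrec.id).of_eq
    fun a => by simp

theorem primrec_unpair_fst {f : α → ℕ} (hf : Primrec f) : Primrec fun a => (f a).unpair.1 :=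
  Primrec.fst.comp (Primrec.unpair.comp hf)

theorem primrec_unpair_snd {f : α → ℕ} (hf : Primrec f) : Primrec fun a => (f a).unpair.2 :=
  Primrec.snd.comp (Primrec.unpair.comp hf)

theorem primrecPred_mod_two_eq {f : α → ℕ} (hf : Primrec f) (k : ℕ) :
    PrimrecPred fun a => f a % 2 = k :=
  Primrec.eq.comp (Primrec.nat_mod.comp hf (Primrec.const 2)) (Primrec.const k)

theorem primrecPred_isSome {o : α → Option ℕ} (ho : Primrec o) :
    PrimrecPred fun a => (o a).isSome = true :=
  Primrec.eq.comp (Primrec.option_isSome.comp ho) (Primrec.const true)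

theorem primrec_evaln_div_two {c s z : α → ℕ} (hc : Primrec c) (hs : Primrec s) (hz : Primrec z) :
    Primrec fun a => Code.evaln (s a) (ofNat Code (c a / 2)) (z a) :=
  Code.primrec_evaln.comp
    ((hs.pair ((Primrec.ofNat Code).comp (Primrec.nat_div.comp hc (Primrec.const 2)))).pair hz)

theorem primrec_ev {c s z : α → ℕ} (hc : Primrec c) (hs : Primrec s) (hz : Primrec z) :
    Primrec fun a => ev (c a) (s a) (z a) :=
  Primrec.ite (primrecPred_mod_two_eq hc 0)
    (Primrec.option_some.comp (Primrec.nat_div.comp hc (Primrec.const 2)))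
    (primrec_evaln_div_two hc hs hz)

theorem primrec_E {c u z : α → ℕ} (hc : Primrec c) (hu : Primrec u) (hz : Primrec z) :
    Primrec fun a => E (c a) (u a) (z a) := by
  refine Primrec.ite (primrecPred_exists_lt hu (PrimrecPred.and ?_ ?_)) (primrec_ev hc hu hz)
    (Primrec.const none)
  · exact Primrec.nat_lt.comp (Primrec₂.natPair.comp (hz.comp Primrec.snd) Primrec.fst)
      (hu.comp Primrec.snd)
  · exact primrecPred_isSome
      (primrec_ev (hc.comp Primrec.snd) Primrec.fst (hz.comp Primrec.snd))

theorem primrec_two_mul {f : α → ℕ} (hf : Primrec f) : Primrec fun a => 2 * f a :=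
  Primrec.nat_mul.comp (Primrec.const 2) hf

theorem primrec_beta {N q z : α → ℕ} (hN : Primrec N) (hq : Primrec q) (hz : Primrec z) :
    Primrec fun a => beta (N a) (q a) (z a) := by
  refine Primrec.ite (Primrec.nat_lt.comp hz (primrec_two_mul hN))
    (Primrec.option_some.comp (Primrec.option_getD.comp (primrec_E ?_ ?_ hz) (Primrec.const 0)))
    (Primrec.ite (Primrec.eq.comp hz (primrec_two_mul hN)) (Primrec.option_some.comp hq)
      (Primrec.const none))
  · exact primrec_unpair_fst (primrec_unpair_fst (primrec_unpair_snd hN))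
  · exact primrec_unpair_snd (primrec_unpair_snd hN)

theorem primrecPred_isBeta {c u : α → ℕ} (hc : Primrec c) (hu : Primrec u) :
    PrimrecPred fun a => IsBeta (c a) (u a) := by
  refine primrecPred_exists_lt hu (primrecPred_forall_lt
    (Primrec.nat_mul.comp (Primrec.const 3) (hu.comp Primrec.snd)) ?_)
  have hc' : Primrec fun p : ℕ × ℕ × α => c p.2.2 := hc.comp (Primrec.snd.comp Primrec.snd)
  have hu' : Primrec fun p : ℕ × ℕ × α => u p.2.2 := hu.comp (Primrec.snd.comp Primrec.snd)
  have hN : Primrec fun p : ℕ × ℕ × α => p.2.1 := Primrec.fst.comp Primrec.snd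
  exact Primrec.eq.comp (primrec_E hc' hu' Primrec.fst)
    (primrec_beta hN (Primrec.option_getD.comp (primrec_E hc' hu' (primrec_two_mul hN))
      (Primrec.const 0)) Primrec.fst)

open Classical in
theorem primrec_A {c s z : α → ℕ} (hc : Primrec c) (hs : Primrec s) (hz : Primrec z) :
    Primrec fun a => A (c a) (s a) (z a) :=
  Primrec.ite (primrecPred_exists_lt (Primrec.succ.comp hs) (PrimrecPred.and
    (primrecPred_isBeta (hc.comp Primrec.snd) Primrec.fst).not
    (primrecPred_isSome (primrec_E (hc.comp Primrec.snd) Primrec.fst (hz.comp Primrec.snd)))))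
    (primrec_E hc hs hz) (Primrec.const none)

theorem primrecPred_giveUp {c t s : α → ℕ} (hc : Primrec c) (ht : Primrec t) (hs : Primrec s) :
    PrimrecPred fun a => GiveUp (c a) (t a) (s a) := by
  have hc' : Primrec fun p : ℕ × α => c p.2 := hc.comp Primrec.snd
  have hs' : Primrec fun p : ℕ × α => s p.2 := hs.comp Primrec.snd
  have hA : Primrec fun p : ℕ × α => A (c p.2) (s p.2) p.1 := primrec_A hc' hs' Primrec.fst
  refine (Primrec.eq.comp ht (Primrec.const 0)).or (PrimrecPred.or ?_ ?_)
  · refine (primrecPred_mod_two_eq hc 0).and ((Primrec.eq.comp ht (Primrec.const 1)).and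
      (primrecPred_exists_lt hs ?_))
    exact Primrec.eq.comp (primrec_evaln_div_two hc' hs'
      (primrec_two_mul (Primrec₂.natPair.comp hc' (Primrec.const 0))))
      (Primrec.option_some.comp Primrec.fst)
  · refine (primrecPred_mod_two_eq hc 1).and
      ((Primrec.nat_lt.comp ht (Primrec.succ.comp hs)).and (PrimrecPred.or ?_ ?_))
    · refine primrecPred_exists_lt hc (primrecPred_forall_lt (ht.comp Primrec.snd) ?_)
      exact Primrec.eq.comp
        (primrec_A (Primrec.fst.comp Primrec.snd) (hs'.comp Primrec.snd) Primrec.fst)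
        (primrec_A (hc'.comp Primrec.snd) (hs'.comp Primrec.snd) Primrec.fst)
    · exact primrecPred_forall_lt ht ((primrecPred_isSome hA).and
        (Primrec.eq.comp hA (primrec_A hc' hs' (Primrec.const 0))))

theorem primrecPred_valid {f : α → ℕ} (hf : Primrec f) : PrimrecPred fun a => Valid (f a) := by
  have hc := primrec_unpair_fst hf
  have ht := primrec_unpair_fst (primrec_unpair_snd hf)
  have hs := primrec_unpair_snd (primrec_unpair_snd hf)
  exact (primrecPred_giveUp hc ht hs).and (primrecPred_forall_lt hs
    (primrecPred_giveUp (hc.comp Primrec.snd) (ht.comp Primrec.snd) Primrec.fst).not)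

theorem primrecPred_rel {f s : α → ℕ} (hf : Primrec f) (hs : Primrec s) :
    PrimrecPred fun a => Rel (f a) (s a) :=
  (primrecPred_valid hf).not.or (primrecPred_giveUp (primrec_unpair_fst hf)
    (Primrec.succ.comp (primrec_unpair_fst (primrec_unpair_snd hf))) hs)

theorem primrecPred_firstRel {f s : α → ℕ} (hf : Primrec f) (hs : Primrec s) :
    PrimrecPred fun a => FirstRel (f a) (s a) :=
  (primrecPred_rel hf hs).and
    (primrecPred_forall_lt hs (primrecPred_rel (hf.comp Primrec.snd) Primrec.fst).not)

open Classical in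
theorem primrec_shift {i N q : α → ℕ} (hi : Primrec i) (hN : Primrec N) (hq : Primrec q) :
    Primrec fun a => shift (i a) (N a) (q a) :=
  Primrec.ite ((Primrec.eq.comp (primrec_unpair_fst hN) hi).and
    (primrecPred_firstRel (primrec_unpair_fst (primrec_unpair_snd hN))
      (primrec_unpair_snd (primrec_unpair_snd hN)))) (Primrec.succ.comp hq) hq

open Classical in
theorem primrec_followerStep {i f x u : α → ℕ} (hi : Primrec i) (hf : Primrec f) (hx : Primrec x)
    (hu : Primrec u) : Primrec fun a => followerStep (i a) (f a) (x a) (u a) :=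
  Primrec.ite (primrecPred_firstRel hf hu)
    (primrec_beta (Primrec₂.natPair.comp hi (Primrec₂.natPair.comp hf hu)) (Primrec.const 0) hx)
    (Primrec.ite (primrecPred_exists_lt hu (primrecPred_rel (hf.comp Primrec.snd) Primrec.fst))
      (Primrec.const none) (primrec_A (primrec_unpair_fst hf) hu hx))

theorem primrec_step {i n x u : α → ℕ} (hi : Primrec i) (hn : Primrec n) (hx : Primrec x)
    (hu : Primrec u) : Primrec fun a => step (i a) (n a) (x a) (u a) := by
  have hn2 : Primrec fun a => n a / 2 := Primrec.nat_div.comp hn (Primrec.const 2)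
  have hN := primrec_unpair_fst hn2
  exact Primrec.ite (primrecPred_mod_two_eq hn 0) (primrec_followerStep hi hn2 hx hu)
    (primrec_beta hN (primrec_shift hi hN (primrec_unpair_snd hn2)) hx)

theorem partrec_nu {i n x : α → ℕ} (hi : Primrec i) (hn : Primrec n) (hx : Primrec x) :
    Partrec fun a => nu (i a) (n a) (x a) :=
  Partrec.rfindOpt (f := fun a u => step (i a) (n a) (x a) u)
    (primrec_step (hi.comp Primrec.fst) (hn.comp Primrec.fst) (hx.comp Primrec.fst)
      Primrec.snd).to_comp

end Computability

end FriedbergSequence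

/-- There is a uniformly c.e. independent sequence of Friedberg numberings of 𝒫⁽¹⁾. -/
theorem independent_friedberg_sequence :
    ∃ ν : ℕ → ℕ → ℕ →. ℕ, UniformlyCE ν ∧
      (∀ i, IsFriedberg PCF (ν i)) ∧
      ∀ i, ¬ Reducible (ν i) (dsumExcept ν i) := by
  open FriedbergSequence in
  refine ⟨nu, ?_, fun i => ⟨⟨⟨fun n => ?_, fun f hf => exists_nu_eq i hf⟩, ?_⟩, nu_injective i⟩,
    not_reducible⟩
  · exact partrec_nu (Primrec.fst.comp Primrec.fst) (Primrec.snd.comp Primrec.fst) Primrec.snd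
  · exact Partrec.nat_iff.1 (partrec_nu (Primrec.const i) (Primrec.const n) Primrec.id)
  · exact partrec_nu (Primrec.const i) Primrec.fst Primrec.snd
end

section
/- The Rogers semilattice of 𝒫⁽¹⁾ is not a lattice, and moreover there exist two computable numberings of 𝒫⁽¹⁾ with no common lower bound: there are computable numberings ν and μ of 𝒫⁽¹⁾ such that no computable numbering ρ of 𝒫⁽¹⁾ satisfies ρ ≤ ν and ρ ≤ μ. -/
open Nat.Partrec (Code)

/-- The standard numbering of the partial computable functions. -/
def univ (e : ℕ) : ℕ →. ℕ := Code.eval (Denumerable.ofNat Code e)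

/-- The function with domain `{0}` and value `k` there. -/
def pointFn (k : ℕ) : ℕ →. ℕ := fun y => bif y == 0 then Part.some k else Part.none

/-- A numbering of the partial computable functions whose domain is not `{0}`: the index
`Nat.pair e x` stands for `univ e` if that is defined at `x + 1`, and for the empty function
otherwise. -/
def offPoint (n : ℕ) : ℕ →. ℕ := fun y =>
  (univ n.unpair.1 (n.unpair.2 + 1)).bind fun _ => univ n.unpair.1 y

/-- A numbering in which `pointFn k` has the single index `2 * k`. -/
def uniqueNumbering (i : ℕ) : ℕ →. ℕ := fun y =>
  bif i.bodd then offPoint i.div2 y else pointFn i.div2 y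

/-- A numbering in which `pointFn k` has at most the indices `4 * k` and `4 * k + 2`, and the
value of `univ k` at `k` is not among them. -/
def diagNumbering (i : ℕ) : ℕ →. ℕ := fun y =>
  bif i.bodd then offPoint i.div2 y
  else bif y == 0 then Part.some i.div2.div2
  else (univ i.div2.div2 i.div2.div2).bind fun v => bif v == i then Part.some 0 else Part.none

theorem partrec₂_univ : Partrec₂ univ :=
  Code.eval_part.comp ((Computable.ofNat Code).comp Computable.fst) Computable.snd

theorem exists_univ_eq {f : ℕ →. ℕ} (hf : Nat.Partrec f) : ∃ e, univ e = f := by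
  obtain ⟨c, rfl⟩ := Code.exists_code.1 hf
  exact ⟨Encodable.encode c, by simp [univ]⟩

theorem partrec₂_pointFn : Partrec₂ pointFn :=
  Partrec.cond (Primrec.beq.to_comp.comp Computable.snd (Computable.const 0))
    Computable.fst.partrec Partrec.none

theorem partrec₂_offPoint : Partrec₂ offPoint := by
  have hu : Computable fun p : ℕ × ℕ => p.1.unpair :=
    Computable.unpair.comp Computable.fst
  have he : Computable fun p : ℕ × ℕ => p.1.unpair.1 := Computable.fst.comp hu
  have hx : Computable fun p : ℕ × ℕ => p.1.unpair.2 + 1 :=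
    Computable.succ.comp (Computable.snd.comp hu)
  exact (partrec₂_univ.comp he hx).bind
    (partrec₂_univ.comp (he.comp Computable.fst) (Computable.snd.comp Computable.fst)).to₂

theorem partrec₂_uniqueNumbering : Partrec₂ uniqueNumbering := by
  have hd : Computable fun p : ℕ × ℕ => p.1.div2 :=
    Primrec.nat_div2.to_comp.comp Computable.fst
  exact Partrec.cond (Primrec.nat_bodd.to_comp.comp Computable.fst)
    (partrec₂_offPoint.comp hd Computable.snd) (partrec₂_pointFn.comp hd Computable.snd)

theorem partrec₂_diagNumbering : Partrec₂ diagNumbering := by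
  have hd : Computable fun p : ℕ × ℕ => p.1.div2 :=
    Primrec.nat_div2.to_comp.comp Computable.fst
  have hdd : Computable fun p : ℕ × ℕ => p.1.div2.div2 :=
    Primrec.nat_div2.to_comp.comp hd
  have hkill : Partrec₂ fun (p : ℕ × ℕ) (v : ℕ) =>
      (bif v == p.1 then Part.some 0 else Part.none : Part ℕ) :=
    Partrec.cond
      (Primrec.beq.to_comp.comp Computable.snd (Computable.fst.comp Computable.fst))
      (Computable.const 0).partrec Partrec.none
  exact Partrec.cond (Primrec.nat_bodd.to_comp.comp Computable.fst)
    (partrec₂_offPoint.comp hd Computable.snd)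
    (Partrec.cond (Primrec.beq.to_comp.comp Computable.snd (Computable.const 0))
      hdd.partrec ((partrec₂_univ.comp hdd hdd).bind hkill))

theorem mem_PCF_of_partrec₂ {ν : ℕ → ℕ →. ℕ} (h : Partrec₂ ν) (i : ℕ) : ν i ∈ PCF :=
  Partrec.nat_iff.1 (h.comp (Computable.const i) Computable.id)

theorem offPoint_ne_pointFn (n k : ℕ) : offPoint n ≠ pointFn k := by
  intro h
  have h0 : k ∈ offPoint n 0 := by simp [h, pointFn]
  obtain ⟨v, hv, -⟩ := Part.mem_bind_iff.1 h0
  have hx : v ∈ offPoint n (n.unpair.2 + 1) := Part.mem_bind_iff.2 ⟨v, hv, hv⟩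
  simp [h, pointFn] at hx

theorem exists_pointFn_or_offPoint {f : ℕ →. ℕ} (hf : f ∈ PCF) :
    (∃ k, f = pointFn k) ∨ ∃ n, f = offPoint n := by
  obtain ⟨e, rfl⟩ := exists_univ_eq hf
  by_cases hx : ∃ x v, v ∈ univ e (x + 1)
  · obtain ⟨x, v, hv⟩ := hx
    refine .inr ⟨Nat.pair e x, funext fun y => ?_⟩
    simp [offPoint, Part.eq_some_iff.2 hv]
  · push Not at hx
    have hnone (x : ℕ) : univ e (x + 1) = Part.none := Part.eq_none_iff.2 (hx x)
    by_cases h0 : ∃ k, k ∈ univ e 0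
    · obtain ⟨k, hk⟩ := h0
      refine .inl ⟨k, funext fun y => ?_⟩
      cases y with
      | zero => simpa [pointFn] using Part.eq_some_iff.2 hk
      | succ y => simp [pointFn, hnone]
    · push Not at h0
      refine .inr ⟨Nat.pair e 0, funext fun y => ?_⟩
      cases y with
      | zero => simp [offPoint, hnone 0, Part.eq_none_iff.2 h0]
      | succ y => simp [offPoint, hnone]

theorem uniqueNumbering_odd (n : ℕ) : uniqueNumbering (2 * n + 1) = offPoint n := by
  funext y
  simp [uniqueNumbering, Nat.div2_val]

theorem uniqueNumbering_even (k : ℕ) : uniqueNumbering (2 * k) = pointFn k := by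
  funext y
  simp [uniqueNumbering, Nat.div2_val]

theorem diagNumbering_odd (n : ℕ) : diagNumbering (2 * n + 1) = offPoint n := by
  funext y
  simp [diagNumbering, Nat.div2_val]

theorem pointFn_injective : Function.Injective pointFn := fun k l h => by
  simpa [pointFn] using congrFun h 0

theorem eq_of_uniqueNumbering_eq {i k : ℕ} (h : uniqueNumbering i = pointFn k) : i = 2 * k := by
  obtain ⟨n, rfl | rfl⟩ := Nat.even_or_odd' i
  · rw [uniqueNumbering_even] at h
    rw [pointFn_injective h]
  · rw [uniqueNumbering_odd] at h
    exact (offPoint_ne_pointFn n k h).elim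

theorem diagNumbering_eq_pointFn {i k : ℕ} (hi : i = 4 * k ∨ i = 4 * k + 2)
    (hv : i ∉ univ k k) : diagNumbering i = pointFn k := by
  have hb : i.bodd = false := by rcases hi with rfl | rfl <;> simp
  have hd : i.div2.div2 = k := by simp only [Nat.div2_val]; lia
  funext y
  cases y with
  | zero => simp [diagNumbering, pointFn, hb, hd]
  | succ y =>
    have hnone : diagNumbering i (y + 1) = Part.none := by
      refine Part.eq_none_iff.2 fun w hw => ?_
      simp only [diagNumbering, hb, hd, cond_false,
        beq_eq_false_iff_ne.2 (Nat.succ_ne_zero y)] at hw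
      obtain ⟨v, hv', hw⟩ := Part.mem_bind_iff.1 hw
      have hvi : v ≠ i := by rintro rfl; exact hv hv'
      rw [beq_eq_false_iff_ne.2 hvi] at hw
      exact Part.notMem_none _ hw
    simp [hnone, pointFn]

theorem notMem_univ_of_diagNumbering_eq {i k : ℕ} (h : diagNumbering i = pointFn k) :
    i ∉ univ k k := by
  intro hv
  obtain ⟨n, rfl | rfl⟩ := Nat.even_or_odd' i
  · have h0 := congrFun h 0
    have h1 := congrFun h 1
    simp only [diagNumbering, pointFn, Nat.bodd_mul, Nat.bodd_two, Bool.false_and, cond_false,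
      beq_self_eq_true, cond_true, Part.some_inj] at h0
    simp only [diagNumbering, pointFn, Nat.bodd_mul, Nat.bodd_two, Bool.false_and, cond_false,
      h0, Part.eq_some_iff.2 hv] at h1
    simp at h1
  · rw [diagNumbering_odd] at h
    exact offPoint_ne_pointFn n k h

theorem isCompNumbering_uniqueNumbering : IsCompNumbering PCF uniqueNumbering := by
  refine ⟨⟨mem_PCF_of_partrec₂ partrec₂_uniqueNumbering, fun f hf => ?_⟩, partrec₂_uniqueNumbering⟩
  obtain ⟨k, rfl⟩ | ⟨n, rfl⟩ := exists_pointFn_or_offPoint hf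
  · exact ⟨_, uniqueNumbering_even k⟩
  · exact ⟨_, uniqueNumbering_odd n⟩

theorem isCompNumbering_diagNumbering : IsCompNumbering PCF diagNumbering := by
  refine ⟨⟨mem_PCF_of_partrec₂ partrec₂_diagNumbering, fun f hf => ?_⟩, partrec₂_diagNumbering⟩
  obtain ⟨k, rfl⟩ | ⟨n, rfl⟩ := exists_pointFn_or_offPoint hf
  · by_cases hv : 4 * k ∈ univ k k
    · refine ⟨_, diagNumbering_eq_pointFn (.inr rfl) fun hv' => ?_⟩
      have := Part.mem_unique hv hv'
      lia
    · exact ⟨_, diagNumbering_eq_pointFn (.inl rfl) hv⟩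
  · exact ⟨_, diagNumbering_odd n⟩

/-- No computable function finds a `diagNumbering`-index of `pointFn k` from `k`. -/
theorem not_computable_of_diagNumbering_eq {t : ℕ → ℕ}
    (ht : ∀ k, diagNumbering (t k) = pointFn k) : ¬ Computable t := by
  intro hc
  obtain ⟨e, he⟩ := exists_univ_eq (Partrec.nat_iff.1 hc.partrec)
  exact notMem_univ_of_diagNumbering_eq (ht e) (by simp [he])

theorem Computable.exists_comp_eq {f g : ℕ → ℕ} (hf : Computable f) (hg : Computable g)
    (h : ∀ k, ∃ n, f n = g k) : ∃ s : ℕ → ℕ, Computable s ∧ ∀ k, f (s k) = g k := by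
  classical
  refine ⟨fun k => Nat.find (h k), ?_, fun k => Nat.find_spec (h k)⟩
  have hb : Computable₂ fun k n => f n == g k :=
    Primrec.beq.to_comp.comp (hf.comp Computable.snd) (hg.comp Computable.fst)
  refine (Partrec.rfind hb.partrec₂).of_eq fun k => Part.eq_some_iff.2 ?_
  refine Nat.mem_rfind.2 ⟨?_, fun {m} hm => ?_⟩
  · simpa using Nat.find_spec (h k)
  · simpa using Nat.find_min (h k) hm

/-- The Rogers semilattice of 𝒫⁽¹⁾ is not a lattice: there exist two computable
numberings of 𝒫⁽¹⁾ with no common lower bound. -/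
theorem no_common_lower_bound :
    ∃ ν μ : ℕ → ℕ →. ℕ, IsCompNumbering PCF ν ∧ IsCompNumbering PCF μ ∧
      ∀ ρ : ℕ → ℕ →. ℕ, IsCompNumbering PCF ρ →
        ¬ (Reducible ρ ν ∧ Reducible ρ μ) := by
  refine ⟨uniqueNumbering, diagNumbering, isCompNumbering_uniqueNumbering,
    isCompNumbering_diagNumbering, ?_⟩
  rintro ρ ⟨⟨-, hρ⟩, -⟩ ⟨⟨f, hf, hfρ⟩, g, hg, hgρ⟩
  obtain ⟨s, hs, hfs⟩ := hf.exists_comp_eq Primrec.nat_double.to_comp fun k => by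
    obtain ⟨n, hn⟩ := hρ _ (mem_PCF_of_partrec₂ partrec₂_pointFn k)
    exact ⟨n, eq_of_uniqueNumbering_eq ((hfρ n).symm.trans hn)⟩
  refine not_computable_of_diagNumbering_eq (t := fun k => g (s k)) (fun k => ?_) (hg.comp hs)
  rw [← hgρ, hfρ, hfs, uniqueNumbering_even]
end
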